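/- Fix an integer p ≥ 2 and c ∈ (0,1/2), and let γ_n, β_n, α_n, θ_n, a_n, c_n, k_n(t) be as in the standing setup. Then for every u > 0 and every t > 0, lim_{n→∞} 𝔼[ν_n^t(u,∞)] = 2p·t·u^{-1}, where 𝔼 denotes expectation over the environment (the i.i.d. Gaussian couplings) and ν_n^t(u,∞) = k_n(t)·𝒫(Σ_{j=1}^{θ_n} e^{β_n H_n(J_n(j))} e_{n,j} > c_n u^{β_n/γ_n} | H_n). -/

import Mathlib

open MeasureTheory ProbabilityTheory Filter Real Finset

/-- Configuration space: the hypercube `Σ_n = {−1,1}^n`, encoded as `Fin n → Bool`,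
with the Hamming distance as graph distance. -/
abbrev V (n : ℕ) := Fin n → Bool

/-- Overlap `R_n(x,x') = 1 − 2·dist(x,x')/n`. -/
noncomputable def overlap (n : ℕ) (x y : V n) : ℝ := 1 - 2 * (hammingDist x y : ℝ) / n

/-- `γ_n = n^{-c}`. -/
noncomputable def γseq (c : ℝ) (n : ℕ) : ℝ := (n : ℝ) ^ (-c)

/-- Block length `θ_n = 3n²`. -/
def θseq (n : ℕ) : ℕ := 3 * n ^ 2

/-- Jump scale `a_n = √(2πn)·γ_n⁻¹·e^{γ_n²n/2}`. -/
noncomputable def aseq (c : ℝ) (n : ℕ) : ℝ :=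
  Real.sqrt (2 * π * n) * (γseq c n)⁻¹ * Real.exp ((γseq c n) ^ 2 * n / 2)

/-- Time scale `c_n = e^{γ_nβ_n n}`. -/
noncomputable def cseq (c : ℝ) (β : ℕ → ℝ) (n : ℕ) : ℝ := Real.exp (γseq c n * β n * n)

/-- `k_n(t) = ⌊⌊a_n t⌋/θ_n⌋`. -/
noncomputable def kseq (c : ℝ) (n : ℕ) (t : ℝ) : ℕ := ⌊aseq c n * t⌋₊ / θseq n

/-- `X` is a centered Gaussian random vector with covariance `Δ`: every linear combination
of its coordinates is a centered real Gaussian with the corresponding variance. -/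
def IsCenteredGaussianVector {Ω : Type*} [MeasurableSpace Ω] (P : Measure Ω)
    {I : Type*} [Fintype I] (X : I → Ω → ℝ) (Δ : I → I → ℝ) : Prop :=
  ∀ c : I → ℝ, Measure.map (fun ω => ∑ i, c i * X i ω) P =
    gaussianReal 0 (Real.toNNReal (∑ i, ∑ j, c i * c j * Δ i j))

/-- Joint law of the dynamics: `J n` is the simple random walk on `Σ_n` started from the
uniform distribution, `(e n j)` are i.i.d. mean-one exponentials, and the walk and the
exponentials are independent; all of this is encoded through the joint finite-dimensional
distributions. -/
def WalkExpLaw {Ω' : Type*} [MeasurableSpace Ω'] (Pw : Measure Ω')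
    (J : (n : ℕ) → ℕ → Ω' → V n) (e : ℕ → ℕ → Ω' → ℝ) : Prop :=
  ∀ (n m : ℕ) (xs : Fin (m + 1) → V n) (ys : Fin (m + 1) → ℝ), (∀ k, 0 ≤ ys k) →
    Pw {ω' | (∀ k : Fin (m + 1), J n k ω' = xs k) ∧ (∀ k : Fin (m + 1), ys k < e n k ω')} =
      ENNReal.ofReal (((2 : ℝ) ^ n)⁻¹ *
        ∏ k : Fin m, (if hammingDist (xs k.castSucc) (xs k.succ) = 1 then (n : ℝ)⁻¹ else 0)) *
      ENNReal.ofReal (Real.exp (-∑ k, ys k))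

/-- `ν_n^t(u,∞) = k_n(t)·𝒫(Σ_{j=1}^{θ_n} e^{β_n h(J_n(j))} e_{n,j} > c_n u^{β_n/γ_n})`,
for a fixed realization `h` of the environment. -/
noncomputable def nuSum {Ω' : Type*} [MeasurableSpace Ω'] (Pw : Measure Ω')
    (J : (n : ℕ) → ℕ → Ω' → V n) (e : ℕ → ℕ → Ω' → ℝ)
    (c : ℝ) (β : ℕ → ℝ) (n : ℕ) (t u : ℝ) (h : V n → ℝ) : ℝ :=
  (kseq c n t : ℝ) *
    (Pw {ω' | cseq c β n * u ^ (β n / γseq c n) <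
      ∑ j ∈ Icc 1 (θseq n), Real.exp (β n * h (J n j ω')) * e n j ω'}).toReal

noncomputable def wT (n : ℕ) (x y : V n) : ℝ :=
  if hammingDist x y = 1 then (n : ℝ)⁻¹ else 0

noncomputable def wP (n m : ℕ) (xs : Fin (m + 1) → V n) : ℝ :=
  ((2 : ℝ) ^ n)⁻¹ * ∏ k : Fin m, wT n (xs k.castSucc) (xs k.succ)

lemma wT_nonneg (n : ℕ) (x y : V n) : 0 ≤ wT n x y := by
  unfold wT; split_ifs <;> positivity

lemma wP_nonneg (n m : ℕ) (xs : Fin (m + 1) → V n) : 0 ≤ wP n m xs :=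
  mul_nonneg (by positivity) (Finset.prod_nonneg fun _ _ => wT_nonneg _ _ _)

lemma wP_snoc (n m : ℕ) (xs : Fin (m + 1) → V n) (y : V n) :
    wP n (m + 1) (Fin.snoc (α := fun _ => V n) xs y) = wP n m xs * wT n (xs (Fin.last m)) y := by
  unfold wP
  rw [Fin.prod_univ_castSucc, ← mul_assoc]
  congr 1
  · congr 1
    refine Finset.prod_congr rfl fun k _ => ?_
    rw [Fin.succ_castSucc, Fin.snoc_castSucc, Fin.snoc_castSucc]
  · rw [Fin.snoc_castSucc, Fin.succ_last, Fin.snoc_last]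

def flipc {n : ℕ} (x : V n) (k : Fin n) : V n := Function.update x k (!x k)

lemma flipc_inj {n : ℕ} (x : V n) : Function.Injective (flipc x) := by
  intro k l h
  by_contra hkl
  have := congrFun h k
  simp [flipc, Function.update_of_ne hkl] at this

lemma dist_flipc {n : ℕ} (a x : V n) (k : Fin n) :
    hammingDist a (flipc x k) = if a k = x k then hammingDist a x + 1 else hammingDist a x - 1 := by
  have hf1 : ∀ i, i ≠ k → flipc x k i = x i := fun i hik => by
    unfold flipc; rw [Function.update_of_ne hik]
  have hf2 : flipc x k k = !x k := by unfold flipc; rw [Function.update_self]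
  unfold hammingDist
  split_ifs with h
  · have : (Finset.univ.filter fun i => a i ≠ flipc x k i) = insert k (Finset.univ.filter fun i => a i ≠ x i) := by
      ext i
      simp only [Finset.mem_filter, Finset.mem_univ, true_and, Finset.mem_insert]
      by_cases hik : i = k
      · subst hik; rw [hf2, h]; simp
      · rw [hf1 i hik]; simp [hik]
    rw [this, Finset.card_insert_of_notMem (by simp [h])]
  · have : (Finset.univ.filter fun i => a i ≠ flipc x k i) = Finset.erase (Finset.univ.filter fun i => a i ≠ x i) k := by
      ext i
      simp only [Finset.mem_filter, Finset.mem_univ, true_and, Finset.mem_erase]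
      by_cases hik : i = k
      · subst hik
        rw [hf2]
        revert h; cases a i <;> cases x i <;> simp
      · rw [hf1 i hik]; simp [hik]
    rw [this, Finset.card_erase_of_mem (by simp [h])]

lemma nbr_eq {n : ℕ} (x : V n) :
    (Finset.univ.filter fun y : V n => hammingDist x y = 1) = Finset.univ.image (flipc x) := by
  ext y
  simp only [Finset.mem_filter, Finset.mem_univ, true_and, Finset.mem_image]
  constructor
  · intro h
    unfold hammingDist at h
    obtain ⟨k, hk⟩ := Finset.card_eq_one.1 h
    refine ⟨k, ?_⟩
    funext i
    have hi : (x i ≠ y i) ↔ i = k := by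
      have := Finset.ext_iff.1 hk i
      simpa using this
    by_cases hik : i = k
    · subst hik
      have := hi.2 rfl
      simp [flipc]
      revert this; cases x i <;> cases y i <;> simp
    · have : x i = y i := by by_contra h'; exact hik (hi.1 h')
      simp [flipc, hik, this]
  · rintro ⟨k, rfl⟩
    rw [dist_flipc]; simp

lemma sum_wT {n : ℕ} (a x : V n) (φ : ℕ → ℝ) :
    ∑ y, wT n x y * φ (hammingDist a y) =
      (1 - (hammingDist a x : ℝ) / n) * φ (hammingDist a x + 1) * (if n = 0 then 0 else 1)
        + (hammingDist a x : ℝ) / n * φ (hammingDist a x - 1) := by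
  have h1 : ∑ y, wT n x y * φ (hammingDist a y)
      = ∑ y ∈ Finset.univ.filter (fun y : V n => hammingDist x y = 1),
        (n : ℝ)⁻¹ * φ (hammingDist a y) := by
    rw [Finset.sum_filter]
    refine Finset.sum_congr rfl fun y _ => ?_
    unfold wT; split_ifs <;> simp
  rw [h1, nbr_eq, Finset.sum_image (fun _ _ _ _ h => flipc_inj x h)]
  rcases Nat.eq_zero_or_pos n with hn | hn
  · subst hn; simp
  have hn' : (n : ℝ) ≠ 0 := by positivity
  rw [if_neg hn.ne', ← Finset.mul_sum]
  have h2 : ∀ k, φ (hammingDist a (flipc x k)) =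
      if a k ≠ x k then φ (hammingDist a x - 1) else φ (hammingDist a x + 1) := by
    intro k; rw [dist_flipc]; by_cases h : a k = x k <;> simp [h]
  simp_rw [h2]
  rw [Finset.sum_ite]
  simp only [Finset.sum_const, nsmul_eq_mul]
  have h3 : (#{k | a k ≠ x k} : ℝ) = hammingDist a x := rfl
  have h4 : (#{k | ¬ a k ≠ x k} : ℝ) = n - hammingDist a x := by
    have := Finset.card_filter_add_card_filter_not (s := (Finset.univ : Finset (Fin n))) (fun k => a k ≠ x k)
    rw [Finset.card_univ, Fintype.card_fin] at this
    have h5 : (#{k | a k ≠ x k} : ℝ) + (#{k | ¬ a k ≠ x k} : ℝ) = n := by exact_mod_cast this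
    rw [← h3]; linarith
  rw [h3, h4]
  field_simp
  ring

lemma sum_wT_one {n : ℕ} (hn : n ≠ 0) (x : V n) : ∑ y, wT n x y = 1 := by
  have := sum_wT x x (fun _ => 1)
  simpa [hn] using this

lemma sum_snoc {n m : ℕ} (F : (Fin (m + 2) → V n) → ℝ) :
    ∑ xs, F xs = ∑ xs : Fin (m + 1) → V n, ∑ y, F (Fin.snoc (α := fun _ => V n) xs y) := by
  rw [← (Fin.snocEquiv (fun _ : Fin (m + 2) => V n)).sum_comp, Fintype.sum_prod_type, Finset.sum_comm]
  rfl

lemma sum_wP {n : ℕ} (hn : n ≠ 0) (m : ℕ) : ∑ xs, wP n m xs = 1 := by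
  induction m with
  | zero =>
    simp only [wP, Finset.univ_eq_empty, Finset.prod_empty, mul_one, Finset.sum_const]
    simp
  | succ m ih =>
    rw [sum_snoc]
    simp_rw [wP_snoc, ← Finset.mul_sum, sum_wT_one hn, mul_one]
    exact ih

section law
variable {Ω' : Type*} [MeasurableSpace Ω'] {Pw : Measure Ω'} [IsProbabilityMeasure Pw]
    {J : (n : ℕ) → ℕ → Ω' → V n} {e : ℕ → ℕ → Ω' → ℝ}

/-- path up to time m -/
def pathJ (J : (n : ℕ) → ℕ → Ω' → V n) (n m : ℕ) (ω' : Ω') : Fin (m + 1) → V n :=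
  fun k => J n k ω'

lemma measurable_pathJ (hJmeas : ∀ n i, Measurable (J n i)) (n m : ℕ) :
    Measurable (pathJ J n m) := measurable_pi_lambda _ fun k => hJmeas n k

lemma law_set (hJmeas : ∀ n i, Measurable (J n i)) (hemeas : ∀ n i, Measurable (e n i))
    (hlaw : WalkExpLaw Pw J e) (n m : ℕ) (S : Finset (Fin (m + 1) → V n))
    (ys : Fin (m + 1) → ℝ) (hy : ∀ k, 0 ≤ ys k) :
    Pw.real {ω' | pathJ J n m ω' ∈ S ∧ ∀ k : Fin (m + 1), ys k < e n k ω'} =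
      (∑ xs ∈ S, wP n m xs) * Real.exp (-∑ k, ys k) := by
  have h1 : {ω' | pathJ J n m ω' ∈ S ∧ ∀ k : Fin (m + 1), ys k < e n k ω'} =
      ⋃ xs ∈ S, {ω' | (∀ k : Fin (m + 1), J n k ω' = xs k) ∧ (∀ k : Fin (m + 1), ys k < e n k ω')} := by
    ext ω'
    simp only [Set.mem_ofPred_eq, Set.mem_iUnion, exists_prop]
    constructor
    · rintro ⟨h, h'⟩; exact ⟨_, h, fun k => rfl, h'⟩
    · rintro ⟨xs, hx, h, h'⟩
      have : pathJ J n m ω' = xs := funext h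
      exact ⟨this ▸ hx, h'⟩
  rw [h1, measureReal_biUnion_finset]
  · rw [Finset.sum_mul]
    refine Finset.sum_congr rfl fun xs _ => ?_
    rw [Measure.real, hlaw n m xs ys hy, ENNReal.toReal_mul, ENNReal.toReal_ofReal,
      ENNReal.toReal_ofReal (Real.exp_pos _).le]
    · rfl
    · exact wP_nonneg n m xs
  · intro xs _ xs' _ hne
    refine Set.disjoint_left.2 fun ω' h h' => hne ?_
    funext k; rw [← h.1 k, h'.1 k]
  · intro xs _
    have h2 : {ω' | (∀ k : Fin (m + 1), J n k ω' = xs k) ∧ (∀ k : Fin (m + 1), ys k < e n k ω')} =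
      (⋂ k : Fin (m + 1), {ω' | J n k ω' = xs k}) ∩ (⋂ k : Fin (m + 1), {ω' | ys k < e n k ω'}) := by
      ext; simp
    rw [h2]
    refine MeasurableSet.inter ?_ ?_
    · exact MeasurableSet.iInter fun k => (hJmeas n k) (measurableSet_singleton (xs k))
    · exact MeasurableSet.iInter fun k => measurableSet_lt measurable_const (hemeas n k)

lemma law_exp (hJmeas : ∀ n i, Measurable (J n i)) (hemeas : ∀ n i, Measurable (e n i))
    (hlaw : WalkExpLaw Pw J e) {n : ℕ} (hn : n ≠ 0) (m : ℕ)
    (ys : Fin (m + 1) → ℝ) (hy : ∀ k, 0 ≤ ys k) :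
    Pw.real {ω' | ∀ k : Fin (m + 1), ys k < e n k ω'} = Real.exp (-∑ k, ys k) := by
  have := law_set hJmeas hemeas hlaw n m Finset.univ ys hy
  simpa [sum_wP hn] using this

lemma law_e_pos (hJmeas : ∀ n i, Measurable (J n i)) (hemeas : ∀ n i, Measurable (e n i))
    (hlaw : WalkExpLaw Pw J e) {n : ℕ} (hn : n ≠ 0) (m : ℕ) :
    ∀ᵐ ω' ∂Pw, ∀ k : Fin (m + 1), 0 < e n k ω' := by
  have := law_exp hJmeas hemeas hlaw hn m (fun _ => 0) (fun _ => le_rfl)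
  simp only [Finset.sum_const_zero, neg_zero, Real.exp_zero] at this
  have hm : MeasurableSet {ω' | ∀ k : Fin (m + 1), 0 < e n k ω'} := by
    have : {ω' | ∀ k : Fin (m + 1), 0 < e n k ω'} = ⋂ k : Fin (m + 1), {ω' | 0 < e n k ω'} := by
      ext; simp
    rw [this]
    exact MeasurableSet.iInter fun k => measurableSet_lt measurable_const (hemeas n k)
  rw [measureReal_def, ENNReal.toReal_eq_one_iff, ← mem_ae_iff_prob_eq_one hm] at this
  exact this

lemma law_path (hJmeas : ∀ n i, Measurable (J n i)) (hemeas : ∀ n i, Measurable (e n i))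
    (hlaw : WalkExpLaw Pw J e) {n : ℕ} (hn : n ≠ 0) (m : ℕ) (S : Finset (Fin (m + 1) → V n)) :
    Pw.real {ω' | pathJ J n m ω' ∈ S} = ∑ xs ∈ S, wP n m xs := by
  have h := law_set hJmeas hemeas hlaw n m S (fun _ => 0) (fun _ => le_rfl)
  simp only [Finset.sum_const_zero, neg_zero, Real.exp_zero, mul_one] at h
  rw [← h]
  refine measureReal_congr ?_
  filter_upwards [law_e_pos hJmeas hemeas hlaw hn m] with ω' hω'
  refine propext ⟨fun h => ⟨h, hω'⟩, fun h => h.1⟩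

/-- independence of path and exponentials, in the form needed -/
lemma law_path_exp (hJmeas : ∀ n i, Measurable (J n i)) (hemeas : ∀ n i, Measurable (e n i))
    (hlaw : WalkExpLaw Pw J e) {n : ℕ} (hn : n ≠ 0) (m : ℕ) (S : Set (Fin (m + 1) → V n))
    (y : ℝ) (hy : 0 ≤ y) :
    Pw.real {ω' | pathJ J n m ω' ∈ S ∧ ∀ k : Fin (m + 1), y < e n k ω'} =
      Pw.real {ω' | pathJ J n m ω' ∈ S} * Real.exp (-((m + 1) * y)) := by
  classical
  have h1 := law_path hJmeas hemeas hlaw hn m S.toFinset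
  have h2 := law_set hJmeas hemeas hlaw n m S.toFinset (fun _ => y) (fun _ => hy)
  simp only [Set.mem_toFinset] at h1 h2
  rw [h1, h2]; simp

lemma exp_marg (hJmeas : ∀ n i, Measurable (J n i)) (hemeas : ∀ n i, Measurable (e n i))
    (hlaw : WalkExpLaw Pw J e) {n : ℕ} (hn : n ≠ 0) (j : ℕ) (y : ℝ) (hy : 0 ≤ y) :
    Pw.real {ω' | y < e n j ω'} = Real.exp (-y) := by
  have h := law_exp hJmeas hemeas hlaw hn j (fun k => if k = Fin.last j then y else 0)
    (fun k => by split_ifs <;> simp [hy])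
  rw [Finset.sum_ite_eq' Finset.univ (Fin.last j), if_pos (Finset.mem_univ _)] at h
  rw [← h]
  refine measureReal_congr ?_
  filter_upwards [law_e_pos hJmeas hemeas hlaw hn j] with ω' hω'
  refine propext ⟨fun (h : y < e n j ω') k => ?_, fun h => ?_⟩
  · split_ifs with hk
    · subst hk; simpa using h
    · exact hω' k
  · have := h (Fin.last j)
    show y < e n j ω'
    simpa using this

lemma integral_path (hJmeas : ∀ n i, Measurable (J n i)) (hemeas : ∀ n i, Measurable (e n i))
    (hlaw : WalkExpLaw Pw J e) {n : ℕ} (hn : n ≠ 0) (m : ℕ) (F : (Fin (m + 1) → V n) → ℝ) :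
    ∫ ω', F (pathJ J n m ω') ∂Pw = ∑ xs, wP n m xs * F xs := by
  have hm := measurable_pathJ hJmeas n m
  rw [← integral_map (φ := pathJ J n m) (f := F) hm.aemeasurable
    (Measurable.of_discrete.aestronglyMeasurable)]
  have : IsProbabilityMeasure (Pw.map (pathJ J n m)) := Measure.isProbabilityMeasure_map hm.aemeasurable
  rw [integral_fintype (Integrable.of_finite)]
  refine Finset.sum_congr rfl fun xs _ => ?_
  rw [map_measureReal_apply hm (measurableSet_singleton _)]
  have := law_path hJmeas hemeas hlaw hn m {xs}
  simp only [Finset.mem_singleton, Finset.sum_singleton] at this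
  rw [smul_eq_mul, ← this]; rfl

lemma integral_path_step (hJmeas : ∀ n i, Measurable (J n i)) (hemeas : ∀ n i, Measurable (e n i))
    (hlaw : WalkExpLaw Pw J e) {n : ℕ} (hn : n ≠ 0) {i l : ℕ} (hil : i ≤ l) (φ : ℕ → ℝ) :
    ∫ ω', φ (hammingDist (J n i ω') (J n (l + 1) ω')) ∂Pw =
      ∫ ω', ((1 - (hammingDist (J n i ω') (J n l ω') : ℝ) / n)
          * φ (hammingDist (J n i ω') (J n l ω') + 1)
        + (hammingDist (J n i ω') (J n l ω') : ℝ) / n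
          * φ (hammingDist (J n i ω') (J n l ω') - 1)) ∂Pw := by
  let a : Fin (l + 1) := ⟨i, by omega⟩
  have h1 := integral_path hJmeas hemeas hlaw hn (l + 1)
    (fun xs => φ (hammingDist (xs a.castSucc) (xs (Fin.last _))))
  have h2 := integral_path hJmeas hemeas hlaw hn l
    (fun xs => (1 - (hammingDist (xs a) (xs (Fin.last _)) : ℝ) / n)
          * φ (hammingDist (xs a) (xs (Fin.last _)) + 1)
        + (hammingDist (xs a) (xs (Fin.last _)) : ℝ) / n
          * φ (hammingDist (xs a) (xs (Fin.last _)) - 1))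
  refine Eq.trans ?_ (h1.trans (Eq.trans ?_ (h2.symm.trans ?_)))
  · rfl
  · rw [sum_snoc]
    refine Finset.sum_congr rfl fun xs _ => ?_
    simp_rw [wP_snoc, Fin.snoc_castSucc, Fin.snoc_last, mul_assoc (wP n l xs), ← Finset.mul_sum]
    congr 1
    rw [sum_wT, if_neg hn, mul_one]
  · rfl
end law

section law2
variable {Ω' : Type*} [MeasurableSpace Ω'] {Pw : Measure Ω'} [IsProbabilityMeasure Pw]
    {J : (n : ℕ) → ℕ → Ω' → V n} {e : ℕ → ℕ → Ω' → ℝ}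

lemma measurable_hdist (hJmeas : ∀ n i, Measurable (J n i)) (n i l : ℕ) :
    Measurable (fun ω' => hammingDist (J n i ω') (J n l ω')) := by
  have h : Measurable (fun q : V n × V n => hammingDist q.1 q.2) := Measurable.of_discrete
  exact h.comp ((hJmeas n i).prodMk (hJmeas n l))

lemma integrable_phi_dist (hJmeas : ∀ n i, Measurable (J n i)) (n i l : ℕ) (φ : ℕ → ℝ) :
    Integrable (fun ω' => φ (hammingDist (J n i ω') (J n l ω'))) Pw := by
  have hm : Measurable (fun ω' => φ (hammingDist (J n i ω') (J n l ω'))) :=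
    (Measurable.of_discrete (f := φ)).comp (measurable_hdist hJmeas n i l)
  refine Integrable.of_bound (C := ∑ d ∈ Finset.range (n + 1), |φ d|) hm.aestronglyMeasurable ?_
  refine Eventually.of_forall fun ω' => ?_
  rw [Real.norm_eq_abs]
  refine Finset.single_le_sum (f := fun d => |φ d|) (fun _ _ => abs_nonneg _) ?_
  have := hammingDist_le_card_fintype (x := J n i ω') (y := J n l ω')
  rw [Fintype.card_fin] at this
  exact Finset.mem_range.2 (by omega)

lemma dist_step (hJmeas : ∀ n i, Measurable (J n i)) (hemeas : ∀ n i, Measurable (e n i))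
    (hlaw : WalkExpLaw Pw J e) {n : ℕ} (hn : n ≠ 0) (l : ℕ) :
    ∀ᵐ ω' ∂Pw, hammingDist (J n l ω') (J n (l + 1) ω') = 1 := by
  have h := integral_path_step hJmeas hemeas hlaw hn (le_refl l) (fun d => if d = 1 then 0 else 1)
  simp at h
  rw [integral_eq_zero_iff_of_nonneg] at h
  · filter_upwards [h] with ω' hω'
    by_contra hne
    simp [hne] at hω'
  · intro ω'; simp only [Pi.zero_apply]; split_ifs <;> simp
  · exact integrable_phi_dist hJmeas n l (l + 1) (fun d => if d = 1 then 0 else 1)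

lemma dist_le (hJmeas : ∀ n i, Measurable (J n i)) (hemeas : ∀ n i, Measurable (e n i))
    (hlaw : WalkExpLaw Pw J e) {n : ℕ} (hn : n ≠ 0) :
    ∀ᵐ ω' ∂Pw, ∀ i j : ℕ, hammingDist (J n i ω') (J n (i + j) ω') ≤ j := by
  filter_upwards [ae_all_iff.2 (dist_step hJmeas hemeas hlaw hn)] with ω' h i j
  induction j with
  | zero => simp
  | succ j ih =>
    have h1 := hammingDist_triangle (J n i ω') (J n (i + j) ω') (J n (i + j + 1) ω')
    have h2 := h (i + j)
    rw [← add_assoc]; omega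

lemma mean_dist (hJmeas : ∀ n i, Measurable (J n i)) (hemeas : ∀ n i, Measurable (e n i))
    (hlaw : WalkExpLaw Pw J e) {n : ℕ} (hn : n ≠ 0) (i j : ℕ) :
    (j : ℝ) - (j : ℝ) ^ 2 / n ≤ ∫ ω', (hammingDist (J n i ω') (J n (i + j) ω') : ℝ) ∂Pw := by
  have hnp : (0 : ℝ) < n := by positivity
  induction j with
  | zero => simp
  | succ j ih =>
    have h := integral_path_step hJmeas hemeas hlaw hn (show i ≤ i + j by omega) (fun d => (d : ℝ))
    rw [← add_assoc, h]
    have hIntg := integrable_phi_dist (Pw := Pw) hJmeas n i (i + j) (fun d => (d : ℝ))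
    have h2 : ∫ ω', (((hammingDist (J n i ω') (J n (i + j) ω') : ℝ)) + (1 - 2 * j / n)) ∂Pw ≤
      ∫ ω', ((1 - (hammingDist (J n i ω') (J n (i + j) ω') : ℝ) / n)
          * ((hammingDist (J n i ω') (J n (i + j) ω') + 1 : ℕ) : ℝ)
        + (hammingDist (J n i ω') (J n (i + j) ω') : ℝ) / n
          * ((hammingDist (J n i ω') (J n (i + j) ω') - 1 : ℕ) : ℝ)) ∂Pw := by
      refine integral_mono_ae (hIntg.add (integrable_const _))
        (integrable_phi_dist (Pw := Pw) hJmeas n i (i + j)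
          (fun d => (1 - (d : ℝ) / n) * ((d + 1 : ℕ) : ℝ) + (d : ℝ) / n * ((d - 1 : ℕ) : ℝ))) ?_
      filter_upwards [dist_le hJmeas hemeas hlaw hn] with ω' hω'
      have h3 := hω' i j
      generalize hammingDist (J n i ω') (J n (i + j) ω') = d at h3
      have h3' : (d : ℝ) ≤ j := by exact_mod_cast h3
      have h4 : (d : ℝ) / n ≤ j / n := by gcongr
      rcases Nat.eq_zero_or_pos d with hd | hd
      · subst hd; simp; positivity
      · rw [Nat.cast_sub (by omega : 1 ≤ d)]
        push_cast
        have : (2 : ℝ) * j / n = 2 * (j / n) := by ring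
        rw [this]
        nlinarith
    rw [integral_add hIntg (integrable_const _)] at h2
    simp only [integral_const, probReal_univ, one_smul] at h2
    refine le_trans ?_ h2
    refine le_trans ?_ (add_le_add ih le_rfl)
    push_cast
    have : ((j : ℝ) + 1) ^ 2 / n = j ^ 2 / n + 2 * j / n + 1 / n := by ring
    rw [this]
    have : (0 : ℝ) < 1 / n := by positivity
    linarith

lemma exp_drift {lam : ℝ} (h0 : 0 < lam) (h1 : lam ≤ 1 / 4) {n d : ℝ} (hn : 0 < n) (hd : 0 ≤ d)
    (hdn : d ≤ n) :
    (1 - d / n) * exp (-lam * (d + 1)) + d / n * exp (-lam * (d - 1)) ≤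
      (1 - lam / 4) * exp (-lam * d) + exp (-lam * (n / 4 - 1)) := by
  have hq1 : d / n ≤ 1 := (div_le_one hn).2 hdn
  have hq0 : 0 ≤ d / n := by positivity
  by_cases h : d ≤ n / 4
  · have hq : d / n ≤ 1 / 4 := by rw [div_le_iff₀ hn]; linarith
    have e1 : exp (-lam * (d + 1)) = exp (-lam * d) * exp (-lam) := by rw [← Real.exp_add]; ring_nf
    have e2 : exp (-lam * (d - 1)) = exp (-lam * d) * exp lam := by rw [← Real.exp_add]; ring_nf
    have b1 : exp lam ≤ 1 + lam + lam ^ 2 := by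
      have := Real.abs_exp_sub_one_sub_id_le (x := lam) (by rw [abs_of_pos h0]; linarith)
      have := le_abs_self (exp lam - 1 - lam); linarith
    have b2 : exp (-lam) ≤ 1 - lam + lam ^ 2 := by
      have := Real.abs_exp_sub_one_sub_id_le (x := -lam) (by rw [abs_neg, abs_of_pos h0]; linarith)
      have := le_abs_self (exp (-lam) - 1 - -lam); nlinarith
    have b3 : exp (-lam) ≤ exp lam := Real.exp_le_exp.2 (by linarith)
    have key : (1 - d / n) * exp (-lam) + d / n * exp lam ≤ 1 - lam / 4 := by
      nlinarith
    have := Real.exp_pos (-lam * d)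
    have := Real.exp_pos (-lam * (n / 4 - 1))
    rw [e1, e2]
    nlinarith
  · push Not at h
    have b1 : exp (-lam * (d + 1)) ≤ exp (-lam * (n / 4 - 1)) := Real.exp_le_exp.2 (by nlinarith)
    have b2 : exp (-lam * (d - 1)) ≤ exp (-lam * (n / 4 - 1)) := Real.exp_le_exp.2 (by nlinarith)
    have : 0 ≤ (1 - lam / 4) * exp (-lam * d) := mul_nonneg (by linarith) (Real.exp_pos _).le
    nlinarith

lemma mean_exp_dist (hJmeas : ∀ n i, Measurable (J n i)) (hemeas : ∀ n i, Measurable (e n i))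
    (hlaw : WalkExpLaw Pw J e) {n : ℕ} (hn : n ≠ 0) {lam : ℝ} (h0 : 0 < lam) (h1 : lam ≤ 1 / 4)
    (i j : ℕ) :
    ∫ ω', (exp (-lam * (hammingDist (J n i ω') (J n (i + j) ω') : ℝ))
        + exp (-lam * (n - (hammingDist (J n i ω') (J n (i + j) ω') : ℝ)))) ∂Pw ≤
      2 * exp (-(lam * j / 4)) + 8 / lam * exp (-lam * (n / 4 - 1)) := by
  have hnp : (0 : ℝ) < n := by positivity
  suffices hs : ∫ ω', (exp (-lam * (hammingDist (J n i ω') (J n (i + j) ω') : ℝ))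
        + exp (-lam * (n - (hammingDist (J n i ω') (J n (i + j) ω') : ℝ)))) ∂Pw ≤
      2 * (1 - lam / 4) ^ j + 8 / lam * exp (-lam * (n / 4 - 1)) by
    refine hs.trans ?_
    gcongr
    have : exp (-(lam * j / 4)) = exp (-(lam / 4)) ^ j := by rw [← Real.exp_nat_mul]; ring_nf
    rw [this]
    have := Real.add_one_le_exp (-(lam / 4))
    exact pow_le_pow_left₀ (by linarith) (by linarith) j
  induction j with
  | zero =>
    simp only [add_zero, hammingDist_self, Nat.cast_zero, mul_zero, Real.exp_zero, sub_zero,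
      integral_const, probReal_univ, one_smul, pow_zero, mul_one]
    have : exp (-lam * n) ≤ 1 := Real.exp_le_one_iff.2 (by nlinarith)
    have : 0 ≤ 8 / lam * exp (-lam * (n / 4 - 1)) := by positivity
    linarith
  | succ j ih =>
    have h := integral_path_step hJmeas hemeas hlaw hn (show i ≤ i + j by omega)
      (fun d => exp (-lam * (d : ℝ)) + exp (-lam * (n - (d : ℝ))))
    rw [← add_assoc, h]
    have hIntg := integrable_phi_dist (Pw := Pw) hJmeas n i (i + j)
      (fun d => exp (-lam * (d : ℝ)) + exp (-lam * (n - (d : ℝ))))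
    set E := exp (-lam * ((n : ℝ) / 4 - 1)) with hE
    refine le_trans (integral_mono (integrable_phi_dist (Pw := Pw) hJmeas n i (i + j) (fun d =>
      (1 - (d : ℝ) / n) * (exp (-lam * ((d + 1 : ℕ) : ℝ)) + exp (-lam * (n - ((d + 1 : ℕ) : ℝ))))
      + (d : ℝ) / n * (exp (-lam * ((d - 1 : ℕ) : ℝ)) + exp (-lam * (n - ((d - 1 : ℕ) : ℝ))))))
      ((hIntg.const_mul (1 - lam / 4)).add (integrable_const (2 * E))) ?_) ?_
    · intro ω'
      have h3 := hammingDist_le_card_fintype (x := J n i ω') (y := J n (i + j) ω')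
      rw [Fintype.card_fin] at h3
      simp only [Pi.add_apply]
      generalize hammingDist (J n i ω') (J n (i + j) ω') = d at h3
      have h3' : (d : ℝ) ≤ n := by exact_mod_cast h3
      have k1 := exp_drift h0 h1 hnp (Nat.cast_nonneg d) h3'
      have k2 := exp_drift (d := n - d) h0 h1 hnp (by linarith) (by linarith)
      have e1 : 1 - ((n : ℝ) - d) / n = d / n := by field_simp; ring
      have e2 : ((n : ℝ) - d) / n = 1 - d / n := by field_simp
      rw [e1, e2] at k2
      rcases Nat.eq_zero_or_pos d with hd | hd
      · subst hd
        simp [hE] at k1 k2 ⊢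
        linarith
      · rw [Nat.cast_sub (by omega : 1 ≤ d)]
        push_cast
        have e3 : (n : ℝ) - (d + 1) = n - d - 1 := by ring
        have e4 : (n : ℝ) - (d - 1) = n - d + 1 := by ring
        rw [e3, e4]
        linarith
    · simp only [Pi.add_apply]
      rw [integral_add (hIntg.const_mul _) (integrable_const _), integral_const_mul]
      simp only [integral_const, probReal_univ, one_smul]
      have hmul := mul_le_mul_of_nonneg_left ih (show 0 ≤ 1 - lam / 4 by linarith)
      refine (add_le_add hmul le_rfl).trans ?_
      rw [pow_succ]
      have : (1 - lam / 4) * (8 / lam * E) = 8 / lam * E - 2 * E := by field_simp; ring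
      linarith
end law2

set_option linter.unusedSectionVars false

section gauss
variable {Ω : Type*} [MeasurableSpace Ω] {P : Measure Ω} [IsProbabilityMeasure P]

lemma gv_comp {I ι : Type*} [Fintype I] [Fintype ι] {X : I → Ω → ℝ} {Δ : I → I → ℝ}
    (h : IsCenteredGaussianVector P X Δ) (x : ι → I) :
    IsCenteredGaussianVector P (fun k => X (x k)) (fun k l => Δ (x k) (x l)) := by
  classical
  intro c
  have h1 := h (fun i => ∑ k, if x k = i then c k else 0)
  have e1 : ∀ f : I → ℝ, ∑ i, (∑ k, if x k = i then c k else 0) * f i = ∑ k, c k * f (x k) := by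
    intro f
    simp_rw [Finset.sum_mul]
    rw [Finset.sum_comm]
    refine Finset.sum_congr rfl fun k _ => ?_
    simp [ite_mul]
  have e2 : ∑ i, ∑ j, (∑ k, if x k = i then c k else 0) * (∑ k, if x k = j then c k else 0) * Δ i j
      = ∑ i, ∑ j, c i * c j * Δ (x i) (x j) := by
    have : ∀ i, ∑ j, (∑ k, if x k = i then c k else 0) * (∑ k, if x k = j then c k else 0) * Δ i j
      = (∑ k, if x k = i then c k else 0) * ∑ l, c l * Δ i (x l) := by
      intro i
      rw [← e1 (Δ i), Finset.mul_sum]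
      exact Finset.sum_congr rfl fun j _ => by ring
    simp_rw [this]
    rw [e1 (fun i => ∑ l, c l * Δ i (x l))]
    refine Finset.sum_congr rfl fun k _ => ?_
    rw [Finset.mul_sum]
    exact Finset.sum_congr rfl fun j _ => by ring
  rw [e2] at h1
  rw [← h1]
  congr 1
  funext ω
  exact (e1 (fun i => X i ω)).symm

lemma gv_gauss {I : Type*} [Fintype I] {X : I → Ω → ℝ} {Δ : I → I → ℝ}
    (hm : ∀ i, Measurable (X i)) (h : IsCenteredGaussianVector P X Δ) :
    HasGaussianLaw (fun ω i => X i ω) P := by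
  classical
  refine ⟨isGaussian_of_map_eq_gaussianReal fun L => ⟨0,
    Real.toNNReal (∑ i, ∑ j, L (Pi.single i 1) * L (Pi.single j 1) * Δ i j), ?_⟩⟩
  · rw [Measure.map_map L.continuous.measurable (measurable_pi_lambda _ hm)]
    have h1 := h (fun i => L (Pi.single i 1))
    refine Eq.trans ?_ h1
    congr 1
    funext ω
    have : (fun i => X i ω) = ∑ i, (X i ω) • (Pi.single i 1 : I → ℝ) := by
      rw [← pi_eq_sum_univ' ]
    simp only [Function.comp]
    rw [this, map_sum]
    refine Finset.sum_congr rfl fun i _ => ?_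
    rw [map_smul, smul_eq_mul, mul_comm]

lemma gv_mean {I : Type*} [Fintype I] {X : I → Ω → ℝ} {Δ : I → I → ℝ}
    (hm : ∀ i, Measurable (X i)) (h : IsCenteredGaussianVector P X Δ) (c : I → ℝ) :
    ∫ ω, ∑ i, c i * X i ω ∂P = 0 := by
  have hmm : Measurable (fun ω => ∑ i, c i * X i ω) :=
    Finset.measurable_sum _ fun i _ => (hm i).const_mul _
  rw [← integral_map (f := fun x : ℝ => x) hmm.aemeasurable (measurable_id.aestronglyMeasurable), h c,
    integral_id_gaussianReal]

lemma gv_var {I : Type*} [Fintype I] {X : I → Ω → ℝ} {Δ : I → I → ℝ}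
    (hm : ∀ i, Measurable (X i)) (h : IsCenteredGaussianVector P X Δ) (c : I → ℝ) :
    Var[fun ω => ∑ i, c i * X i ω; P] = Real.toNNReal (∑ i, ∑ j, c i * c j * Δ i j) := by
  have hmm : Measurable (fun ω => ∑ i, c i * X i ω) :=
    Finset.measurable_sum _ fun i _ => (hm i).const_mul _
  rw [← variance_id_map hmm.aemeasurable, h c, variance_id_gaussianReal]

lemma gv_memLp {I : Type*} [Fintype I] {X : I → Ω → ℝ} {Δ : I → I → ℝ}
    (hm : ∀ i, Measurable (X i)) (h : IsCenteredGaussianVector P X Δ) (i : I) :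
    MemLp (X i) 2 P := ((gv_gauss hm h).eval i).memLp_two

lemma gv_cov {I : Type*} [Fintype I] {X : I → Ω → ℝ} {Δ : I → I → ℝ}
    (hm : ∀ i, Measurable (X i)) (h : IsCenteredGaussianVector P X Δ) (i j : I)
    (hs : Δ i j = Δ j i) (hi : 0 ≤ Δ i i) (hj : 0 ≤ Δ j j) (hij : 0 ≤ Δ i i + 2 * Δ i j + Δ j j) :
    cov[X i, X j; P] = Δ i j := by
  have h2 := gv_comp h ![i, j]
  have hm2 : ∀ k, Measurable ((fun k => X (![i, j] k)) k) := fun k => hm _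
  have v11 := gv_var hm2 h2 ![1, 1]
  have v10 := gv_var hm2 h2 ![1, 0]
  have v01 := gv_var hm2 h2 ![0, 1]
  simp only [Fin.sum_univ_two, Matrix.cons_val_zero, Matrix.cons_val_one, Matrix.cons_val_fin_one, one_mul, zero_mul,
    add_zero, zero_add, mul_zero, mul_one] at v11 v10 v01
  rw [Real.coe_toNNReal _ (by linarith)] at v11
  rw [Real.coe_toNNReal _ hi] at v10
  rw [Real.coe_toNNReal _ hj] at v01
  have := variance_fun_add (gv_memLp hm h i) (gv_memLp hm h j)
  rw [v11] at this
  have e1 : Var[X i; P] = Δ i i := v10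
  have e2 : Var[X j; P] = Δ j j := v01
  rw [e1, e2] at this
  linarith
end gauss

section field
lemma overlap_comm (n : ℕ) (x y : V n) : overlap n x y = overlap n y x := by
  unfold overlap; rw [hammingDist_comm]

lemma overlap_self (n : ℕ) (x : V n) : overlap n x x = 1 := by
  unfold overlap; simp

lemma abs_overlap_le (n : ℕ) (x y : V n) : |overlap n x y| ≤ 1 := by
  unfold overlap
  have h3 := hammingDist_le_card_fintype (x := x) (y := y)
  rw [Fintype.card_fin] at h3
  have h3' : (hammingDist x y : ℝ) ≤ n := by exact_mod_cast h3
  rcases Nat.eq_zero_or_pos n with hn | hn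
  · subst hn; simp
  have hn' : (0 : ℝ) < n := by exact_mod_cast hn
  have h4 : (hammingDist x y : ℝ) / n ≤ 1 := (div_le_one hn').2 h3'
  have h5 : 0 ≤ (hammingDist x y : ℝ) / n := by positivity
  rw [abs_le, mul_div_assoc]; constructor <;> linarith

/-- correlation -/
noncomputable def rr (p n : ℕ) (x y : V n) : ℝ := overlap n x y ^ p

lemma rr_comm (p n : ℕ) (x y : V n) : rr p n x y = rr p n y x := by
  unfold rr; rw [overlap_comm]

lemma rr_self (p n : ℕ) (x : V n) : rr p n x x = 1 := by unfold rr; rw [overlap_self, one_pow]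

lemma abs_rr_le (p n : ℕ) (x y : V n) : |rr p n x y| ≤ 1 := by
  unfold rr; rw [abs_pow]; exact pow_le_one₀ (abs_nonneg _) (abs_overlap_le n x y)

lemma rr_le_sq {p : ℕ} (hp : 2 ≤ p) (n : ℕ) (x y : V n) : rr p n x y ≤ overlap n x y ^ 2 := by
  unfold rr
  calc overlap n x y ^ p ≤ |overlap n x y ^ p| := le_abs_self _
    _ = |overlap n x y| ^ p := abs_pow _ _
    _ ≤ |overlap n x y| ^ 2 := pow_le_pow_of_le_one (abs_nonneg _) (abs_overlap_le n x y) hp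
    _ = _ := sq_abs _

lemma one_sub_rr_le (p n : ℕ) (x y : V n) (hn : n ≠ 0) : (n : ℝ) * (1 - rr p n x y) ≤ 2 * p * hammingDist x y := by
  unfold rr
  have h := one_add_mul_le_pow (a := overlap n x y - 1) (by have := (abs_le.1 (abs_overlap_le n x y)).1; linarith) p
  have h2 : overlap n x y - 1 = -(2 * (hammingDist x y : ℝ) / n) := by unfold overlap; ring
  have h3 : 1 + (overlap n x y - 1) = overlap n x y := by ring
  rw [h3, h2] at h
  have hn' : (0 : ℝ) < n := by positivity
  calc (n : ℝ) * (1 - overlap n x y ^ p) ≤ n * (p * (2 * (hammingDist x y : ℝ) / n)) := by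
        gcongr; linarith
    _ = _ := by field_simp

lemma one_sub_rr_ge {p : ℕ} (hp : 2 ≤ p) (n : ℕ) (x y : V n) (hn : n ≠ 0) :
    2 * min (hammingDist x y : ℝ) (n - hammingDist x y) ≤ n * (1 - rr p n x y) := by
  have h := rr_le_sq hp n x y
  have h3 := hammingDist_le_card_fintype (x := x) (y := y)
  rw [Fintype.card_fin] at h3
  have h3' : (hammingDist x y : ℝ) ≤ n := by exact_mod_cast h3
  have hn' : (0 : ℝ) < n := by positivity
  have h0 : (0 : ℝ) ≤ hammingDist x y := by positivity
  have e : (n : ℝ) * (1 - overlap n x y ^ 2) = 4 * hammingDist x y * (n - hammingDist x y) / n := by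
    unfold overlap; field_simp; ring
  refine le_trans ?_ (mul_le_mul_of_nonneg_left (sub_le_sub_left h 1) hn'.le)
  rw [e, le_div_iff₀ hn']
  rcases le_total (hammingDist x y : ℝ) (n - hammingDist x y) with h | h
  · rw [min_eq_left h]; nlinarith
  · rw [min_eq_right h]; nlinarith
end field

set_option linter.unusedSectionVars false
set_option linter.unusedVariables false

noncomputable def bG (g : ℝ) (n : ℕ) (s : ℝ) : ℝ := g * n + s / g
noncomputable def AG (g : ℝ) (n : ℕ) : ℝ := Real.sqrt (2 * π * n) * g * exp (g ^ 2 * n / 2)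

lemma AG_pos {g : ℝ} (hg : 0 < g) {n : ℕ} (hn : n ≠ 0) : 0 < AG g n := by
  unfold AG
  have : (0 : ℝ) < n := by positivity
  have := Real.pi_pos
  positivity

lemma bG_lt {g : ℝ} (hg : 0 < g) (n : ℕ) (s s' : ℝ) : bG g n s < bG g n s' ↔ s < s' := by
  unfold bG; rw [add_lt_add_iff_left, div_lt_div_iff_of_pos_right hg]

lemma gauss_tail_id {g : ℝ} (hg : 0 < g) {n : ℕ} (hn : n ≠ 0) (s0 : ℝ) (φ : ℝ → ℝ) :
    ∫ x, (Set.Ioi (bG g n s0)).indicator φ x ∂gaussianReal 0 n =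
      (AG g n)⁻¹ * ∫ s in Set.Ioi s0, exp (-s - s ^ 2 / (2 * g ^ 2 * n)) * φ (bG g n s) := by
  have hn' : (0 : ℝ) < n := by positivity
  have hv : (n : NNReal) ≠ 0 := by positivity
  rw [integral_gaussianReal_eq_integral_smul hv]
  set F : ℝ → ℝ := fun x => gaussianPDFReal 0 n x • (Set.Ioi (bG g n s0)).indicator φ x with hF
  have h1 : ∫ s, F (g * n + s / g) = g * ∫ x, F x := by
    rw [Measure.integral_comp_div (fun y => F (g * n + y)) g, integral_add_left_eq_self, abs_of_pos hg,
      smul_eq_mul]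
  have h2 : ∫ x, F x = g⁻¹ * ∫ s, F (g * n + s / g) := by rw [h1]; field_simp
  rw [h2, ← integral_indicator measurableSet_Ioi, ← integral_const_mul, ← integral_const_mul]
  congr 1
  funext s
  simp only [hF]
  by_cases hs : s0 < s
  · have hb : bG g n s0 < g * n + s / g := (bG_lt hg n s0 s).2 hs
    rw [Set.indicator_of_mem (show g * n + s / g ∈ Set.Ioi _ from hb),
      Set.indicator_of_mem (show s ∈ Set.Ioi _ from hs), gaussianPDFReal, smul_eq_mul]
    have he : exp (-(g * n + s / g - 0) ^ 2 / (2 * ((n : NNReal) : ℝ))) =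
        (exp (g ^ 2 * n / 2))⁻¹ * exp (-s - s ^ 2 / (2 * g ^ 2 * n)) := by
      rw [← Real.exp_neg, ← Real.exp_add]
      congr 1
      simp only [NNReal.coe_natCast]
      field_simp
      ring
    rw [he]
    unfold AG
    have : (0 : ℝ) < Real.sqrt (2 * π * n) := by positivity
    simp only [NNReal.coe_natCast, bG]
    field_simp
  · have hb : ¬ bG g n s0 < g * n + s / g := fun h => hs ((bG_lt hg n s0 s).1 h)
    rw [Set.indicator_of_notMem (show g * n + s / g ∉ Set.Ioi _ from hb),
      Set.indicator_of_notMem (show s ∉ Set.Ioi _ from hs)]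
    simp

lemma integrable_gt {g : ℝ} {n : ℕ} (s0 : ℝ) :
    IntegrableOn (fun s => exp (-s - s ^ 2 / (2 * g ^ 2 * n))) (Set.Ioi s0) := by
  have h : IntegrableOn (fun s => exp (-s)) (Set.Ioi s0) := integrableOn_exp_neg_Ioi s0
  refine Integrable.mono' h ?_ ?_
  · exact Continuous.aestronglyMeasurable (by fun_prop)
  · refine Eventually.of_forall fun s => ?_
    rw [Real.norm_eq_abs, abs_of_pos (exp_pos _)]
    exact Real.exp_le_exp.2 (by have : 0 ≤ s ^ 2 / (2 * g ^ 2 * n) := by positivity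
                                linarith)

lemma gauss_tail_le {g : ℝ} (hg : 0 < g) {n : ℕ} (hn : n ≠ 0) (s0 : ℝ) :
    (gaussianReal 0 n).real (Set.Ioi (bG g n s0)) ≤ (AG g n)⁻¹ * exp (-s0) := by
  have h := gauss_tail_id hg hn s0 (fun _ => 1)
  rw [integral_indicator measurableSet_Ioi] at h
  simp only [integral_const, smul_eq_mul, mul_one, measureReal_restrict_apply_univ] at h
  rw [h]
  have := AG_pos hg hn
  gcongr
  rw [← integral_exp_neg_Ioi s0]
  refine integral_mono (integrable_gt s0) (integrableOn_exp_neg_Ioi s0) fun s => ?_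
  exact Real.exp_le_exp.2 (by have : 0 ≤ s ^ 2 / (2 * g ^ 2 * n) := by positivity
                              linarith)

lemma gauss_tilt {n : ℕ} (hn : n ≠ 0) (τ b : ℝ) :
    ∫ x, (Set.Ioi b).indicator (fun x => exp (τ * x)) x ∂gaussianReal 0 n =
      exp (τ ^ 2 * n / 2) * (gaussianReal 0 n).real (Set.Ioi (b - τ * n)) := by
  have hn' : (0 : ℝ) < n := by positivity
  have hv : (n : NNReal) ≠ 0 := by positivity
  have h1 : (gaussianReal 0 n).real (Set.Ioi (b - τ * n)) =
      ∫ x, (Set.Ioi (b - τ * n)).indicator (fun _ => (1 : ℝ)) x ∂gaussianReal 0 n := by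
    rw [integral_indicator measurableSet_Ioi]; simp
  rw [h1, integral_gaussianReal_eq_integral_smul hv, integral_gaussianReal_eq_integral_smul hv,
    ← integral_sub_right_eq_self (fun x => gaussianPDFReal 0 (n : NNReal) x •
      (Set.Ioi (b - τ * n)).indicator (fun _ => (1 : ℝ)) x) (τ * n : ℝ), ← integral_const_mul]
  congr 1
  funext x
  by_cases hx : b < x
  · rw [Set.indicator_of_mem (show x ∈ Set.Ioi _ from hx),
      Set.indicator_of_mem (show x - τ * n ∈ Set.Ioi _ by simpa using hx)]
    simp only [gaussianPDFReal, smul_eq_mul, NNReal.coe_natCast, mul_one, sub_zero]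
    rw [mul_assoc, mul_left_comm (exp (τ ^ 2 * n / 2)), ← Real.exp_add, ← Real.exp_add]
    congr 2
    field_simp
    ring
  · rw [Set.indicator_of_notMem (show x ∉ Set.Ioi _ from hx),
      Set.indicator_of_notMem (show x - τ * n ∉ Set.Ioi _ by simpa using hx)]
    simp

section G
variable {Ω : Type*} [MeasurableSpace Ω] {P : Measure Ω} [IsProbabilityMeasure P]
  {p : ℕ} {n : ℕ} {H : V n → Ω → ℝ}

lemma fld_law (hn : n ≠ 0) (hm : ∀ x, Measurable (H x))
    (hH : IsCenteredGaussianVector P H (fun x y => (n : ℝ) * overlap n x y ^ p)) (x : V n) :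
    P.map (H x) = gaussianReal 0 n := by
  have h := gv_comp hH (fun _ : Fin 1 => x) 1
  simp [overlap_self] at h
  exact h

lemma fld_tail (hn : n ≠ 0) (hm : ∀ x, Measurable (H x))
    (hH : IsCenteredGaussianVector P H (fun x y => (n : ℝ) * overlap n x y ^ p)) {g : ℝ} (hg : 0 < g)
    (x : V n) (s : ℝ) : P.real {ω | bG g n s < H x ω} ≤ (AG g n)⁻¹ * exp (-s) := by
  refine le_trans (le_of_eq ?_) (gauss_tail_le hg hn s)
  rw [← fld_law hn hm hH x, map_measureReal_apply (hm x) measurableSet_Ioi]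
  rfl

lemma fld_cov (hn : n ≠ 0) (hm : ∀ x, Measurable (H x))
    (hH : IsCenteredGaussianVector P H (fun x y => (n : ℝ) * overlap n x y ^ p)) (x y : V n) :
    cov[H x, H y; P] = n * rr p n x y := by
  have hn' : (0 : ℝ) < n := by positivity
  have hr := abs_le.1 (abs_rr_le p n x y)
  unfold rr at *
  refine gv_cov hm hH x y ?_ ?_ ?_ ?_
  · rw [overlap_comm]
  · simp [overlap_self]
  · simp [overlap_self]
  · simp only [overlap_self, one_pow]; nlinarith

lemma fld_pair (hn : n ≠ 0) (hp : 2 ≤ p) (hm : ∀ x, Measurable (H x))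
    (hH : IsCenteredGaussianVector P H (fun x y => (n : ℝ) * overlap n x y ^ p)) {g : ℝ} (hg : 0 < g)
    (x y : V n) (s : ℝ) (hs : -(g ^ 2 * n / 2) ≤ s) :
    P.real {ω | bG g n s < H x ω ∧ bG g n s < H y ω} ≤
      (AG g n)⁻¹ * exp (-s) * (exp (-(g ^ 2 / 4) * hammingDist x y)
        + exp (-(g ^ 2 / 4) * (n - hammingDist x y))) := by
  have hn' : (0 : ℝ) < n := by positivity
  have hA := AG_pos hg hn
  have hr := abs_le.1 (abs_rr_le p n x y)
  set r := rr p n x y with hrdef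
  set b := bG g n s with hb
  have hbpos : g ^ 2 * n / 2 ≤ g * b := by
    rw [hb]; unfold bG; rw [mul_add, mul_div_cancel₀ _ hg.ne']; nlinarith
  have hb0 : 0 < b := by
    by_contra hneg; push Not at hneg
    have : 0 < g ^ 2 * n / 2 := by positivity
    nlinarith
  have hlaw := gv_comp hH ![x, y] ![1, 1]
  have hmm : Measurable (fun ω => H x ω + H y ω) := (hm x).add (hm y)
  simp only [Fin.sum_univ_two, Matrix.cons_val_zero, Matrix.cons_val_one, Matrix.cons_val_fin_one, one_mul,
    overlap_self, one_pow, mul_one] at hlaw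
  have e1 : (n : ℝ) + n * overlap n x y ^ p + (n * overlap n y x ^ p + n) = 2 * n * (1 + r) := by
    rw [hrdef]; unfold rr; rw [overlap_comm n y x]; ring
  rw [e1] at hlaw
  have hle : P.real {ω | b < H x ω ∧ b < H y ω} ≤
      (gaussianReal 0 (2 * n * (1 + r)).toNNReal).real (Set.Ioi (2 * b)) := by
    rw [← hlaw, map_measureReal_apply hmm measurableSet_Ioi]
    refine measureReal_mono ?_
    rintro ω ⟨h1, h2⟩
    show 2 * b < H x ω + H y ω
    linarith
  refine hle.trans ?_
  rcases eq_or_lt_of_le (show 0 ≤ 1 + r by linarith) with hq | hq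
  · rw [← hq, mul_zero, Real.toNNReal_zero, gaussianReal_zero_var, measureReal_def,
      Measure.dirac_apply' _ measurableSet_Ioi]
    rw [Set.indicator_of_notMem (by simp; linarith)]
    simp only [ENNReal.toReal_zero]
    positivity
  set q := (1 + r) / 2 with hqdef
  have hq0 : 0 < q := by positivity
  have hq1 : q ≤ 1 := by rw [hqdef]; linarith
  set σ := Real.sqrt q with hσ
  have hσ0 : 0 < σ := Real.sqrt_pos.2 hq0
  have hσ2 : σ ^ 2 = q := Real.sq_sqrt hq0.le
  have hscale : (gaussianReal 0 n).map (fun z => (2 * σ) * z) = gaussianReal 0 (2 * n * (1 + r)).toNNReal := by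
    rw [gaussianReal_map_const_mul, mul_zero]
    congr 1
    ext
    rw [Real.coe_toNNReal _ (by positivity)]
    push_cast
    show (2 * σ) ^ 2 * (n : ℝ) = _
    rw [mul_pow, hσ2, hqdef]; ring
  rw [← hscale, map_measureReal_apply (by fun_prop) measurableSet_Ioi]
  have hpre : (fun z => (2 * σ) * z) ⁻¹' Set.Ioi (2 * b) = Set.Ioi (bG g n (s + g * (b / σ - b))) := by
    ext z
    simp only [Set.mem_preimage, Set.mem_Ioi]
    have : bG g n (s + g * (b / σ - b)) = b / σ := by
      rw [hb]; unfold bG; field_simp; ring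
    rw [this, div_lt_iff₀ hσ0]
    constructor <;> intro h <;> nlinarith
  rw [hpre]
  refine (gauss_tail_le hg hn _).trans ?_
  rw [mul_assoc]
  refine mul_le_mul_of_nonneg_left ?_ (by positivity)
  have hσ1 : σ ≤ 1 := by
    rw [hσ]; exact Real.sqrt_le_one.2 hq1
  have key : b * ((1 - r) / 4) ≤ b / σ - b := by
    have h1 : 1 + (1 - q) / 2 ≤ 1 / σ := by
      rw [le_div_iff₀ hσ0, ← hσ2]
      nlinarith [mul_nonneg (sub_nonneg.2 hσ1) (mul_nonneg hσ0.le hσ0.le), sq_nonneg (1 - σ), mul_nonneg (sub_nonneg.2 hσ1) (sub_nonneg.2 hσ1)]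
    have h2 : (1 - q) / 2 = (1 - r) / 4 := by rw [hqdef]; ring
    rw [h2] at h1
    have := mul_le_mul_of_nonneg_left h1 hb0.le
    rw [mul_one_div] at this
    linarith
  have key2 := one_sub_rr_ge hp n x y hn
  rw [← hrdef] at key2
  have key3 : g ^ 2 / 4 * min (hammingDist x y : ℝ) (n - hammingDist x y) ≤ g * (b / σ - b) := by
    have h1 := mul_le_mul_of_nonneg_left key hg.le
    have h2 : g * (b * ((1 - r) / 4)) = (g * b) * ((1 - r) / 4) := by ring
    have h3 := mul_le_mul_of_nonneg_right hbpos (show 0 ≤ (1 - r) / 4 by linarith)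
    have h4 : g ^ 2 * n / 2 * ((1 - r) / 4) = g ^ 2 / 8 * (n * (1 - r)) := by ring
    have h5 := mul_le_mul_of_nonneg_left key2 (show 0 ≤ g ^ 2 / 8 by positivity)
    linarith
  rw [neg_add, Real.exp_add]
  refine mul_le_mul_of_nonneg_left ?_ (exp_pos _).le
  refine (Real.exp_le_exp.2 (neg_le_neg key3)).trans ?_
  have p1 := exp_pos (-(g ^ 2 / 4) * hammingDist x y)
  have p2 := exp_pos (-(g ^ 2 / 4) * ((n : ℝ) - hammingDist x y))
  rcases min_choice (hammingDist x y : ℝ) (n - hammingDist x y) with h | h <;> rw [h, ← neg_mul] <;> linarith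

lemma fld_incr (hn : n ≠ 0) (hm : ∀ x, Measurable (H x))
    (hH : IsCenteredGaussianVector P H (fun x y => (n : ℝ) * overlap n x y ^ p)) {g : ℝ} (hg : 0 < g)
    (x y : V n) (s a lam : ℝ) (hl : 0 ≤ lam) :
    P.real {ω | bG g n s < H x ω ∧ a ≤ H x ω - H y ω} ≤
      (AG g n)⁻¹ * exp (-s) * exp (-lam * a + (lam ^ 2 + g * lam) * (n * (1 - rr p n x y))) := by
  have hn' : (0 : ℝ) < n := by positivity
  set r := rr p n x y with hrdef
  set b := bG g n s with hb
  set v := n * (1 - r) with hv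
  -- G = X - Y - (1-r) X = r X - Y
  have hgl := (gv_gauss (gv_comp hH ![x, y] |> fun h => by
    exact (fun k => hm (![x, y] k) : ∀ k : Fin 2, Measurable (H (![x, y] k)))) (gv_comp hH ![x, y]))
  let L : (Fin 2 → ℝ) →L[ℝ] ℝ × ℝ :=
    (ContinuousLinearMap.proj 0).prod (r • (ContinuousLinearMap.proj 0) - ContinuousLinearMap.proj 1)
  have hXG : HasGaussianLaw (fun ω => (H x ω, r * H x ω - H y ω)) P := hgl.map_fun L
  have hLx : MemLp (H x) 2 P := gv_memLp hm hH x
  have hLy : MemLp (H y) 2 P := gv_memLp hm hH y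
  set G : Ω → ℝ := fun ω => r * H x ω - H y ω with hG
  have hGm : Measurable G := ((hm x).const_mul r).sub (hm y)
  have hcov : cov[H x, G; P] = 0 := by
    rw [hG, covariance_fun_sub_right hLx (hLx.const_mul r) hLy, covariance_const_mul_right,
      fld_cov hn hm hH, fld_cov hn hm hH, rr_self]
    rw [← hrdef]; ring
  have hind : IndepFun (H x) G P := hXG.indepFun_of_covariance_eq_zero hcov
  have hGlaw : P.map G = gaussianReal 0 (n * (1 - r ^ 2)).toNNReal := by
    have h := gv_comp hH ![x, y] ![r, -1]
    simp only [Fin.sum_univ_two, Matrix.cons_val_zero, Matrix.cons_val_one, Matrix.cons_val_fin_one,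
      overlap_self, one_pow, mul_one] at h
    have e1 : r * r * (n : ℝ) + r * -1 * (n * overlap n x y ^ p) + (-1 * r * (n * overlap n y x ^ p) + -1 * -1 * n)
        = n * (1 - r ^ 2) := by
      have : overlap n x y ^ p = r := rfl
      rw [overlap_comm n y x, this]; ring
    rw [e1] at h
    rw [← h]
    congr 1
    funext ω
    rw [hG]; ring
  have hr := abs_le.1 (abs_rr_le p n x y)
  rw [← hrdef] at hr
  -- Chernoff
  have hI : Integrable (fun ω => exp (lam * G ω)) P := by
    have := integrable_exp_mul_gaussianReal (μ := 0) (v := (n * (1 - r ^ 2)).toNNReal) lam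
    rw [← hGlaw] at this
    exact (integrable_map_measure (Continuous.aestronglyMeasurable (by fun_prop)) hGm.aemeasurable).1 this
  set φ : ℝ → ℝ := (Set.Ioi b).indicator (fun z => exp (lam * (1 - r) * z)) with hφ
  have hφm : Measurable φ := Measurable.indicator (by fun_prop) measurableSet_Ioi
  have hφ0 : ∀ z, 0 ≤ φ z := fun z => Set.indicator_nonneg (fun _ _ => (exp_pos _).le) z
  have hIφ : Integrable (fun ω => φ (H x ω)) P := by
    have h1 := integrable_exp_mul_gaussianReal (μ := 0) (v := n) (lam * (1 - r))
    have h2 : Integrable φ (gaussianReal 0 n) := h1.indicator measurableSet_Ioi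
    rw [← fld_law hn hm hH x] at h2
    exact (integrable_map_measure hφm.aestronglyMeasurable (hm x).aemeasurable).1 h2
  have hind2 : IndepFun (fun ω => φ (H x ω)) (fun ω => exp (lam * G ω)) P :=
    hind.comp hφm (by fun_prop : Measurable fun z => exp (lam * z))
  have hprod := hind2.integral_mul_eq_mul_integral hIφ.aestronglyMeasurable hI.aestronglyMeasurable
  have hIprod : Integrable (fun ω => φ (H x ω) * exp (lam * G ω)) P := hind2.integrable_mul hIφ hI
  have e1 : ∫ ω, φ (H x ω) ∂P = exp ((lam * (1 - r)) ^ 2 * n / 2) *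
      (gaussianReal 0 n).real (Set.Ioi (b - lam * (1 - r) * n)) := by
    rw [← gauss_tilt hn, ← fld_law hn hm hH x, integral_map (hm x).aemeasurable hφm.aestronglyMeasurable]
  have e2 : ∫ ω, exp (lam * G ω) ∂P = exp (n * (1 - r ^ 2) * lam ^ 2 / 2) := by
    have := mgf_gaussianReal hGlaw lam
    rw [mgf] at this
    rw [this, Real.coe_toNNReal _ (mul_nonneg hn'.le (by nlinarith))]; simp
  have hset : MeasurableSet {ω | b < H x ω ∧ a ≤ H x ω - H y ω} :=
    (measurableSet_lt measurable_const (hm x)).inter (measurableSet_le measurable_const ((hm x).sub (hm y)))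
  have hle : P.real {ω | b < H x ω ∧ a ≤ H x ω - H y ω} ≤
      exp (-lam * a) * ∫ ω, φ (H x ω) * exp (lam * G ω) ∂P := by
    rw [← integral_indicator_one hset, ← integral_const_mul]
    refine integral_mono ((integrable_const (1 : ℝ)).indicator hset) (hIprod.const_mul _) fun ω => ?_
    by_cases hω : ω ∈ {ω | b < H x ω ∧ a ≤ H x ω - H y ω}
    · rw [Set.indicator_of_mem hω]
      simp only [Pi.one_apply, hφ]
      rw [Set.indicator_of_mem (show H x ω ∈ Set.Ioi b from hω.1), ← Real.exp_add, ← Real.exp_add]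
      refine Real.one_le_exp ?_
      have : -lam * a + (lam * (1 - r) * H x ω + lam * G ω) = lam * (H x ω - H y ω - a) := by
        rw [hG]; ring
      rw [this]
      exact mul_nonneg hl (by linarith [hω.2])
    · rw [Set.indicator_of_notMem hω]
      exact mul_nonneg (exp_pos _).le (mul_nonneg (hφ0 _) (exp_pos _).le)
  refine hle.trans ?_
  have e3 : ∫ ω, φ (H x ω) * exp (lam * G ω) ∂P = (∫ ω, φ (H x ω) ∂P) * ∫ ω, exp (lam * G ω) ∂P := hprod
  rw [e3, e1, e2]
  have hbb : b - lam * (1 - r) * n = bG g n (s - g * lam * v) := by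
    rw [hb, hv]; unfold bG; field_simp; ring
  rw [hbb]
  have htail := gauss_tail_le hg hn (s - g * lam * v)
  calc exp (-lam * a) * (exp ((lam * (1 - r)) ^ 2 * n / 2) * (gaussianReal 0 n).real (Set.Ioi (bG g n (s - g * lam * v)))
        * exp (n * (1 - r ^ 2) * lam ^ 2 / 2)) ≤
      exp (-lam * a) * (exp ((lam * (1 - r)) ^ 2 * n / 2) * ((AG g n)⁻¹ * exp (-(s - g * lam * v)))
        * exp (n * (1 - r ^ 2) * lam ^ 2 / 2)) := by gcongr
    _ = (AG g n)⁻¹ * (exp (-lam * a) * exp ((lam * (1 - r)) ^ 2 * n / 2) * exp (-(s - g * lam * v))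
        * exp (n * (1 - r ^ 2) * lam ^ 2 / 2)) := by ring
    _ = _ := by
      rw [← Real.exp_add, ← Real.exp_add, ← Real.exp_add, mul_assoc (AG g n)⁻¹, ← Real.exp_add]
      congr 2
      rw [hv]; ring
end G

set_option linter.unusedSectionVars false
set_option linter.unusedVariables false

section chain
variable {Ω : Type*} [MeasurableSpace Ω] {P : Measure Ω} [IsProbabilityMeasure P]
  {p : ℕ} {n : ℕ} {H : V n → Ω → ℝ}

lemma exists_pow16 (L : ℕ) (hL : 1 ≤ L) : ∃ κ : ℕ, L ≤ 16 ^ κ ∧ 16 ^ κ ≤ 16 * L := by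
  refine ⟨Nat.clog 16 L, Nat.le_pow_clog (by norm_num) L, ?_⟩
  rcases eq_or_lt_of_le hL with h | h
  · subst h; simp
  · have h1 := Nat.pow_pred_clog_lt_self (b := 16) (by norm_num) h
    have h2 : 0 < Nat.clog 16 L := Nat.clog_pos (by norm_num) h
    have h3 : 16 ^ Nat.clog 16 L = 16 * 16 ^ (Nat.clog 16 L).pred := by
      conv_lhs => rw [← Nat.succ_pred_eq_of_pos h2, Nat.pow_succ]
      ring
    rw [h3]; omega

lemma chain_bound (hn : n ≠ 0) (hm : ∀ x, Measurable (H x))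
    (hH : IsCenteredGaussianVector P H (fun x y => (n : ℝ) * overlap n x y ^ p)) {g : ℝ} (hg : 0 < g)
    (x : ℕ → V n) (hx : ∀ i j, hammingDist (x i) (x (i + j)) ≤ j) {L : ℕ} (hL : 1 ≤ L)
    {Lam : ℝ} (hLam : 1 ≤ Lam) (hδ : g ^ 2 * L * Lam ^ 2 ≤ 1) {ε : ℝ} (hε : 0 < ε) (s0 : ℝ) :
    P.real {ω | H (x 0) ω ≤ bG g n (s0 - ε) ∧ ∃ i < L, bG g n s0 < H (x i) ω} ≤
      (AG g n)⁻¹ * exp (-s0) * (exp (ε + 1024 * p) * (120 / (ε * Lam) ^ 5)) := by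
  have hA := AG_pos hg hn
  obtain ⟨κ, hκ1, hκ2⟩ := exists_pow16 L hL
  let t : ℕ → ℝ := fun k => s0 - ε * (1 / 2) ^ k
  let E : ℕ → ℕ → Set Ω := fun k m => {ω | bG g n (t (k + 1)) < H (x (m * 16 ^ (κ - (k + 1)))) ω ∧
    ε * (1 / 2) ^ (k + 1) / g ≤ H (x (m * 16 ^ (κ - (k + 1)))) ω - H (x (m / 16 * 16 ^ (κ - k))) ω}
  have hsub : {ω | H (x 0) ω ≤ bG g n (s0 - ε) ∧ ∃ i < L, bG g n s0 < H (x i) ω} ⊆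
      ⋃ k ∈ Finset.range κ, ⋃ m ∈ Finset.range (16 ^ (k + 1)), E k m := by
    rintro ω ⟨h0, i, hiL, hi⟩
    classical
    let f : ℕ → ℕ := fun k => i / 16 ^ (κ - k) * 16 ^ (κ - k)
    have hex : ∃ k, bG g n (t k) < H (x (f k)) ω := by
      refine ⟨κ, ?_⟩
      have : f κ = i := by simp [f]
      rw [this]
      refine lt_of_lt_of_le' hi ?_
      have : t κ < s0 := by
        show s0 - ε * (1 / 2) ^ κ < s0
        have : 0 < ε * (1 / 2) ^ κ := by positivity
        linarith
      exact ((bG_lt hg n _ _).2 this).le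
    have hk := Nat.find_spec hex
    have hmin : ∀ k' < Nat.find hex, ¬ bG g n (t k') < H (x (f k')) ω := fun k' h => Nat.find_min hex h
    have hle : Nat.find hex ≤ κ := Nat.find_min' hex (by
      have : f κ = i := by simp [f]
      rw [this]
      refine lt_of_lt_of_le' hi ?_
      have : t κ < s0 := by
        show s0 - ε * (1 / 2) ^ κ < s0
        have : 0 < ε * (1 / 2) ^ κ := by positivity
        linarith
      exact ((bG_lt hg n _ _).2 this).le)
    generalize Nat.find hex = k at hk hmin hle
    have hiκ : i < 16 ^ κ := by omega
    rcases k with _ | k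
    · exfalso
      have : f 0 = 0 := by simp [f, Nat.div_eq_of_lt hiκ]
      rw [this] at hk
      have e : t 0 = s0 - ε := by simp [t]
      rw [e] at hk
      linarith
    · have h1 := hmin k (by omega)
      push Not at h1
      simp only [Set.mem_iUnion, Finset.mem_range]
      refine ⟨k, by omega, i / 16 ^ (κ - (k + 1)), ?_, hk, ?_⟩
      · rw [Nat.div_lt_iff_lt_mul (by positivity), ← pow_add]
        have : k + 1 + (κ - (k + 1)) = κ := by omega
        rw [this]; exact hiκ
      · have e1 : i / 16 ^ (κ - (k + 1)) / 16 = i / 16 ^ (κ - k) := by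
          rw [Nat.div_div_eq_div_mul, ← pow_succ]
          congr 2; omega
        rw [e1]
        have e2 : ε * (1 / 2) ^ (k + 1) / g = bG g n (t (k + 1)) - bG g n (t k) := by
          simp only [bG, t]; rw [pow_succ]; field_simp; ring
        rw [e2]
        have : bG g n (t (k + 1)) < H (x (i / 16 ^ (κ - (k + 1)) * 16 ^ (κ - (k + 1)))) ω := hk
        have : H (x (i / 16 ^ (κ - k) * 16 ^ (κ - k))) ω ≤ bG g n (t k) := h1
        linarith
  have hE : ∀ k < κ, ∀ m, P.real (E k m) ≤
      (AG g n)⁻¹ * exp (-s0) * exp (ε + 1024 * p) * (120 / (ε * Lam) ^ 5 * (1 / 32) ^ (k + 1)) := by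
    intro k hk m
    have hlag : hammingDist (x (m * 16 ^ (κ - (k + 1)))) (x (m / 16 * 16 ^ (κ - k))) ≤ 16 ^ (κ - k) := by
      have e : 16 ^ (κ - k) = 16 * 16 ^ (κ - (k + 1)) := by
        rw [← pow_succ']; congr 1; omega
      have h1 := hx (m / 16 * 16 ^ (κ - k)) ((m % 16) * 16 ^ (κ - (k + 1)))
      have e2 : m / 16 * 16 ^ (κ - k) + m % 16 * 16 ^ (κ - (k + 1)) = m * 16 ^ (κ - (k + 1)) := by
        rw [e]
        conv_rhs => rw [← Nat.div_add_mod m 16]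
        ring
      rw [e2, hammingDist_comm] at h1
      refine h1.trans ?_
      rw [e]
      gcongr
      omega
    have hb := fld_incr hn hm hH hg (x (m * 16 ^ (κ - (k + 1)))) (x (m / 16 * 16 ^ (κ - k)))
      (t (k + 1)) (ε * (1 / 2) ^ (k + 1) / g) (g * Lam * 4 ^ (k + 1)) (by positivity)
    refine hb.trans ?_
    have hv := one_sub_rr_le p n (x (m * 16 ^ (κ - (k + 1)))) (x (m / 16 * 16 ^ (κ - k))) hn
    set v := (n : ℝ) * (1 - rr p n (x (m * 16 ^ (κ - (k + 1)))) (x (m / 16 * 16 ^ (κ - k)))) with hvdef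
    have hv2 : v * 16 ^ (k + 1) ≤ 512 * p * L := by
      have h1 : (hammingDist (x (m * 16 ^ (κ - (k + 1)))) (x (m / 16 * 16 ^ (κ - k))) : ℝ) ≤ 16 ^ (κ - k) := by
        exact_mod_cast hlag
      have h2 : (16 : ℝ) ^ (κ - k) * 16 ^ (k + 1) ≤ 256 * L := by
        rw [← pow_add]
        have : κ - k + (k + 1) = κ + 1 := by omega
        rw [this, pow_succ]
        have : (16 : ℝ) ^ κ ≤ 16 * L := by exact_mod_cast hκ2
        linarith
      calc v * 16 ^ (k + 1) ≤ (2 * p * 16 ^ (κ - k)) * 16 ^ (k + 1) := by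
            gcongr; exact hv.trans (by gcongr)
        _ = 2 * p * (16 ^ (κ - k) * 16 ^ (k + 1)) := by ring
        _ ≤ 2 * p * (256 * L) := by gcongr
        _ = _ := by ring
    have hv0 : 0 ≤ v := by
      have := (abs_le.1 (abs_rr_le p n (x (m * 16 ^ (κ - (k + 1)))) (x (m / 16 * 16 ^ (κ - k))))).2
      rw [hvdef]; exact mul_nonneg (by positivity) (by linarith)
    have hex : ((g * Lam * 4 ^ (k + 1)) ^ 2 + g * (g * Lam * 4 ^ (k + 1))) * v ≤ 1024 * p := by
      have h16 : ((4 : ℝ) ^ (k + 1)) ^ 2 = 16 ^ (k + 1) := by rw [← pow_mul, mul_comm, pow_mul]; norm_num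
      have h4 : (1 : ℝ) ≤ 4 ^ (k + 1) := one_le_pow₀ (by norm_num)
      have e1 : (g * Lam * 4 ^ (k + 1)) ^ 2 = g ^ 2 * Lam ^ 2 * 16 ^ (k + 1) := by rw [mul_pow, mul_pow, h16]
      have e2 : g * (g * Lam * 4 ^ (k + 1)) ≤ g ^ 2 * Lam ^ 2 * 16 ^ (k + 1) := by
        rw [← e1]
        have : 1 ≤ Lam * 4 ^ (k + 1) := by nlinarith
        have : Lam * 4 ^ (k + 1) ≤ (Lam * 4 ^ (k + 1)) ^ 2 := by nlinarith
        calc g * (g * Lam * 4 ^ (k + 1)) = g ^ 2 * (Lam * 4 ^ (k + 1)) := by ring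
          _ ≤ g ^ 2 * (Lam * 4 ^ (k + 1)) ^ 2 := by gcongr
          _ = _ := by ring
      calc ((g * Lam * 4 ^ (k + 1)) ^ 2 + g * (g * Lam * 4 ^ (k + 1))) * v
          ≤ (2 * (g ^ 2 * Lam ^ 2 * 16 ^ (k + 1))) * v := by
            gcongr; linarith
        _ = 2 * g ^ 2 * Lam ^ 2 * (v * 16 ^ (k + 1)) := by ring
        _ ≤ 2 * g ^ 2 * Lam ^ 2 * (512 * p * L) := by gcongr
        _ = 1024 * p * (g ^ 2 * L * Lam ^ 2) := by ring
        _ ≤ 1024 * p * 1 := by gcongr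
        _ = _ := by ring
    set y := ε * Lam * 2 ^ (k + 1) with hy
    have hy0 : 0 < y := by positivity
    have e3 : -(g * Lam * 4 ^ (k + 1)) * (ε * (1 / 2) ^ (k + 1) / g) = -y := by
      have : (4 : ℝ) ^ (k + 1) = 2 ^ (k + 1) * 2 ^ (k + 1) := by rw [← mul_pow]; norm_num
      rw [this, hy, one_div, inv_pow]; field_simp
    have e4 : exp (-y) ≤ 120 / (ε * Lam) ^ 5 * (1 / 32) ^ (k + 1) := by
      have h1 := Real.pow_div_factorial_le_exp y hy0.le 5
      rw [Real.exp_neg]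
      have h2 : 120 / (ε * Lam) ^ 5 * (1 / 32) ^ (k + 1) = (y ^ 5 / (Nat.factorial 5 : ℝ))⁻¹ := by
        rw [hy, mul_pow (ε * Lam)]
        have : ((2 : ℝ) ^ (k + 1)) ^ 5 = 32 ^ (k + 1) := by rw [← pow_mul, mul_comm, pow_mul]; norm_num
        rw [this]
        have : ((Nat.factorial 5 : ℕ) : ℝ) = 120 := by norm_num [Nat.factorial]
        rw [this, one_div, inv_pow]
        field_simp
      rw [h2]
      exact inv_anti₀ (by positivity) h1
    rw [e3]
    calc (AG g n)⁻¹ * exp (-t (k + 1)) * exp (-y + ((g * Lam * 4 ^ (k + 1)) ^ 2 + g * (g * Lam * 4 ^ (k + 1))) * v)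
        ≤ (AG g n)⁻¹ * exp (-s0 + ε) * exp (-y + 1024 * p) := by
          gcongr
          show -(s0 - ε * (1 / 2) ^ (k + 1)) ≤ -s0 + ε
          have : ((1 : ℝ) / 2) ^ (k + 1) ≤ 1 := pow_le_one₀ (by norm_num) (by norm_num)
          nlinarith
      _ = (AG g n)⁻¹ * exp (-s0) * exp (ε + 1024 * p) * exp (-y) := by
          rw [Real.exp_add, Real.exp_add, Real.exp_add]; ring
      _ ≤ _ := by gcongr
  refine (measureReal_mono hsub (measure_ne_top _ _)).trans ?_
  refine (measureReal_biUnion_finset_le _ _).trans ?_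
  set C := (AG g n)⁻¹ * exp (-s0) * exp (ε + 1024 * p) with hC
  have hC0 : 0 < C := by positivity
  have hk : ∀ k ∈ Finset.range κ, P.real (⋃ m ∈ Finset.range (16 ^ (k + 1)), E k m) ≤
      C * (120 / (ε * Lam) ^ 5) * (1 / 2) ^ (k + 1) := by
    intro k hk
    refine (measureReal_biUnion_finset_le _ _).trans ?_
    refine (Finset.sum_le_sum fun m _ => hE k (Finset.mem_range.1 hk) m).trans ?_
    rw [Finset.sum_const, Finset.card_range, nsmul_eq_mul]
    apply le_of_eq
    have : ((1 : ℝ) / 2) ^ (k + 1) = 16 ^ (k + 1) * (1 / 32) ^ (k + 1) := by rw [← mul_pow]; norm_num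
    rw [this]; push_cast; ring
  refine (Finset.sum_le_sum hk).trans ?_
  rw [← Finset.mul_sum]
  have hsum : ∑ i ∈ Finset.range κ, ((1 : ℝ) / 2) ^ (i + 1) ≤ 1 := by
    have : ∀ κ : ℕ, ∑ i ∈ Finset.range κ, ((1 : ℝ) / 2) ^ (i + 1) = 1 - (1 / 2) ^ κ := by
      intro κ
      induction κ with
      | zero => simp
      | succ κ ih => rw [Finset.sum_range_succ, ih, pow_succ]; ring
    rw [this]
    have : (0 : ℝ) < (1 / 2) ^ κ := by positivity
    linarith
  calc C * (120 / (ε * Lam) ^ 5) * ∑ i ∈ Finset.range κ, ((1 : ℝ) / 2) ^ (i + 1)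
      ≤ C * (120 / (ε * Lam) ^ 5) * 1 := by gcongr
    _ = _ := by rw [hC]; ring
end chain

set_option linter.unusedSectionVars false
set_option linter.unusedVariables false

/-- step law -/
noncomputable def stepLaw (m : ℝ) : Measure ℝ := gaussianReal (-m) (Real.toNNReal (2 * m))

instance (m : ℝ) : IsProbabilityMeasure (stepLaw m) := by unfold stepLaw; infer_instance

/-- law of the running maximum -/
noncomputable def maxLaw (m : ℝ) : ℕ → Measure ℝ
  | 0 => Measure.dirac 0
  | K + 1 => ((stepLaw m).prod (maxLaw m K)).map (fun q => max 0 (q.1 + q.2))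

instance instMaxLaw (m : ℝ) (K : ℕ) : IsProbabilityMeasure (maxLaw m K) := by
  induction K with
  | zero => unfold maxLaw; infer_instance
  | succ K ih =>
    unfold maxLaw
    exact Measure.isProbabilityMeasure_map (by fun_prop)

lemma maxLaw_nonneg (m : ℝ) (K : ℕ) : ∀ᵐ x ∂maxLaw m K, 0 ≤ x := by
  cases K with
  | zero =>
    unfold maxLaw
    rw [ae_dirac_iff (p := fun x : ℝ => 0 ≤ x) measurableSet_Ici]
  | succ K =>
    unfold maxLaw
    rw [ae_map_iff (f := fun q : ℝ × ℝ => max 0 (q.1 + q.2)) (p := fun x : ℝ => 0 ≤ x)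
      (Measurable.aemeasurable (by fun_prop)) measurableSet_Ici]
    exact Eventually.of_forall fun q => le_max_left _ _

lemma stepLaw_memLp (m : ℝ) : MemLp id 2 (stepLaw m) := by
  unfold stepLaw; exact memLp_id_gaussianReal' 2 (by simp)

lemma stepLaw_integrable (m : ℝ) : Integrable (fun x : ℝ => x) (stepLaw m) :=
  (stepLaw_memLp m).integrable (by norm_num)

lemma memLp_fst (m : ℝ) (K : ℕ) : MemLp (fun q : ℝ × ℝ => q.1) 2 ((stepLaw m).prod (maxLaw m K)) :=
  (stepLaw_memLp m).comp_measurePreserving (measurePreserving_fst)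

lemma maxLaw_memLp (m : ℝ) (K : ℕ) : MemLp id 2 (maxLaw m K) := by
  induction K with
  | zero =>
    unfold maxLaw
    exact MemLp.of_bound measurable_id.aestronglyMeasurable 0 (by
      rw [ae_dirac_iff (measurableSet_le (by fun_prop) measurable_const)]; simp)
  | succ K ih =>
    have h2 : MemLp (fun q : ℝ × ℝ => q.2) 2 ((stepLaw m).prod (maxLaw m K)) :=
      ih.comp_measurePreserving (measurePreserving_snd)
    unfold maxLaw
    rw [memLp_map_measure_iff measurable_id.aestronglyMeasurable (by fun_prop)]
    have h := (memLp_fst m K).add h2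
    refine h.mono (Measurable.aestronglyMeasurable (by fun_prop)) (Eventually.of_forall fun q => ?_)
    simp only [Function.comp, id, Pi.add_apply, Real.norm_eq_abs]
    rcases le_total 0 (q.1 + q.2) with h | h
    · rw [max_eq_right h]
    · rw [max_eq_left h]; simp

lemma memLp_snd (m : ℝ) (K : ℕ) : MemLp (fun q : ℝ × ℝ => q.2) 2 ((stepLaw m).prod (maxLaw m K)) :=
  (maxLaw_memLp m K).comp_measurePreserving (measurePreserving_snd)

lemma memLp_N (m : ℝ) (K : ℕ) : MemLp (fun q : ℝ × ℝ => q.1 + q.2) 2 ((stepLaw m).prod (maxLaw m K)) :=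
  (memLp_fst m K).add (memLp_snd m K)

lemma integrable_N (m : ℝ) (K : ℕ) :
    Integrable (fun q : ℝ × ℝ => q.1 + q.2) ((stepLaw m).prod (maxLaw m K)) :=
  (memLp_N m K).integrable (by norm_num)

lemma maxLaw_antitone (m : ℝ) (K : ℕ) : ∀ ψ : ℝ → ENNReal, Antitone ψ →
    ∫⁻ x, ψ x ∂maxLaw m (K + 1) ≤ ∫⁻ x, ψ x ∂maxLaw m K := by
  induction K with
  | zero =>
    intro ψ hψ
    have h1 : ∫⁻ x, ψ x ∂maxLaw m 0 = ψ 0 := by unfold maxLaw; simp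
    rw [h1]
    calc ∫⁻ x, ψ x ∂maxLaw m 1 ≤ ∫⁻ x, ψ 0 ∂maxLaw m 1 := by
          refine lintegral_mono_ae ?_
          filter_upwards [maxLaw_nonneg m 1] with x hx
          exact hψ hx
      _ = ψ 0 := by simp
  | succ K ih =>
    intro ψ hψ
    have hψm : Measurable ψ := hψ.measurable
    have key : ∀ K, ∫⁻ x, ψ x ∂maxLaw m (K + 1) = ∫⁻ y, ∫⁻ x, ψ (max 0 (x + y)) ∂stepLaw m ∂maxLaw m K := by
      intro K
      conv_lhs => unfold maxLaw
      rw [lintegral_map hψm (by fun_prop), lintegral_prod_symm]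
      exact (hψm.comp (by fun_prop)).aemeasurable
    rw [key, key]
    refine ih _ ?_
    intro y y' hyy
    refine lintegral_mono fun x => hψ (max_le_max le_rfl (by linarith))

noncomputable def eM (m : ℝ) (K : ℕ) : ℝ := ∫ x, x ∂maxLaw m K
noncomputable def fN (m : ℝ) (K : ℕ) : ℝ := ∫ q : ℝ × ℝ, max 0 (-(q.1 + q.2)) ∂(stepLaw m).prod (maxLaw m K)
noncomputable def hN (m : ℝ) (K : ℕ) : ℝ :=
  ∫ q : ℝ × ℝ, max 0 (1 - exp (q.1 + q.2)) ∂(stepLaw m).prod (maxLaw m K)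

lemma eM_nonneg (m : ℝ) (K : ℕ) : 0 ≤ eM m K := integral_nonneg_of_ae (maxLaw_nonneg m K)

lemma integrable_negN (m : ℝ) (K : ℕ) :
    Integrable (fun q : ℝ × ℝ => max 0 (-(q.1 + q.2))) ((stepLaw m).prod (maxLaw m K)) :=
  (integrable_zero _ _ _).sup (integrable_N m K).neg

lemma integrable_posN (m : ℝ) (K : ℕ) :
    Integrable (fun q : ℝ × ℝ => max 0 (q.1 + q.2)) ((stepLaw m).prod (maxLaw m K)) :=
  (integrable_zero _ _ _).sup (integrable_N m K)

lemma eM_succ (m : ℝ) (K : ℕ) : eM m (K + 1) = ∫ q : ℝ × ℝ, max 0 (q.1 + q.2) ∂(stepLaw m).prod (maxLaw m K) := by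
  unfold eM
  conv_lhs => unfold maxLaw
  rw [integral_map (by fun_prop) (by fun_prop)]

lemma int_fst (m : ℝ) (K : ℕ) : ∫ q : ℝ × ℝ, q.1 ∂(stepLaw m).prod (maxLaw m K) = -m := by
  have := integral_fun_fst (μ := stepLaw m) (ν := maxLaw m K) (f := fun x => x)
  rw [this]; simp [stepLaw]

lemma int_snd (m : ℝ) (K : ℕ) : ∫ q : ℝ × ℝ, q.2 ∂(stepLaw m).prod (maxLaw m K) = eM m K := by
  have := integral_fun_snd (μ := stepLaw m) (ν := maxLaw m K) (f := fun x => x)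
  rw [this]; simp [eM]

lemma fN_eq (m : ℝ) (K : ℕ) : fN m K = m + eM m (K + 1) - eM m K := by
  have h1 : fN m K = ∫ q : ℝ × ℝ, (max 0 (q.1 + q.2) - (q.1 + q.2)) ∂(stepLaw m).prod (maxLaw m K) := by
    unfold fN
    congr 1; funext q
    rcases le_total 0 (q.1 + q.2) with h | h
    · rw [max_eq_left (by linarith), max_eq_right h]; ring
    · rw [max_eq_right (by linarith), max_eq_left h]; ring
  rw [h1, integral_sub (integrable_posN m K) (integrable_N m K), ← eM_succ,
    integral_add ((memLp_fst m K).integrable (by norm_num)) ((memLp_snd m K).integrable (by norm_num)),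
    int_fst, int_snd]
  ring

lemma fN_antitone (m : ℝ) : Antitone (fN m) := by
  refine antitone_nat_of_succ_le fun K => ?_
  have key : ∀ K, fN m K = (∫⁻ y, ∫⁻ x, ENNReal.ofReal (max 0 (-(x + y))) ∂stepLaw m ∂maxLaw m K).toReal := by
    intro K
    unfold fN
    rw [integral_eq_lintegral_of_nonneg_ae (f := fun q : ℝ × ℝ => max 0 (-(q.1 + q.2))) (Eventually.of_forall fun q => le_max_left _ _)
      (integrable_negN m K).aestronglyMeasurable, lintegral_prod_symm]
    exact Measurable.aemeasurable (by fun_prop)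
  rw [key, key]
  refine ENNReal.toReal_mono ?_ (maxLaw_antitone m K _ ?_)
  · rw [← lintegral_prod_symm (fun q : ℝ × ℝ => ENNReal.ofReal (max 0 (-(q.1 + q.2)))) (Measurable.aemeasurable (by fun_prop))]
    have := (integrable_negN m K).lintegral_lt_top
    exact this.ne
  · intro y y' hyy
    refine lintegral_mono fun x => ENNReal.ofReal_le_ofReal (max_le_max le_rfl (by linarith))

lemma eM_sq_le {m : ℝ} (hm : 0 ≤ m) (K : ℕ) :
    ∫ x, x ^ 2 ∂maxLaw m K ≤ K * ∫ x, x ^ 2 ∂stepLaw m := by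
  induction K with
  | zero => unfold maxLaw; simp
  | succ K ih =>
    have i1 : Integrable (fun q : ℝ × ℝ => q.1 ^ 2) ((stepLaw m).prod (maxLaw m K)) := (memLp_fst m K).integrable_sq
    have i2 : Integrable (fun q : ℝ × ℝ => q.2 ^ 2) ((stepLaw m).prod (maxLaw m K)) := (memLp_snd m K).integrable_sq
    have i3 : Integrable (fun q : ℝ × ℝ => q.1 * q.2) ((stepLaw m).prod (maxLaw m K)) :=
      (stepLaw_integrable m).mul_prod ((maxLaw_memLp m K).integrable (by norm_num))
    have e1 : ∫ x, x ^ 2 ∂maxLaw m (K + 1) = ∫ q : ℝ × ℝ, (max 0 (q.1 + q.2)) ^ 2 ∂(stepLaw m).prod (maxLaw m K) := by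
      conv_lhs => unfold maxLaw
      rw [integral_map (by fun_prop) (by fun_prop)]
    have e2 : ∫ q : ℝ × ℝ, (max 0 (q.1 + q.2)) ^ 2 ∂(stepLaw m).prod (maxLaw m K) ≤
        ∫ q : ℝ × ℝ, (q.1 ^ 2 + (2 * (q.1 * q.2) + q.2 ^ 2)) ∂(stepLaw m).prod (maxLaw m K) := by
      refine integral_mono_of_nonneg (Eventually.of_forall fun q => sq_nonneg _)
        (i1.add ((i3.const_mul 2).add i2)) (Eventually.of_forall fun q => ?_)
      show (max 0 (q.1 + q.2)) ^ 2 ≤ q.1 ^ 2 + (2 * (q.1 * q.2) + q.2 ^ 2)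
      rcases le_total 0 (q.1 + q.2) with h | h
      · rw [max_eq_right h]; nlinarith
      · rw [max_eq_left h]; nlinarith [sq_nonneg (q.1 + q.2)]
    rw [e1]
    refine e2.trans ?_
    have j3 : ∫ q : ℝ × ℝ, q.1 * q.2 ∂(stepLaw m).prod (maxLaw m K) = -m * eM m K := by
      have := integral_prod_mul (μ := stepLaw m) (ν := maxLaw m K) (fun x : ℝ => x) (fun x : ℝ => x)
      rw [this]; simp [stepLaw, eM]
    have j1 : ∫ q : ℝ × ℝ, q.1 ^ 2 ∂(stepLaw m).prod (maxLaw m K) = ∫ x, x ^ 2 ∂stepLaw m := by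
      have := integral_fun_fst (μ := stepLaw m) (ν := maxLaw m K) (f := fun x => x ^ 2)
      rw [this]; simp
    have j2 : ∫ q : ℝ × ℝ, q.2 ^ 2 ∂(stepLaw m).prod (maxLaw m K) = ∫ x, x ^ 2 ∂maxLaw m K := by
      have := integral_fun_snd (μ := stepLaw m) (ν := maxLaw m K) (f := fun x => x ^ 2)
      rw [this]; simp
    have i4 : Integrable (fun q : ℝ × ℝ => 2 * (q.1 * q.2) + q.2 ^ 2) ((stepLaw m).prod (maxLaw m K)) :=
      (i3.const_mul 2).add i2
    rw [integral_add i1 i4, integral_add (i3.const_mul 2) i2, integral_const_mul, j1, j2, j3]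
    have := mul_nonneg hm (eM_nonneg m K)
    push_cast
    linarith

lemma fN_sum (m : ℝ) (K : ℕ) : ∑ j ∈ Finset.range K, fN m j = K * m + eM m K := by
  induction K with
  | zero => simp [eM, maxLaw]
  | succ K ih => rw [Finset.sum_range_succ, ih, fN_eq]; push_cast; ring

lemma eM_div {m : ℝ} (hm : 0 ≤ m) : Tendsto (fun K : ℕ => (K : ℝ)⁻¹ * eM m K) atTop (nhds 0) := by
  set σ := ∫ x, x ^ 2 ∂stepLaw m with hσ
  have hσ0 : 0 ≤ σ := integral_nonneg fun x => sq_nonneg x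
  -- eM ≤ (t + K σ / t)/... use eM ≤ 1/2 (√K + E M^2/√K)
  have hb : ∀ K : ℕ, eM m K ≤ Real.sqrt (K * σ) := by
    intro K
    refine Real.le_sqrt_of_sq_le ?_
    refine le_trans ?_ (eM_sq_le hm K)
    have h := (maxLaw_memLp m K)
    have hv := variance_eq_sub h
    have hv0 := variance_nonneg id (maxLaw m K)
    simp only [id, Pi.pow_apply] at hv hv0
    unfold eM
    linarith
  have h1 : Tendsto (fun K : ℕ => Real.sqrt (σ * (K : ℝ)⁻¹)) atTop (nhds 0) := by
    have : Tendsto (fun K : ℕ => σ * (K : ℝ)⁻¹) atTop (nhds (σ * 0)) :=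
      (tendsto_inv_atTop_nhds_zero_nat (𝕜 := ℝ)).const_mul σ
    rw [mul_zero] at this
    simpa using this.sqrt
  refine squeeze_zero (fun K => mul_nonneg (by positivity) (eM_nonneg m K)) (fun K => ?_) h1
  refine (mul_le_mul_of_nonneg_left (hb K) (by positivity)).trans (le_of_eq ?_)
  rcases Nat.eq_zero_or_pos K with h | h
  · subst h; simp
  · have hK : (0 : ℝ) < K := by exact_mod_cast h
    rw [eq_comm, Real.sqrt_eq_iff_mul_self_eq (by positivity) (by positivity)]
    have := Real.mul_self_sqrt (show 0 ≤ K * σ by positivity)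
    have e1 : (K:ℝ)⁻¹ * √(K * σ) * ((K:ℝ)⁻¹ * √(K * σ)) = (K:ℝ)⁻¹ * (K:ℝ)⁻¹ * (√(K * σ) * √(K * σ)) := by ring
    rw [e1, this]
    field_simp

lemma fN_tendsto {m : ℝ} (hm : 0 ≤ m) : Tendsto (fN m) atTop (nhds m) := by
  have hb : BddBelow (Set.range (fN m)) := ⟨0, by
    rintro _ ⟨K, rfl⟩; exact integral_nonneg fun q => le_max_left _ _⟩
  have h1 := tendsto_atTop_ciInf (fN_antitone m) hb
  have h2 := h1.cesaro
  have h3 : Tendsto (fun K : ℕ => (K : ℝ)⁻¹ * ∑ j ∈ Finset.range K, fN m j) atTop (nhds m) := by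
    have h4 := (eM_div hm).const_add m
    rw [add_zero] at h4
    refine h4.congr' ?_
    filter_upwards [eventually_gt_atTop 0] with K hK
    have hK : (0 : ℝ) < K := by exact_mod_cast hK
    rw [fN_sum]; field_simp
  have e := tendsto_nhds_unique h3 h2
  rw [← e] at h1
  exact h1

lemma fN_ge {m : ℝ} (hm : 0 ≤ m) (K : ℕ) : m ≤ fN m K := (fN_antitone m).le_of_tendsto (fN_tendsto hm) K

lemma integrable_hN (m : ℝ) (K : ℕ) :
    Integrable (fun q : ℝ × ℝ => max 0 (1 - exp (q.1 + q.2))) ((stepLaw m).prod (maxLaw m K)) := by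
  refine Integrable.of_bound (C := 1) (Measurable.aestronglyMeasurable (by fun_prop)) (Eventually.of_forall fun q => ?_)
  rw [Real.norm_eq_abs, abs_of_nonneg (le_max_left _ _)]
  exact max_le (by norm_num) (by linarith [exp_pos (q.1 + q.2)])

lemma hN_le_fN (m : ℝ) (K : ℕ) : hN m K ≤ fN m K := by
  refine integral_mono (integrable_hN m K) (integrable_negN m K) fun q => ?_
  refine max_le_max le_rfl ?_
  linarith [Real.add_one_le_exp (q.1 + q.2)]

lemma one_sub_exp_ge {y : ℝ} (hy : 0 ≤ y) : y - y ^ 2 / 2 ≤ 1 - exp (-y) := by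
  have h := Real.quadratic_le_exp_of_nonneg hy
  rw [Real.exp_neg]
  have h1 : (exp y)⁻¹ ≤ (1 + y + y ^ 2 / 2)⁻¹ := inv_anti₀ (by positivity) h
  have h2 : (1 + y + y ^ 2 / 2)⁻¹ ≤ 1 - y + y ^ 2 / 2 := by
    rw [inv_le_iff_one_le_mul₀ (by positivity)]
    nlinarith [sq_nonneg (y ^ 2)]
  linarith

lemma integrable_pow4 (m : ℝ) : Integrable (fun x : ℝ => x ^ 4) (stepLaw m) := by
  have h : MemLp id 4 (stepLaw m) := by unfold stepLaw; exact memLp_id_gaussianReal' 4 (by simp)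
  have := h.integrable_norm_pow (p := 4) (by norm_num)
  refine this.congr (Eventually.of_forall fun x => ?_)
  simp only [id, Real.norm_eq_abs]
  rw [← abs_pow, abs_of_nonneg (by positivity)]

lemma hN_ge {m : ℝ} (K : ℕ) {a : ℝ} (ha : 0 < a) :
    fN m K * (1 - a / 2) - (∫ x, x ^ 4 ∂stepLaw m) / (2 * a ^ 2) ≤ hN m K := by
  have j1 : ∫ q : ℝ × ℝ, q.1 ^ 4 ∂(stepLaw m).prod (maxLaw m K) = ∫ x, x ^ 4 ∂stepLaw m := by
    have := integral_fun_fst (μ := stepLaw m) (ν := maxLaw m K) (f := fun x => x ^ 4)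
    rw [this]; simp
  have i1 : Integrable (fun q : ℝ × ℝ => q.1 ^ 4) ((stepLaw m).prod (maxLaw m K)) :=
    (integrable_pow4 m).comp_fst _
  have hle : ∫ q : ℝ × ℝ, (max 0 (-(q.1 + q.2)) * (1 - a / 2) - q.1 ^ 4 / (2 * a ^ 2)) ∂(stepLaw m).prod (maxLaw m K)
      ≤ hN m K := by
    refine integral_mono_ae (((integrable_negN m K).mul_const _).sub (i1.div_const _)) (integrable_hN m K) ?_
    have hnn : ∀ᵐ q ∂(stepLaw m).prod (maxLaw m K), 0 ≤ q.2 :=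
      Measure.quasiMeasurePreserving_snd.ae (maxLaw_nonneg m K)
    filter_upwards [hnn] with q hq
    show max 0 (-(q.1 + q.2)) * (1 - a / 2) - q.1 ^ 4 / (2 * a ^ 2) ≤ max 0 (1 - exp (q.1 + q.2))
    rcases le_total 0 (q.1 + q.2) with h | h
    · rw [max_eq_left (by linarith)]
      have : 0 ≤ q.1 ^ 4 / (2 * a ^ 2) := by positivity
      have := le_max_left 0 (1 - exp (q.1 + q.2))
      linarith
    · rw [max_eq_right (by linarith : (0 : ℝ) ≤ -(q.1 + q.2))]
      refine le_trans ?_ (le_max_right _ _)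
      set y := -(q.1 + q.2) with hy
      have hy0 : 0 ≤ y := by linarith
      have h1 := one_sub_exp_ge hy0
      have e : q.1 + q.2 = -y := by rw [hy]; ring
      rw [e]
      refine le_trans ?_ h1
      have hyx : y ^ 4 ≤ q.1 ^ 4 := by
        have : y ≤ -q.1 := by linarith
        calc y ^ 4 ≤ (-q.1) ^ 4 := by gcongr
          _ = _ := by ring
      have key : y ^ 2 ≤ a * y + q.1 ^ 4 / a ^ 2 := by
        rcases le_total y a with hya | hya
        · have : 0 ≤ q.1 ^ 4 / a ^ 2 := by positivity
          nlinarith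
        · have h2 : y ^ 2 ≤ y ^ 4 / a ^ 2 := by
            rw [le_div_iff₀ (by positivity)]
            have : a ^ 2 ≤ y ^ 2 := by gcongr
            nlinarith [sq_nonneg y]
          have h3 : y ^ 4 / a ^ 2 ≤ q.1 ^ 4 / a ^ 2 := by gcongr
          have : 0 ≤ a * y := by positivity
          linarith
      have : q.1 ^ 4 / (2 * a ^ 2) = q.1 ^ 4 / a ^ 2 / 2 := by field_simp
      rw [this]
      linarith
  rw [integral_sub ((integrable_negN m K).mul_const _) (i1.div_const _), integral_mul_const, integral_div, j1] at hle
  exact hle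

lemma fourth_moment : ∃ C : ℝ, 0 < C ∧ ∀ m : ℝ, 0 ≤ m → m ≤ 1 → ∫ x, x ^ 4 ∂stepLaw m ≤ C * m ^ 2 := by
  set κ := ∫ x, x ^ 4 ∂gaussianReal 0 1 with hκ
  have hκ0 : 0 ≤ κ := integral_nonneg fun x => by positivity
  have hIntg : Integrable (fun x : ℝ => x ^ 4) (gaussianReal 0 1) := by
    have h : MemLp id 4 (gaussianReal 0 1) := memLp_id_gaussianReal' 4 (by simp)
    have := h.integrable_norm_pow (p := 4) (by norm_num)
    refine this.congr (Eventually.of_forall fun x => ?_)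
    simp only [id, Real.norm_eq_abs]
    rw [← abs_pow, abs_of_nonneg (by positivity)]
  refine ⟨8 + 32 * κ, by positivity, fun m hm0 hm1 => ?_⟩
  have hmap : (gaussianReal 0 1).map (fun z => Real.sqrt (2 * m) * z - m) = stepLaw m := by
    have : (fun z => Real.sqrt (2 * m) * z - m) = (fun z => z - m) ∘ (fun z => Real.sqrt (2 * m) * z) := rfl
    rw [this, ← Measure.map_map (by fun_prop) (by fun_prop), gaussianReal_map_const_mul, gaussianReal_map_sub_const]
    unfold stepLaw
    congr 1
    · simp
    · ext
      push_cast
      rw [mul_one, Real.coe_toNNReal _ (by positivity)]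
      exact Real.sq_sqrt (by positivity)
  rw [← hmap, integral_map (by fun_prop) (by fun_prop)]
  have hb : ∀ z : ℝ, (Real.sqrt (2 * m) * z - m) ^ 4 ≤ 8 * m ^ 2 + 32 * m ^ 2 * z ^ 4 := by
    intro z
    set w := Real.sqrt (2 * m) * z with hw
    have hw4 : w ^ 4 = 4 * m ^ 2 * z ^ 4 := by
      have := Real.sq_sqrt (show 0 ≤ 2 * m by positivity)
      rw [hw, mul_pow]
      have : Real.sqrt (2 * m) ^ 4 = (Real.sqrt (2 * m) ^ 2) ^ 2 := by ring
      rw [this, Real.sq_sqrt (by positivity)]; ring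
    have h1 : (w - m) ^ 4 ≤ 8 * (w ^ 4 + m ^ 4) := by
      have a1 : (w - m) ^ 2 ≤ 2 * (w ^ 2 + m ^ 2) := by nlinarith [sq_nonneg (w + m)]
      have a2 : ((w - m) ^ 2) ^ 2 ≤ (2 * (w ^ 2 + m ^ 2)) ^ 2 := by gcongr
      nlinarith [sq_nonneg (w ^ 2 - m ^ 2)]
    have h2 : m ^ 4 ≤ m ^ 2 := by
      have : m ^ 2 ≤ 1 := by nlinarith
      nlinarith [sq_nonneg m]
    nlinarith
  refine (integral_mono_of_nonneg (Eventually.of_forall fun z => by positivity)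
    ((integrable_const _).add (hIntg.const_mul _)) (Eventually.of_forall hb)).trans ?_
  simp only [Pi.add_apply]
  have e1 : ∫ a, 32 * m ^ 2 * a ^ 4 ∂gaussianReal 0 1 = 32 * m ^ 2 * κ := integral_const_mul _ _
  rw [integral_add (integrable_const _) (hIntg.const_mul _), e1]
  simp only [integral_const, probReal_univ, one_smul]
  apply le_of_eq; ring

/-- main conclusion of the Lindley part -/
lemma hN_limit {η : ℝ} (hη : 0 < η) : ∃ m0 > 0, ∀ m, 0 < m → m < m0 →
    ∃ K0 : ℕ, ∀ K ≥ K0, |hN m K - m| ≤ η * m := by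
  obtain ⟨C, hC, h4⟩ := fourth_moment
  set a := min η 1 with ha
  have ha0 : 0 < a := lt_min hη one_pos
  have ha1 : a ≤ 1 := min_le_right _ _
  have haη : a ≤ η := min_le_left _ _
  refine ⟨min 1 (a ^ 2 * η / C), lt_min one_pos (by positivity), fun m hm hm0 => ?_⟩
  have hm1 : m ≤ 1 := (hm0.trans_le (min_le_left _ _)).le
  have hm2 : m ≤ a ^ 2 * η / C := (hm0.trans_le (min_le_right _ _)).le
  have hlim := fN_tendsto hm.le
  have hev := hlim.eventually (gt_mem_nhds (show m < m + η * m by nlinarith))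
  obtain ⟨K0, hK0⟩ := eventually_atTop.1 hev
  refine ⟨K0, fun K hK => ?_⟩
  have h1 := hN_le_fN m K
  have h2 := hK0 K hK
  have h3 := hN_ge (m := m) K ha0
  have h5 := fN_ge hm.le K
  have h6 : (∫ x, x ^ 4 ∂stepLaw m) / (2 * a ^ 2) ≤ η * m / 2 := by
    rw [div_le_iff₀ (by positivity)]
    refine (h4 m hm.le hm1).trans ?_
    rw [le_div_iff₀ hC] at hm2
    nlinarith
  have h7 : m * (1 - a / 2) ≤ fN m K * (1 - a / 2) := by gcongr; linarith
  rw [abs_le]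
  constructor
  · nlinarith
  · linarith

set_option linter.unusedSectionVars false
set_option linter.unusedVariables false

/-- running maximum functional -/
noncomputable def Mx : (K : ℕ) → (Fin K → ℝ) → ℝ
  | 0, _ => 0
  | K + 1, ξ => max 0 (ξ 0 + Mx K (fun i => ξ i.succ))

lemma Mx_continuous (K : ℕ) : Continuous (Mx K) := by
  induction K with
  | zero => exact continuous_const
  | succ K ih =>
    have e : Mx (K + 1) = fun ξ : Fin (K + 1) → ℝ => max 0 (ξ 0 + Mx K (fun i => ξ i.succ)) := rfl
    rw [e]
    have : Continuous fun ξ : Fin (K + 1) → ℝ => (fun i : Fin K => ξ i.succ) := by fun_prop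
    have h2 := ih.comp this
    exact continuous_const.max ((continuous_apply 0).add h2)

/-- the functional whose sublevel sets we use -/
noncomputable def Nx (K : ℕ) (ξ : Fin (K + 1) → ℝ) : ℝ := ξ 0 + Mx K (fun i => ξ i.succ)

lemma Nx_continuous (K : ℕ) : Continuous (Nx K) := by
  unfold Nx
  have : Continuous fun ξ : Fin (K + 1) → ℝ => (fun i : Fin K => ξ i.succ) := by fun_prop
  exact (continuous_apply 0).add ((Mx_continuous K).comp this)

lemma pi_split (m : ℝ) (K : ℕ) :
    MeasurePreserving (fun ξ : Fin (K + 1) → ℝ => ((ξ 0, fun i : Fin K => ξ i.succ) : ℝ × (Fin K → ℝ)))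
      (Measure.pi fun _ => stepLaw m) ((stepLaw m).prod (Measure.pi fun _ => stepLaw m)) := by
  have := measurePreserving_piFinSuccAbove (fun _ : Fin (K + 1) => stepLaw m) 0
  have e : (fun ξ : Fin (K + 1) → ℝ => ((ξ 0, fun i : Fin K => ξ i.succ) : ℝ × (Fin K → ℝ))) =
    ⇑(MeasurableEquiv.piFinSuccAbove (fun _ : Fin (K + 1) => ℝ) 0) := by
    funext ξ; rfl
  rw [e]; exact this

lemma Mx_law (m : ℝ) (K : ℕ) : (Measure.pi fun _ : Fin K => stepLaw m).map (Mx K) = maxLaw m K := by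
  induction K with
  | zero =>
    have : Mx 0 = fun _ => (0:ℝ) := rfl
    rw [this, Measure.map_const]
    unfold maxLaw; simp
  | succ K ih =>
    have h1 : Mx (K + 1) = (fun q : ℝ × ℝ => max 0 (q.1 + q.2)) ∘ (Prod.map id (Mx K)) ∘
      (fun ξ : Fin (K + 1) → ℝ => ((ξ 0, fun i : Fin K => ξ i.succ) : ℝ × (Fin K → ℝ))) := rfl
    have hM := (Mx_continuous K).measurable
    rw [h1, ← Measure.map_map (by fun_prop) (by fun_prop), ← Measure.map_map (by fun_prop) (by fun_prop),
      (pi_split m K).map_eq, ← Measure.map_prod_map _ _ measurable_id hM, Measure.map_id, ih]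
    rfl

lemma Nx_law (m : ℝ) (K : ℕ) : (Measure.pi fun _ : Fin (K + 1) => stepLaw m).map (Nx K) =
    ((stepLaw m).prod (maxLaw m K)).map (fun q => q.1 + q.2) := by
  have h1 : Nx K = (fun q : ℝ × ℝ => (q.1 + q.2)) ∘ (Prod.map id (Mx K)) ∘
      (fun ξ : Fin (K + 1) → ℝ => ((ξ 0, fun i : Fin K => ξ i.succ) : ℝ × (Fin K → ℝ))) := rfl
  have hM := (Mx_continuous K).measurable
  rw [h1, ← Measure.map_map (by fun_prop) (by fun_prop), ← Measure.map_map (by fun_prop) (by fun_prop),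
      (pi_split m K).map_eq, ← Measure.map_prod_map _ _ measurable_id hM, Measure.map_id, Mx_law]

lemma Nx_null {m : ℝ} (hm : 0 < m) (K : ℕ) (a : ℝ) :
    (Measure.pi fun _ : Fin (K + 1) => stepLaw m) {ξ | Nx K ξ = a} = 0 := by
  have h1 : (Measure.pi fun _ : Fin (K + 1) => stepLaw m) {ξ | Nx K ξ = a} =
      (Measure.pi fun _ : Fin (K + 1) => stepLaw m).map (Nx K) {a} := by
    rw [Measure.map_apply (Nx_continuous K).measurable (measurableSet_singleton a)]; rfl
  rw [h1, Nx_law, Measure.map_apply (by fun_prop) (measurableSet_singleton a)]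
  have hms : MeasurableSet ((fun q : ℝ × ℝ => q.1 + q.2) ⁻¹' {a}) :=
    (show Measurable (fun q : ℝ × ℝ => q.1 + q.2) by fun_prop) (measurableSet_singleton a)
  rw [Measure.prod_apply_symm hms, lintegral_eq_zero_iff (measurable_measure_prodMk_right hms)]
  refine Eventually.of_forall fun y => ?_
  have e : (fun x : ℝ => (x, y)) ⁻¹' ((fun q : ℝ × ℝ => q.1 + q.2) ⁻¹' {a}) = {a - y} := by
    ext x
    simp only [Set.mem_preimage, Set.mem_singleton_iff]
    constructor <;> intro h <;> linarith
  have hna : NullSingletonClass (stepLaw m) := by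
    unfold stepLaw
    exact nullSingletonClass_gaussianReal (by simp [hm])
  show stepLaw m ((fun x : ℝ => (x, y)) ⁻¹' ((fun q : ℝ × ℝ => q.1 + q.2) ⁻¹' {a})) = 0
  rw [e]; exact measure_singleton _

lemma Nx_iff (K : ℕ) : ∀ (U : ℕ → ℝ) (a : ℝ), Nx K (fun i : Fin (K + 1) => U (i + 1) - U i) ≤ a ↔
    ∀ k, k < K + 1 → U (k + 1) - U 0 ≤ a := by
  induction K with
  | zero =>
    intro U a
    simp [Nx, Mx]
  | succ K ih =>
    intro U a
    have h := ih (fun i => U (i + 1)) (a - (U 1 - U 0))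
    have e : Nx (K + 1) (fun i : Fin (K + 2) => U (i + 1) - U i) = (U 1 - U 0) + max 0 (Nx K (fun i : Fin (K + 1) => U (i + 1 + 1) - U (i + 1))) := by
      unfold Nx
      rw [Mx]
      simp
    rw [e]
    constructor
    · intro h1 k hk
      cases k with
      | zero => have := le_max_left 0 (Nx K (fun i : Fin (K + 1) => U (i + 1 + 1) - U (i + 1))); simp; linarith
      | succ k =>
        have h2 := le_max_right 0 (Nx K (fun i : Fin (K + 1) => U (i + 1 + 1) - U (i + 1)))
        have := h.1 (by linarith) k (by omega)
        simp at this
        linarith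
    · intro h1
      have h2 := h.2 (fun k hk => by have := h1 (k + 1) (by omega); simp; linarith)
      have h3 := h1 0 (by omega)
      simp at h3
      have : max 0 (Nx K (fun i : Fin (K + 1) => U (i + 1 + 1) - U (i + 1))) ≤ a - (U 1 - U 0) :=
        max_le (by linarith) h2
      linarith

lemma hN_eq_integral (m : ℝ) (K : ℕ) (s0 : ℝ) :
    ∫ s in Set.Ioi s0, exp (-s) * (Measure.pi fun _ : Fin (K + 1) => stepLaw m).real {ξ | Nx K ξ ≤ s0 - s} =
      exp (-s0) * hN m K := by
  set μ := (stepLaw m).prod (maxLaw m K) with hμ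
  have h1 : ∀ s, (Measure.pi fun _ : Fin (K + 1) => stepLaw m).real {ξ | Nx K ξ ≤ s0 - s} =
      ∫ q, (if q.1 + q.2 ≤ s0 - s then (1:ℝ) else 0) ∂μ := by
    intro s
    have h2 : (Measure.pi fun _ : Fin (K + 1) => stepLaw m) {ξ | Nx K ξ ≤ s0 - s} = μ {q | q.1 + q.2 ≤ s0 - s} := by
      have e1 : (Measure.pi fun _ : Fin (K + 1) => stepLaw m) {ξ | Nx K ξ ≤ s0 - s} =
        (Measure.pi fun _ : Fin (K + 1) => stepLaw m).map (Nx K) (Set.Iic (s0 - s)) := by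
          rw [Measure.map_apply (Nx_continuous K).measurable measurableSet_Iic]; rfl
      rw [e1, Nx_law, Measure.map_apply (by fun_prop) measurableSet_Iic]; rfl
    rw [measureReal_def, h2, ← measureReal_def]
    have hms : MeasurableSet {q : ℝ × ℝ | q.1 + q.2 ≤ s0 - s} := measurableSet_le (by fun_prop) (by fun_prop)
    rw [← integral_indicator_one hms]
    congr 1
  have h3 : ∀ s, exp (-s) * (Measure.pi fun _ : Fin (K + 1) => stepLaw m).real {ξ | Nx K ξ ≤ s0 - s} =
      ∫ q, exp (-s) * (if q.1 + q.2 ≤ s0 - s then (1:ℝ) else 0) ∂μ := by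
    intro s; rw [h1, integral_const_mul]
  simp_rw [h3]
  have hmeas : Measurable (fun z : ℝ × (ℝ × ℝ) => exp (-z.1) * (if z.2.1 + z.2.2 ≤ s0 - z.1 then (1:ℝ) else 0)) := by
    refine Measurable.mul (by fun_prop) (Measurable.ite (measurableSet_le (by fun_prop) (by fun_prop)) measurable_const measurable_const)
  have hexp : IntegrableOn (fun s : ℝ => exp (-s)) (Set.Ioi s0) := integrableOn_exp_neg_Ioi s0
  have hIntg : Integrable (fun z : ℝ × (ℝ × ℝ) => exp (-z.1) * (if z.2.1 + z.2.2 ≤ s0 - z.1 then (1:ℝ) else 0))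
      ((volume.restrict (Set.Ioi s0)).prod μ) := by
    have : Integrable (fun z : ℝ × (ℝ × ℝ) => exp (-z.1)) ((volume.restrict (Set.Ioi s0)).prod μ) :=
      hexp.comp_fst μ
    refine this.mono hmeas.aestronglyMeasurable (Eventually.of_forall fun z => ?_)
    rw [norm_mul]
    refine mul_le_of_le_one_right (norm_nonneg _) ?_
    split_ifs <;> simp
  rw [integral_integral_swap hIntg]
  unfold hN
  rw [← hμ, ← integral_const_mul]
  congr 1; funext q
  set N := q.1 + q.2 with hN
  have e2 : ∀ s, exp (-s) * (if N ≤ s0 - s then (1:ℝ) else 0) = (Set.Iic (s0 - N)).indicator (fun s => exp (-s)) s := by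
    intro s
    simp only [Set.indicator, Set.mem_Iic]
    by_cases h : N ≤ s0 - s
    · rw [if_pos h, if_pos (by linarith), mul_one]
    · rw [if_neg h, if_neg (by intro h'; apply h; linarith), mul_zero]
  simp_rw [e2]
  rw [setIntegral_indicator measurableSet_Iic, Set.Ioi_inter_Iic]
  rcases le_total N 0 with h | h
  · rw [← intervalIntegral.integral_of_le (by linarith)]
    rw [max_eq_right (by have := Real.exp_le_one_iff.2 h; linarith)]
    rw [intervalIntegral.integral_comp_neg (fun x => exp x), integral_exp]
    rw [mul_sub, ← Real.exp_add]; ring_nf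
  · rw [Set.Ioc_eq_empty (by intro h'; linarith)]
    rw [max_eq_left (by have := Real.one_le_exp h; linarith)]
    simp

set_option linter.unusedSectionVars false
set_option linter.unusedVariables false

section cond
variable {Ω : Type*} [MeasurableSpace Ω] {P : Measure Ω} [IsProbabilityMeasure P]
  {n p : ℕ} {H : V n → Ω → ℝ}

/-- residual of `H (x k)` after projecting on `H (x 0)` -/
noncomputable def Yf (p : ℕ) {n : ℕ} (H : V n → Ω → ℝ) (x : ℕ → V n) (k : ℕ) (ω : Ω) : ℝ :=
  H (x k) ω - rr p n (x 0) (x k) * H (x 0) ω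

/-- covariance of the residuals -/
noncomputable def cY (p n : ℕ) (x : ℕ → V n) (j k : ℕ) : ℝ :=
  n * (rr p n (x j) (x k) - rr p n (x 0) (x j) * rr p n (x 0) (x k))

lemma Yf_meas (hm : ∀ x, Measurable (H x)) (x : ℕ → V n) (k : ℕ) : Measurable (Yf p H x k) :=
  (hm _).sub ((hm _).const_mul _)

lemma fld_memLp (hm : ∀ x, Measurable (H x))
    (hH : IsCenteredGaussianVector P H (fun x y => (n : ℝ) * overlap n x y ^ p)) (v : V n) :
    MemLp (H v) 2 P := gv_memLp hm hH v

lemma Yf_memLp (hm : ∀ x, Measurable (H x))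
    (hH : IsCenteredGaussianVector P H (fun x y => (n : ℝ) * overlap n x y ^ p)) (x : ℕ → V n) (k : ℕ) :
    MemLp (Yf p H x k) 2 P :=
  (fld_memLp hm hH _).sub ((fld_memLp hm hH _).const_mul _)

lemma Yf_cov0 (hn : n ≠ 0) (hm : ∀ x, Measurable (H x))
    (hH : IsCenteredGaussianVector P H (fun x y => (n : ℝ) * overlap n x y ^ p)) (x : ℕ → V n) (k : ℕ) :
    cov[H (x 0), Yf p H x k; P] = 0 := by
  have h := fld_memLp hm hH
  have e : Yf p H x k = fun ω => H (x k) ω - rr p n (x 0) (x k) * H (x 0) ω := rfl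
  rw [e, covariance_fun_sub_right (h _) (h _) ((h _).const_mul _), covariance_const_mul_right,
    fld_cov hn hm hH, fld_cov hn hm hH, rr_self]
  ring

lemma Yf_cov (hn : n ≠ 0) (hm : ∀ x, Measurable (H x))
    (hH : IsCenteredGaussianVector P H (fun x y => (n : ℝ) * overlap n x y ^ p)) (x : ℕ → V n) (j k : ℕ) :
    cov[Yf p H x j, Yf p H x k; P] = cY p n x j k := by
  have h := fld_memLp hm hH
  have e : Yf p H x j = fun ω => H (x j) ω - rr p n (x 0) (x j) * H (x 0) ω := rfl
  have e2 : Yf p H x k = fun ω => H (x k) ω - rr p n (x 0) (x k) * H (x 0) ω := rfl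
  rw [e, covariance_fun_sub_left (h _) ((h _).const_mul _) (Yf_memLp hm hH x k), covariance_const_mul_left,
    Yf_cov0 hn hm hH, e2, covariance_fun_sub_right (h _) (h _) ((h _).const_mul _), covariance_const_mul_right,
    fld_cov hn hm hH, fld_cov hn hm hH, rr_comm p n (x j) (x 0)]
  unfold cY; ring

lemma Yf_indep (hn : n ≠ 0) (hm : ∀ x, Measurable (H x))
    (hH : IsCenteredGaussianVector P H (fun x y => (n : ℝ) * overlap n x y ^ p)) (x : ℕ → V n) (K : ℕ) :
    IndepFun (H (x 0)) (fun ω (k : Fin K) => Yf p H x (k + 1) ω) P := by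
  have hG := gv_gauss hm hH
  let L1 : (V n → ℝ) →L[ℝ] (Fin 1 → ℝ) := ContinuousLinearMap.pi fun _ => ContinuousLinearMap.proj (x 0)
  let L2 : (V n → ℝ) →L[ℝ] (Fin K → ℝ) := ContinuousLinearMap.pi fun k =>
    ContinuousLinearMap.proj (x (k + 1)) - rr p n (x 0) (x (k + 1)) • ContinuousLinearMap.proj (x 0)
  have h1 := hG.map_fun (L1.prod L2)
  have h2 : HasGaussianLaw (fun ω => ((fun _ : Fin 1 => H (x 0) ω), (fun k : Fin K => Yf p H x (k + 1) ω))) P := h1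
  have h3 := HasGaussianLaw.indepFun_of_covariance_eval (X := fun _ : Fin 1 => H (x 0))
    (Y := fun k : Fin K => Yf p H x (k + 1)) h2 (fun _ k => Yf_cov0 hn hm hH x _)
  exact h3.comp (φ := fun f : Fin 1 → ℝ => f 0) (ψ := id) (by fun_prop) measurable_id

lemma cond_id (hn : n ≠ 0) (hm : ∀ x, Measurable (H x))
    (hH : IsCenteredGaussianVector P H (fun x y => (n : ℝ) * overlap n x y ^ p)) {g : ℝ} (hg : 0 < g)
    (x : ℕ → V n) (K : ℕ) (s0 : ℝ) :
    AG g n * P.real {ω | bG g n s0 < H (x 0) ω ∧ ∀ k, k < K → H (x (k + 1)) ω ≤ bG g n s0} =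
      ∫ s in Set.Ioi s0, exp (-s - s ^ 2 / (2 * g ^ 2 * n)) *
        P.real {ω | ∀ k, k < K → Yf p H x (k + 1) ω ≤ bG g n s0 - rr p n (x 0) (x (k + 1)) * bG g n s} := by
  have hA := AG_pos hg hn
  set b := bG g n s0 with hb
  set Yv : Ω → Fin K → ℝ := fun ω (k : Fin K) => Yf p H x (k + 1) ω with hYv
  have hYm : Measurable Yv := measurable_pi_lambda _ fun k => Yf_meas hm x _
  set E : Set (ℝ × (Fin K → ℝ)) := {q | b < q.1 ∧ ∀ k : Fin K, q.2 k ≤ b - rr p n (x 0) (x (k + 1)) * q.1} with hE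
  have hEm : MeasurableSet E := by
    refine (measurableSet_lt measurable_const measurable_fst).inter ?_
    have : {q : ℝ × (Fin K → ℝ) | ∀ k : Fin K, q.2 k ≤ b - rr p n (x 0) (x (k + 1)) * q.1} =
      ⋂ k : Fin K, {q : ℝ × (Fin K → ℝ) | q.2 k ≤ b - rr p n (x 0) (x (k + 1)) * q.1} := by
        ext q; simp
    show MeasurableSet {q : ℝ × (Fin K → ℝ) | ∀ k : Fin K, q.2 k ≤ b - rr p n (x 0) (x (k + 1)) * q.1}
    rw [this]
    exact MeasurableSet.iInter fun k => measurableSet_le (by fun_prop) (by fun_prop)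
  have hlaw := (indepFun_iff_map_prod_eq_prod_map_map (hm (x 0)).aemeasurable hYm.aemeasurable).1
    (Yf_indep hn hm hH x K)
  have hpm : Measurable fun ω => (H (x 0) ω, Yv ω) := (hm _).prodMk hYm
  have : IsProbabilityMeasure (P.map Yv) := Measure.isProbabilityMeasure_map hYm.aemeasurable
  have e1 : P.real {ω | b < H (x 0) ω ∧ ∀ k, k < K → H (x (k + 1)) ω ≤ b} =
      ((P.map (H (x 0))).prod (P.map Yv)).real E := by
    rw [← hlaw, map_measureReal_apply hpm hEm]
    congr 1
    ext ω
    show (b < H (x 0) ω ∧ ∀ k, k < K → H (x (k + 1)) ω ≤ b) ↔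
      (b < H (x 0) ω ∧ ∀ k : Fin K, H (x (k + 1)) ω - rr p n (x 0) (x (k + 1)) * H (x 0) ω ≤ b - rr p n (x 0) (x (k + 1)) * H (x 0) ω)
    refine and_congr Iff.rfl ⟨fun h k => by have := h k k.2; linarith, fun h k hk => by have := h ⟨k, hk⟩; simp at this; linarith⟩
  set φ : ℝ → ℝ := fun a => P.real {ω | ∀ k, k < K → Yf p H x (k + 1) ω ≤ b - rr p n (x 0) (x (k + 1)) * a} with hφ
  have e2 : ((P.map (H (x 0))).prod (P.map Yv)).real E = ∫ a, (Set.Ioi b).indicator φ a ∂gaussianReal 0 n := by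
    rw [fld_law hn hm hH, measureReal_def, Measure.prod_apply hEm, ← integral_toReal]
    · congr 1; funext a
      have hsm : MeasurableSet (Prod.mk a ⁻¹' E) := measurable_prodMk_left hEm
      rw [Measure.map_apply hYm hsm]
      by_cases ha : b < a
      · rw [Set.indicator_of_mem (show a ∈ Set.Ioi b from ha), hφ]
        show P.real _ = P.real _
        congr 1
        ext ω
        show (b < a ∧ ∀ k : Fin K, Yf p H x (k + 1) ω ≤ b - rr p n (x 0) (x (k + 1)) * a) ↔ _
        exact ⟨fun h k hk => h.2 ⟨k, hk⟩, fun h => ⟨ha, fun k => h k k.2⟩⟩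
      · rw [Set.indicator_of_notMem (show a ∉ Set.Ioi b from ha)]
        have : Yv ⁻¹' (Prod.mk a ⁻¹' E) = ∅ := by
          ext ω
          simp only [Set.mem_empty_iff_false, iff_false]
          intro h; exact ha h.1
        rw [this]; simp
    · exact (measurable_measure_prodMk_left hEm).aemeasurable
    · exact Eventually.of_forall fun a => measure_lt_top _ _
  rw [e1, e2, hb, gauss_tail_id hg hn s0 φ, ← mul_assoc, mul_inv_cancel₀ hA.ne', one_mul]

lemma Yf_charFun (hn : n ≠ 0) (hm : ∀ x, Measurable (H x))
    (hH : IsCenteredGaussianVector P H (fun x y => (n : ℝ) * overlap n x y ^ p)) (g : ℝ)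
    (x : ℕ → V n) (K : ℕ) (μ : Fin K → ℝ) (t : EuclideanSpace ℝ (Fin K)) :
    charFun (P.map (fun ω => (WithLp.toLp 2 (fun i : Fin K => g * (Yf p H x (i + 1) ω - Yf p H x i ω) - μ i) :
      EuclideanSpace ℝ (Fin K)))) t =
      Complex.exp (((-∑ i, t i * μ i : ℝ) : ℂ) * Complex.I -
        ((∑ i, ∑ j, t i * t j * (g ^ 2 * (cY p n x (i + 1) (j + 1) - cY p n x (i + 1) j - cY p n x i (j + 1) + cY p n x i j)) : ℝ) : ℂ) / 2) := by
  have hG := gv_gauss hm hH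
  set T : Ω → ℝ := fun ω => ∑ i : Fin K, t i * (g * (Yf p H x (i + 1) ω - Yf p H x i ω)) with hT
  have hTm : Measurable T := Finset.measurable_sum _ fun i _ => (((Yf_meas hm x _).sub (Yf_meas hm x _)).const_mul g).const_mul _
  let Ly : ℕ → (V n → ℝ) →L[ℝ] ℝ := fun k =>
    ContinuousLinearMap.proj (x k) - rr p n (x 0) (x k) • ContinuousLinearMap.proj (x 0)
  let L : (V n → ℝ) →L[ℝ] ℝ := ∑ i : Fin K, t i • (g • (Ly (i + 1) - Ly i))
  have hTG : HasGaussianLaw T P := by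
    have h1 := hG.map_fun L
    have : T = fun ω => L (fun v => H v ω) := by
      funext ω
      simp only [hT, L, Ly, _root_.sum_apply]
      rfl
    rw [this]; exact h1
  have hY2 := Yf_memLp hm hH x
  have hH0 : ∀ v, ∫ ω, H v ω ∂P = 0 := by
    intro v
    rw [← integral_map (f := fun x : ℝ => x) (hm v).aemeasurable (measurable_id.aestronglyMeasurable),
      fld_law hn hm hH, integral_id_gaussianReal]
  have hHi : ∀ v, Integrable (H v) P := fun v => (fld_memLp hm hH v).integrable (by norm_num)
  have hYi : ∀ k, Integrable (Yf p H x k) P := fun k => (hY2 k).integrable (by norm_num)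
  have hY0 : ∀ k, ∫ ω, Yf p H x k ω ∂P = 0 := by
    intro k
    have : ∫ ω, Yf p H x k ω ∂P = ∫ ω, (H (x k) ω - rr p n (x 0) (x k) * H (x 0) ω) ∂P := rfl
    rw [this, integral_sub (hHi _) ((hHi _).const_mul _), integral_const_mul, hH0, hH0]; ring
  have hmean : ∫ ω, T ω ∂P = 0 := by
    rw [hT, integral_finsetSum]
    · refine Finset.sum_eq_zero fun i _ => ?_
      rw [integral_const_mul, integral_const_mul, integral_sub (hYi _) (hYi _), hY0, hY0]; ring
    · intro i _
      exact (((hYi _).sub (hYi _)).const_mul g).const_mul _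
  have hvar : Var[T; P] = ∑ i, ∑ j, t i * t j * (g ^ 2 * (cY p n x (i + 1) (j + 1) - cY p n x (i + 1) j - cY p n x i (j + 1) + cY p n x i j)) := by
    have e : T = ∑ i : Fin K, fun ω => t i * (g * (Yf p H x (i + 1) ω - Yf p H x i ω)) := by
      funext ω; simp [hT]
    have hd : ∀ j : Fin K, MemLp (fun ω => Yf p H x (j + 1) ω - Yf p H x j ω) 2 P := fun j => (hY2 _).sub (hY2 _)
    rw [e, variance_sum']
    · refine Finset.sum_congr rfl fun i _ => Finset.sum_congr rfl fun j _ => ?_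
      rw [covariance_const_mul_left, covariance_const_mul_right, covariance_const_mul_left, covariance_const_mul_right,
        covariance_fun_sub_left (hY2 _) (hY2 _) (hd j),
        covariance_fun_sub_right (hY2 _) (hY2 _) (hY2 _), covariance_fun_sub_right (hY2 _) (hY2 _) (hY2 _)]
      rw [Yf_cov hn hm hH, Yf_cov hn hm hH, Yf_cov hn hm hH, Yf_cov hn hm hH]
      ring
    · intro i _
      exact (((hY2 _).sub (hY2 _)).const_mul g).const_mul _
  have hlawT := hTG.map_eq_gaussianReal
  have hch := charFun_gaussianReal (μ := ∫ ω, T ω ∂P) (v := Var[T; P].toNNReal) 1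
  rw [← hlawT, hmean] at hch
  have hDm : Measurable (fun ω => (WithLp.toLp 2 (fun i : Fin K => g * (Yf p H x (i + 1) ω - Yf p H x i ω) - μ i) :
      EuclideanSpace ℝ (Fin K))) := by
    refine (WithLp.measurable_toLp 2 (Fin K → ℝ)).comp (measurable_pi_lambda _ fun i => ?_)
    exact (((Yf_meas hm x _).sub (Yf_meas hm x _)).const_mul g).sub measurable_const
  rw [charFun_apply, integral_map hTm.aemeasurable (Measurable.aestronglyMeasurable (by fun_prop))] at hch
  rw [charFun_apply, integral_map hDm.aemeasurable (Measurable.aestronglyMeasurable (by fun_prop))]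
  have e5 : ∀ ω, Complex.exp (((inner ℝ (WithLp.toLp 2 (fun i : Fin K => g * (Yf p H x (i + 1) ω - Yf p H x i ω) - μ i) :
      EuclideanSpace ℝ (Fin K)) t : ℝ) : ℂ) * Complex.I) =
      Complex.exp (((inner ℝ (T ω) 1 : ℝ) : ℂ) * Complex.I) * Complex.exp (((-∑ i, t i * μ i : ℝ) : ℂ) * Complex.I) := by
    intro ω
    rw [← Complex.exp_add, ← add_mul, ← Complex.ofReal_add]
    congr 4
    simp only [PiLp.inner_apply, hT, RCLike.inner_apply, conj_trivial, one_mul]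
    rw [← Finset.sum_neg_distrib, ← Finset.sum_add_distrib]
    refine Finset.sum_congr rfl fun i _ => ?_
    ring
  simp_rw [e5]
  rw [integral_mul_const, hch, ← Complex.exp_add]
  congr 1
  rw [Real.coe_toNNReal _ (variance_nonneg _ _), hvar]
  push_cast
  ring

end cond

set_option linter.unusedSectionVars false
set_option linter.unusedVariables false

section seqc
variable {Ω : Type*} [MeasurableSpace Ω] {P : Measure Ω} [IsProbabilityMeasure P]

lemma second_diff (i j : ℕ) (m : ℝ) :
    m * (((i + 1 : ℕ) : ℝ) + ((j + 1 : ℕ) : ℝ) - |((i + 1 : ℕ) : ℝ) - ((j + 1 : ℕ) : ℝ)|)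
    - m * (((i + 1 : ℕ) : ℝ) + ((j : ℕ) : ℝ) - |((i + 1 : ℕ) : ℝ) - ((j : ℕ) : ℝ)|)
    - m * (((i : ℕ) : ℝ) + ((j + 1 : ℕ) : ℝ) - |((i : ℕ) : ℝ) - ((j + 1 : ℕ) : ℝ)|)
    + m * (((i : ℕ) : ℝ) + ((j : ℕ) : ℝ) - |((i : ℕ) : ℝ) - ((j : ℕ) : ℝ)|) = if i = j then 2 * m else 0 := by
  push_cast
  rcases lt_trichotomy i j with h | h | h
  · rw [if_neg h.ne]
    have : (i : ℝ) + 1 ≤ j := by exact_mod_cast h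
    rw [abs_of_nonpos (by linarith : (i:ℝ) + 1 - (j + 1) ≤ 0), abs_of_nonpos (by linarith : (i:ℝ) + 1 - j ≤ 0),
      abs_of_nonpos (by linarith : (i:ℝ) - (j + 1) ≤ 0), abs_of_nonpos (by linarith : (i:ℝ) - j ≤ 0)]
    ring
  · subst h
    rw [if_pos rfl]
    rw [show (i:ℝ) + 1 - (i + 1) = 0 by ring, show (i:ℝ) + 1 - i = 1 by ring, show (i:ℝ) - (i + 1) = -1 by ring,
      show (i:ℝ) - i = 0 by ring]
    simp; ring
  · rw [if_neg h.ne']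
    have : (j : ℝ) + 1 ≤ i := by exact_mod_cast h
    rw [abs_of_nonneg (by linarith : 0 ≤ (i:ℝ) + 1 - (j + 1)), abs_of_nonneg (by linarith : 0 ≤ (i:ℝ) + 1 - j),
      abs_of_nonneg (by linarith : 0 ≤ (i:ℝ) - (j + 1)), abs_of_nonneg (by linarith : 0 ≤ (i:ℝ) - j)]
    ring

lemma F_tendsto {p : ℕ} {n : ℕ → ℕ} (hn : ∀ N, n N ≠ 0) {g : ℕ → ℝ} (hg : ∀ N, 0 < g N)
    (hgn : Tendsto (fun N => g N ^ 2 * n N) atTop atTop)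
    {H : ∀ N, V (n N) → Ω → ℝ} (hm : ∀ N x, Measurable (H N x))
    (hH : ∀ N, IsCenteredGaussianVector P (H N) (fun x y => (n N : ℝ) * overlap (n N) x y ^ p))
    (x : ∀ N, ℕ → V (n N)) (K : ℕ) {m : ℝ} (hm0 : 0 < m)
    (hq : ∀ j k, j ≤ K + 1 → k ≤ K + 1 →
      Tendsto (fun N => g N ^ 2 * (n N * (1 - rr p (n N) (x N j) (x N k)))) atTop (nhds (m * |(j:ℝ) - k|)))
    (s0 s : ℝ) :
    Tendsto (fun N => P.real {ω | ∀ k, k < K + 1 → Yf p (H N) (x N) (k + 1) ω ≤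
        bG (g N) (n N) s0 - rr p (n N) (x N 0) (x N (k + 1)) * bG (g N) (n N) s}) atTop
      (nhds ((Measure.pi fun _ : Fin (K + 1) => stepLaw m).real {ξ | Nx K ξ ≤ s0 - s})) := by
  have hn' : ∀ N, (0:ℝ) < n N := fun N => by have := hn N; positivity
  have hgn0 : Tendsto (fun N => (g N ^ 2 * n N)⁻¹) atTop (nhds 0) := hgn.inv_tendsto_atTop
  -- r tends to 1
  have hr1 : ∀ k, k ≤ K + 1 → Tendsto (fun N => rr p (n N) (x N 0) (x N k)) atTop (nhds 1) := by
    intro k hk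
    have h1 := ((hq 0 k (by omega) hk).mul hgn0).const_sub 1
    rw [mul_zero, sub_zero] at h1
    refine h1.congr fun N => ?_
    have := hn' N; have := hg N
    field_simp; ring
  have hc : ∀ j k, j ≤ K + 1 → k ≤ K + 1 → Tendsto (fun N => g N ^ 2 * cY p (n N) (x N) j k) atTop
      (nhds (m * ((j:ℝ) + k - |(j:ℝ) - k|))) := by
    intro j k hj hk
    have h1 := (((hq 0 j (by omega) hj).add (hq 0 k (by omega) hk)).sub (hq j k hj hk)).sub
      (((hq 0 j (by omega) hj).mul (hq 0 k (by omega) hk)).mul hgn0)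
    have e : m * |((0:ℕ):ℝ) - j| + m * |((0:ℕ):ℝ) - k| - m * |(j:ℝ) - k| - m * |((0:ℕ):ℝ) - j| * (m * |((0:ℕ):ℝ) - k|) * 0
      = m * ((j:ℝ) + k - |(j:ℝ) - k|) := by
      simp only [Nat.cast_zero, zero_sub, abs_neg, Nat.abs_cast]; ring
    rw [e] at h1
    refine h1.congr fun N => ?_
    have := hn' N; have := hg N
    unfold cY
    field_simp; ring
  -- centering
  set z : ℕ → ℕ → ℝ := fun N k => g N * (bG (g N) (n N) s0 - rr p (n N) (x N 0) (x N k) * bG (g N) (n N) s) with hz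
  set μ : ∀ N, Fin (K + 1) → ℝ := fun N i => z N (i + 1) - z N i with hμ
  have hμlim : ∀ i, Tendsto (fun N => μ N i) atTop (nhds m) := by
    intro i
    have hi := i.2
    have h1 := ((hq 0 (i + 1) (by omega) (by omega)).sub (hq 0 i (by omega) (by omega))).add
      (((hr1 i (by omega)).sub (hr1 (i + 1) (by omega))).mul_const s)
    have e : m * |((0:ℕ):ℝ) - (((i:ℕ) + 1 : ℕ) : ℝ)| - m * |((0:ℕ):ℝ) - (i : ℕ)| + (1 - 1) * s = m := by
      simp only [Nat.cast_zero, zero_sub, abs_neg, Nat.abs_cast]; push_cast; ring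
    rw [e] at h1
    refine h1.congr fun N => ?_
    have := hn' N; have := hg N
    simp only [hμ, hz, bG]
    field_simp; ring
  set D : ∀ N, Ω → EuclideanSpace ℝ (Fin (K + 1)) := fun N ω =>
    WithLp.toLp 2 (fun i : Fin (K + 1) => g N * (Yf p (H N) (x N) (i + 1) ω - Yf p (H N) (x N) i ω) - μ N i) with hD
  have hDm : ∀ N, Measurable (D N) := by
    intro N
    refine (WithLp.measurable_toLp 2 (Fin (K + 1) → ℝ)).comp (measurable_pi_lambda _ fun i => ?_)
    exact (((Yf_meas (hm N) (x N) _).sub (Yf_meas (hm N) (x N) _)).const_mul _).sub measurable_const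
  let ν : ℕ → ProbabilityMeasure (EuclideanSpace ℝ (Fin (K + 1))) := fun N =>
    ⟨P.map (D N), Measure.isProbabilityMeasure_map (hDm N).aemeasurable⟩
  let ν0 : ProbabilityMeasure (EuclideanSpace ℝ (Fin (K + 1))) :=
    ⟨(Measure.pi fun _ : Fin (K + 1) => stepLaw m).map (WithLp.toLp 2),
      Measure.isProbabilityMeasure_map (WithLp.measurable_toLp 2 (Fin (K + 1) → ℝ)).aemeasurable⟩
  have hν : Tendsto ν atTop (nhds ν0) := by
    refine ProbabilityMeasure.tendsto_of_tendsto_charFun fun t => ?_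
    have e1 : ∀ N, charFun (ν N : Measure _) t = _ := fun N =>
      Yf_charFun (hn N) (hm N) (hH N) (g N) (x N) (K + 1) (μ N) t
    simp_rw [e1]
    have e2 : charFun (ν0 : Measure _) t = Complex.exp (((-∑ i, t i * m : ℝ) : ℂ) * Complex.I -
        ((∑ i : Fin (K + 1), ∑ j : Fin (K + 1), t i * t j * (if (i:ℕ) = j then 2 * m else 0) : ℝ) : ℂ) / 2) := by
      show charFun ((Measure.pi fun _ : Fin (K + 1) => stepLaw m).map (WithLp.toLp 2)) t = _
      rw [charFun_pi]
      simp_rw [stepLaw, charFun_gaussianReal]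
      rw [← Complex.exp_sum]
      congr 1
      have e3 : ∀ i : Fin (K + 1), ∑ j : Fin (K + 1), t i * t j * (if (i:ℕ) = j then 2 * m else 0) = 2 * m * t i ^ 2 := by
        intro i
        have : ∀ j : Fin (K + 1), ((i:ℕ) = j ↔ i = j) := fun j => Fin.ext_iff.symm
        simp_rw [this]
        simp; ring
      simp_rw [e3]
      rw [Finset.sum_sub_distrib]
      rw [Real.coe_toNNReal _ (by positivity)]
      push_cast
      rw [← Finset.sum_mul, ← Finset.sum_div]
      congr 2
      simp
    rw [e2]
    refine (Complex.continuous_exp.tendsto _).comp ?_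
    refine Tendsto.sub (Tendsto.mul_const _ ?_) (Tendsto.div_const ?_ _)
    · refine (Complex.continuous_ofReal.tendsto _).comp ?_
      exact (tendsto_finset_sum _ fun i _ => (hμlim i).const_mul _).neg
    · refine (Complex.continuous_ofReal.tendsto _).comp ?_
      refine tendsto_finset_sum _ fun i _ => tendsto_finset_sum _ fun j _ => Tendsto.const_mul _ ?_
      have hi := i.2
      have hj := j.2
      rw [← second_diff]
      have := (((hc (i + 1) (j + 1) (by omega) (by omega)).sub (hc (i + 1) j (by omega) (by omega))).sub
        (hc i (j + 1) (by omega) (by omega))).add (hc i j (by omega) (by omega))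
      refine this.congr fun N => ?_
      ring
  set E : Set (EuclideanSpace ℝ (Fin (K + 1))) := {v | Nx K (WithLp.ofLp v) ≤ s0 - s} with hE
  have hcont : Continuous fun v : EuclideanSpace ℝ (Fin (K + 1)) => Nx K (WithLp.ofLp v) :=
    (Nx_continuous K).comp (PiLp.continuous_ofLp 2 _)
  have hEm : MeasurableSet E := (isClosed_le hcont continuous_const).measurableSet
  have hfr : (ν0 : Measure (EuclideanSpace ℝ (Fin (K + 1)))) (frontier E) = 0 := by
    refine measure_mono_null (frontier_le_subset_eq hcont continuous_const) ?_
    show ((Measure.pi fun _ : Fin (K + 1) => stepLaw m).map (WithLp.toLp 2)) _ = 0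
    rw [Measure.map_apply (WithLp.measurable_toLp 2 (Fin (K + 1) → ℝ))
      (isClosed_eq hcont continuous_const).measurableSet]
    exact Nx_null hm0 K (s0 - s)
  have hlim := ProbabilityMeasure.tendsto_measure_of_null_frontier_of_tendsto' hν hfr
  have hlim2 := (ENNReal.tendsto_toReal (measure_ne_top _ _)).comp hlim
  have e0 : ((ν0 : Measure (EuclideanSpace ℝ (Fin (K + 1)))) E).toReal =
      (Measure.pi fun _ : Fin (K + 1) => stepLaw m).real {ξ | Nx K ξ ≤ s0 - s} := by
    show ((Measure.pi fun _ : Fin (K + 1) => stepLaw m).map (WithLp.toLp 2) E).toReal = _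
    rw [Measure.map_apply (WithLp.measurable_toLp 2 (Fin (K + 1) → ℝ)) hEm]
    rfl
  rw [e0] at hlim2
  refine hlim2.congr fun N => ?_
  show (P.map (D N) E).toReal = _
  rw [Measure.map_apply (hDm N) hEm]
  show P.real _ = P.real _
  congr 1
  ext ω
  show Nx K (fun i : Fin (K + 1) => g N * (Yf p (H N) (x N) (i + 1) ω - Yf p (H N) (x N) i ω) - μ N i) ≤ s0 - s ↔ _
  have h1 := Nx_iff K (fun k => g N * Yf p (H N) (x N) k ω - z N k) (s0 - s)
  have e7 : (fun i : Fin (K + 1) => g N * (Yf p (H N) (x N) (i + 1) ω - Yf p (H N) (x N) i ω) - μ N i) =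
      fun i : Fin (K + 1) => (g N * Yf p (H N) (x N) (i + 1) ω - z N (i + 1)) - (g N * Yf p (H N) (x N) i ω - z N i) := by
    funext i; simp only [hμ]; ring
  rw [e7]
  refine h1.trans ?_
  have hz0 : z N 0 = s0 - s := by
    simp only [hz, rr_self, bG]
    have := hg N
    field_simp; ring
  have hY0 : Yf p (H N) (x N) 0 ω = 0 := by unfold Yf; rw [rr_self]; ring
  simp only [hz0, hY0]
  refine forall_congr' fun k => imp_congr Iff.rfl ?_
  simp only [hz]
  have := hg N
  constructor
  · intro h
    have h2 : g N * Yf p (H N) (x N) (k + 1) ω ≤ g N * (bG (g N) (n N) s0 - rr p (n N) (x N 0) (x N (k + 1)) * bG (g N) (n N) s) := by linarith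
    exact le_of_mul_le_mul_left h2 this
  · intro h
    have := mul_le_mul_of_nonneg_left h this.le
    linarith

lemma seq_limit {p : ℕ} {n : ℕ → ℕ} (hn : ∀ N, n N ≠ 0) {g : ℕ → ℝ} (hg : ∀ N, 0 < g N)
    (hgn : Tendsto (fun N => g N ^ 2 * n N) atTop atTop)
    {H : ∀ N, V (n N) → Ω → ℝ} (hm : ∀ N x, Measurable (H N x))
    (hH : ∀ N, IsCenteredGaussianVector P (H N) (fun x y => (n N : ℝ) * overlap (n N) x y ^ p))
    (x : ∀ N, ℕ → V (n N)) (K : ℕ) {m : ℝ} (hm0 : 0 < m)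
    (hq : ∀ j k, j ≤ K + 1 → k ≤ K + 1 →
      Tendsto (fun N => g N ^ 2 * (n N * (1 - rr p (n N) (x N j) (x N k)))) atTop (nhds (m * |(j:ℝ) - k|)))
    (s0 : ℝ) :
    Tendsto (fun N => AG (g N) (n N) * P.real {ω | bG (g N) (n N) s0 < H N (x N 0) ω ∧
      ∀ k, k < K + 1 → H N (x N (k + 1)) ω ≤ bG (g N) (n N) s0}) atTop (nhds (exp (-s0) * hN m K)) := by
  have hgn0 : Tendsto (fun N => (g N ^ 2 * n N)⁻¹) atTop (nhds 0) := hgn.inv_tendsto_atTop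
  simp_rw [fun N => cond_id (hn N) (hm N) (hH N) (hg N) (x N) (K + 1) s0]
  rw [← hN_eq_integral]
  refine tendsto_integral_of_dominated_convergence (fun s => exp (-s)) ?_ (integrableOn_exp_neg_Ioi s0) ?_ ?_
  · intro N
    refine AEStronglyMeasurable.mul (Continuous.aestronglyMeasurable (by fun_prop)) ?_
    refine Measurable.aestronglyMeasurable ?_
    have hset : MeasurableSet {q : ℝ × Ω | ∀ k, k < K + 1 → Yf p (H N) (x N) (k + 1) q.2 ≤
        bG (g N) (n N) s0 - rr p (n N) (x N 0) (x N (k + 1)) * bG (g N) (n N) q.1} := by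
      have : {q : ℝ × Ω | ∀ k, k < K + 1 → Yf p (H N) (x N) (k + 1) q.2 ≤
        bG (g N) (n N) s0 - rr p (n N) (x N 0) (x N (k + 1)) * bG (g N) (n N) q.1} =
        ⋂ k, ⋂ (_ : k < K + 1), {q : ℝ × Ω | Yf p (H N) (x N) (k + 1) q.2 ≤
        bG (g N) (n N) s0 - rr p (n N) (x N 0) (x N (k + 1)) * bG (g N) (n N) q.1} := by
          ext q; simp
      rw [this]
      refine MeasurableSet.iInter fun k => MeasurableSet.iInter fun _ => measurableSet_le ?_ ?_
      · exact (Yf_meas (hm N) (x N) _).comp measurable_snd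
      · unfold bG; fun_prop
    exact (measurable_measure_prodMk_left hset).ennreal_toReal
  · intro N
    refine Eventually.of_forall fun s => ?_
    rw [norm_mul, Real.norm_eq_abs, Real.norm_eq_abs, abs_of_pos (exp_pos _), abs_of_nonneg measureReal_nonneg]
    refine (mul_le_of_le_one_right (exp_pos _).le measureReal_le_one).trans ?_
    refine Real.exp_le_exp.2 ?_
    have : 0 ≤ s ^ 2 / (2 * g N ^ 2 * n N) := by positivity
    linarith
  · refine Eventually.of_forall fun s => ?_
    refine Tendsto.mul ?_ (F_tendsto hn hg hgn hm hH x K hm0 hq s0 s)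
    refine (Real.continuous_exp.tendsto _).comp ?_
    have h1 := (hgn0.const_mul (s ^ 2 / 2)).const_sub (-s)
    rw [mul_zero, sub_zero] at h1
    refine h1.congr fun N => ?_
    rw [show s ^ 2 / (2 * g N ^ 2 * n N) = s ^ 2 / 2 * (g N ^ 2 * n N)⁻¹ by rw [mul_assoc, div_mul_eq_div_div, div_eq_mul_inv (s ^ 2 / 2)]]

end seqc

set_option linter.unusedSectionVars false
set_option linter.unusedVariables false

section unif
variable {Ω : Type*} [MeasurableSpace Ω] {P : Measure Ω} [IsProbabilityMeasure P]

lemma gam_pos {c : ℝ} {n : ℕ} (hn : n ≠ 0) : 0 < γseq c n := by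
  unfold γseq
  have : (0 : ℝ) < n := by positivity
  positivity

lemma gam_le_one {c : ℝ} (hc : 0 < c) {n : ℕ} (hn : n ≠ 0) : γseq c n ≤ 1 := by
  unfold γseq
  refine Real.rpow_le_one_of_one_le_of_nonpos ?_ (by linarith)
  exact_mod_cast Nat.one_le_iff_ne_zero.2 hn

lemma gam_sq {c : ℝ} (n : ℕ) : γseq c n ^ 2 = (n : ℝ) ^ (-(2 * c)) := by
  unfold γseq
  rw [← Real.rpow_natCast, ← Real.rpow_mul (by positivity)]
  congr 1; push_cast; ring

lemma gam_sq_n {c : ℝ} {n : ℕ} (hn : n ≠ 0) : γseq c n ^ 2 * n = (n : ℝ) ^ (1 - 2 * c) := by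
  have : (0 : ℝ) < n := by positivity
  rw [gam_sq, ← Real.rpow_add_one this.ne']
  congr 1; ring

lemma gam_sq_tendsto {c : ℝ} (hc2 : c < 1 / 2) :
    Tendsto (fun n : ℕ => γseq c n ^ 2 * n) atTop atTop := by
  have h := (tendsto_rpow_atTop (y := 1 - 2 * c) (by linarith)).comp (tendsto_natCast_atTop_atTop (R := ℝ))
  refine h.congr' ?_
  filter_upwards [eventually_ne_atTop 0] with n hn
  rw [gam_sq_n hn]; rfl

lemma gam_tendsto {c : ℝ} (hc : 0 < c) : Tendsto (fun n : ℕ => γseq c n) atTop (nhds 0) :=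
  (tendsto_rpow_neg_atTop hc).comp tendsto_natCast_atTop_atTop

lemma hq_conv {p : ℕ} {n : ℕ → ℕ} (hn : ∀ N, n N ≠ 0) {g : ℕ → ℝ} (hg : ∀ N, 0 < g N)
    (hgn : Tendsto (fun N => g N ^ 2 * n N) atTop atTop) (x y : ∀ N, V (n N)) {τ : ℝ}
    (h : Tendsto (fun N => g N ^ 2 * hammingDist (x N) (y N)) atTop (nhds τ)) :
    Tendsto (fun N => g N ^ 2 * (n N * (1 - rr p (n N) (x N) (y N)))) atTop (nhds (2 * p * τ)) := by
  have hR : Tendsto (fun N => overlap (n N) (x N) (y N)) atTop (nhds 1) := by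
    have h1 := ((h.mul hgn.inv_tendsto_atTop).const_mul 2).const_sub 1
    rw [mul_zero, mul_zero, sub_zero] at h1
    refine h1.congr fun N => ?_
    have h2 : (n N : ℝ) ≠ 0 := by exact_mod_cast hn N
    have h3 := (hg N).ne'
    simp only [overlap, Pi.inv_apply]
    field_simp
  have hS : Tendsto (fun N => ∑ i ∈ Finset.range p, overlap (n N) (x N) (y N) ^ i) atTop (nhds p) := by
    have := tendsto_finsetSum (Finset.range p) (fun i _ => hR.pow i)
    simpa using this
  have h4 := (h.const_mul 2).mul hS
  rw [show 2 * τ * (p : ℝ) = 2 * p * τ by ring] at h4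
  refine h4.congr fun N => ?_
  have h2 : (n N : ℝ) ≠ 0 := by exact_mod_cast hn N
  have h5 := geom_sum_mul (overlap (n N) (x N) (y N)) p
  unfold rr
  have h6 : 1 - overlap (n N) (x N) (y N) ^ p = (∑ i ∈ Finset.range p, overlap (n N) (x N) (y N) ^ i) * (2 * (hammingDist (x N) (y N) : ℝ) / n N) := by
    have h7 : overlap (n N) (x N) (y N) - 1 = -(2 * (hammingDist (x N) (y N) : ℝ) / n N) := by unfold overlap; ring
    rw [h7] at h5; linarith
  rw [h6]
  field_simp

lemma unif_limit {p : ℕ} (hp : 2 ≤ p) {c : ℝ} (hc : 0 < c) (hc2 : c < 1 / 2)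
    {H : ∀ n, V n → Ω → ℝ} (hm : ∀ n x, Measurable (H n x))
    (hH : ∀ n, IsCenteredGaussianVector P (H n) (fun x y => (n : ℝ) * overlap n x y ^ p))
    (K : ℕ) {δ : ℝ} (hδ : 0 < δ) (s0 : ℝ) {η : ℝ} (hη : 0 < η) :
    ∃ ρ > 0, ∃ N0 : ℕ, ∀ n ≥ N0, ∀ x : ℕ → V n,
      (∀ j k, j ≤ K + 1 → k ≤ K + 1 →
        abs (γseq c n ^ 2 * hammingDist (x j) (x k) - δ * |(j : ℝ) - k|) ≤ ρ) →
      |AG (γseq c n) n * P.real {ω | bG (γseq c n) n s0 < H n (x 0) ω ∧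
        ∀ k, k < K + 1 → H n (x (k + 1)) ω ≤ bG (γseq c n) n s0} - exp (-s0) * hN (2 * p * δ) K| ≤ η := by
  by_contra! hcon
  have h1 : ∀ N : ℕ, ∃ n ≥ N + 1, ∃ x : ℕ → V n, (∀ j k, j ≤ K + 1 → k ≤ K + 1 →
        abs (γseq c n ^ 2 * hammingDist (x j) (x k) - δ * |(j : ℝ) - k|) ≤ 1 / ((N : ℝ) + 1)) ∧
      η < |AG (γseq c n) n * P.real {ω | bG (γseq c n) n s0 < H n (x 0) ω ∧
        ∀ k, k < K + 1 → H n (x (k + 1)) ω ≤ bG (γseq c n) n s0} - exp (-s0) * hN (2 * p * δ) K| := by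
    intro N
    obtain ⟨n, hn, x, hx, h⟩ := hcon (1 / ((N : ℝ) + 1)) (by positivity) (N + 1)
    exact ⟨n, hn, x, hx, h⟩
  choose n hn x hx h using h1
  have hn0 : ∀ N, n N ≠ 0 := fun N => by have := hn N; omega
  have hnt : Tendsto n atTop atTop := tendsto_atTop_mono (fun N => (Nat.le_succ N).trans (hn N)) tendsto_id
  have hgn : Tendsto (fun N => γseq c (n N) ^ 2 * n N) atTop atTop := (gam_sq_tendsto hc2).comp hnt
  have hp0 : (0 : ℝ) < p := by have : 0 < p := by omega
                               exact_mod_cast this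
  have := seq_limit (P := P) hn0 (g := fun N => γseq c (n N)) (fun N => gam_pos (hn0 N)) hgn
    (H := fun N => H (n N)) (fun N => hm (n N)) (fun N => hH (n N)) x K (m := 2 * p * δ) (by positivity)
    (by
      intro j k hj hk
      rw [mul_assoc]
      refine hq_conv hn0 (fun N => gam_pos (hn0 N)) hgn _ _ ?_
      have h2 : Tendsto (fun N : ℕ => γseq c (n N) ^ 2 * (hammingDist (x N j) (x N k) : ℝ) - δ * |(j : ℝ) - k|) atTop (nhds 0) :=
        squeeze_zero_norm (fun N => hx N j k hj hk) tendsto_one_div_add_atTop_nhds_zero_nat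
      simpa using h2.add_const (δ * |(j : ℝ) - k|)) s0
  have h3 := (this.sub_const (exp (-s0) * hN (2 * p * δ) K)).abs
  rw [sub_self, abs_zero] at h3
  obtain ⟨N, hN'⟩ := (h3.eventually (gt_mem_nhds hη)).exists
  exact absurd hN' (not_lt.2 (h N).le)

end unif

set_option linter.unusedSectionVars false
set_option linter.unusedVariables false

section joint
variable {Ω : Type*} [MeasurableSpace Ω] {Pe : Measure Ω} [IsProbabilityMeasure Pe]
variable {Ω' : Type*} [MeasurableSpace Ω'] {Pw : Measure Ω'} [IsProbabilityMeasure Pw]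
    {J : (n : ℕ) → ℕ → Ω' → V n} {e : ℕ → ℕ → Ω' → ℝ} {H : ∀ n, V n → Ω → ℝ} {p : ℕ}

/-- The field seen along the walk. -/
def XJ (H : ∀ n, V n → Ω → ℝ) (J : (n : ℕ) → ℕ → Ω' → V n) (n j : ℕ) (q : Ω × Ω') : ℝ :=
  H n (J n j q.2) q.1

lemma measurable_XJ (hm : ∀ n x, Measurable (H n x)) (hJmeas : ∀ n i, Measurable (J n i)) (n j : ℕ) :
    Measurable (XJ H J n j) := by
  have h : Measurable (fun q : Ω × V n => H n q.2 q.1) :=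
    measurable_from_prod_countable_left fun x => hm n x
  exact h.comp (measurable_fst.prodMk ((hJmeas n j).comp measurable_snd))

lemma prod_real_eq {S : Set (Ω × Ω')} (hS : MeasurableSet S) :
    (Pe.prod Pw).real S = ∫ ω', Pe.real {ω | (ω, ω') ∈ S} ∂Pw := by
  rw [measureReal_def, Measure.prod_apply_symm hS, integral_eq_lintegral_of_nonneg_ae]
  · congr 1
    refine lintegral_congr fun ω' => ?_
    rw [measureReal_def, ENNReal.ofReal_toReal (measure_ne_top _ _)]; rfl
  · exact Eventually.of_forall fun _ => measureReal_nonneg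
  · exact (measurable_measure_prodMk_right hS).ennreal_toReal.aestronglyMeasurable

lemma integrable_fib {S : Set (Ω × Ω')} (hS : MeasurableSet S) :
    Integrable (fun ω' => Pe.real {ω | (ω, ω') ∈ S}) Pw := by
  refine Integrable.of_bound (C := 1) (measurable_measure_prodMk_right hS).ennreal_toReal.aestronglyMeasurable ?_
  refine Eventually.of_forall fun ω' => ?_
  rw [Real.norm_eq_abs, abs_of_nonneg measureReal_nonneg]; exact measureReal_le_one

lemma prod_bound {S : Set (Ω × Ω')} (hS : MeasurableSet S) {f : Ω' → ℝ} (hf : Integrable f Pw)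
    (h : ∀ᵐ ω' ∂Pw, Pe.real {ω | (ω, ω') ∈ S} ≤ f ω') : (Pe.prod Pw).real S ≤ ∫ ω', f ω' ∂Pw := by
  rw [prod_real_eq hS]
  exact integral_mono_ae (integrable_fib hS) hf h

lemma prod_bound_const {S : Set (Ω × Ω')} (hS : MeasurableSet S) {f : ℝ}
    (h : ∀ᵐ ω' ∂Pw, Pe.real {ω | (ω, ω') ∈ S} ≤ f) : (Pe.prod Pw).real S ≤ f := by
  have := prod_bound hS (integrable_const f) h
  simpa using this

lemma XJ_tail (hm : ∀ n x, Measurable (H n x)) (hJmeas : ∀ n i, Measurable (J n i))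
    (hH : ∀ n, IsCenteredGaussianVector Pe (H n) (fun x y => (n : ℝ) * overlap n x y ^ p))
    {n : ℕ} (hn : n ≠ 0) {g : ℝ} (hg : 0 < g) (s : ℝ) (j : ℕ) :
    (Pe.prod Pw).real {q | bG g n s < XJ H J n j q} ≤ (AG g n)⁻¹ * exp (-s) := by
  refine prod_bound_const (measurableSet_lt measurable_const (measurable_XJ hm hJmeas n j)) ?_
  exact Eventually.of_forall fun ω' => fld_tail hn (hm n) (hH n) hg (J n j ω') s

lemma XJ_pair (hp : 2 ≤ p) (hm : ∀ n x, Measurable (H n x)) (hJmeas : ∀ n i, Measurable (J n i))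
    (hemeas : ∀ n i, Measurable (e n i)) (hlaw : WalkExpLaw Pw J e)
    (hH : ∀ n, IsCenteredGaussianVector Pe (H n) (fun x y => (n : ℝ) * overlap n x y ^ p))
    {n : ℕ} (hn : n ≠ 0) {g : ℝ} (hg : 0 < g) (hg1 : g ≤ 1) (s : ℝ) (hs : -(g ^ 2 * n / 2) ≤ s) (i j : ℕ) :
    (Pe.prod Pw).real {q | bG g n s < XJ H J n i q ∧ bG g n s < XJ H J n (i + j) q} ≤
      (AG g n)⁻¹ * exp (-s) * (2 * exp (-(g ^ 2 / 4 * j / 4)) + 8 / (g ^ 2 / 4) * exp (-(g ^ 2 / 4) * (n / 4 - 1))) := by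
  have hA := AG_pos hg hn
  refine (prod_bound ((measurableSet_lt measurable_const (measurable_XJ hm hJmeas n i)).inter
      (measurableSet_lt measurable_const (measurable_XJ hm hJmeas n (i + j))))
      (f := fun ω' => (AG g n)⁻¹ * exp (-s) * (exp (-(g ^ 2 / 4) * (hammingDist (J n i ω') (J n (i + j) ω') : ℝ))
        + exp (-(g ^ 2 / 4) * (n - (hammingDist (J n i ω') (J n (i + j) ω') : ℝ))))) ?_ ?_).trans ?_
  · exact (integrable_phi_dist hJmeas n i (i + j) (fun d => exp (-(g ^ 2 / 4) * (d : ℝ)) + exp (-(g ^ 2 / 4) * (n - (d : ℝ))))).const_mul _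
  · exact Eventually.of_forall fun ω' => fld_pair hn hp (hm n) (hH n) hg (J n i ω') (J n (i + j) ω') s hs
  · rw [integral_const_mul]
    refine mul_le_mul_of_nonneg_left ?_ (by positivity)
    exact mean_exp_dist hJmeas hemeas hlaw hn (by positivity) (by nlinarith) i j

lemma XJ_chain (hm : ∀ n x, Measurable (H n x)) (hJmeas : ∀ n i, Measurable (J n i))
    (hemeas : ∀ n i, Measurable (e n i)) (hlaw : WalkExpLaw Pw J e)
    (hH : ∀ n, IsCenteredGaussianVector Pe (H n) (fun x y => (n : ℝ) * overlap n x y ^ p))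
    {n : ℕ} (hn : n ≠ 0) {g : ℝ} (hg : 0 < g) (s : ℝ) (i : ℕ) {L : ℕ} (hL : 1 ≤ L)
    {Lam : ℝ} (hLam : 1 ≤ Lam) (hδ : g ^ 2 * L * Lam ^ 2 ≤ 1) {ε : ℝ} (hε : 0 < ε) :
    (Pe.prod Pw).real {q | XJ H J n i q ≤ bG g n (s - ε) ∧ ∃ l < L, bG g n s < XJ H J n (i + l) q} ≤
      (AG g n)⁻¹ * exp (-s) * (exp (ε + 1024 * p) * (120 / (ε * Lam) ^ 5)) := by
  have hS : MeasurableSet {q | XJ H J n i q ≤ bG g n (s - ε) ∧ ∃ l < L, bG g n s < XJ H J n (i + l) q} := by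
    refine (measurableSet_le (measurable_XJ hm hJmeas n i) measurable_const).inter ?_
    have : {q : Ω × Ω' | ∃ l < L, bG g n s < XJ H J n (i + l) q} = ⋃ l, ⋃ (_ : l < L), {q : Ω × Ω' | bG g n s < XJ H J n (i + l) q} := by
      ext q; simp
    show MeasurableSet {q : Ω × Ω' | ∃ l < L, bG g n s < XJ H J n (i + l) q}
    rw [this]
    exact MeasurableSet.iUnion fun l => MeasurableSet.iUnion fun _ => measurableSet_lt measurable_const (measurable_XJ hm hJmeas n _)
  refine prod_bound_const hS ?_
  filter_upwards [dist_le hJmeas hemeas hlaw hn] with ω' hω'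
  exact chain_bound hn (hm n) (hH n) hg (fun l => J n (i + l) ω') (fun a b => by rw [← add_assoc]; exact hω' _ _) hL hLam hδ hε s

/-- local exceedance event. -/
def LocE (H : ∀ n, V n → Ω → ℝ) (J : (n : ℕ) → ℕ → Ω' → V n) (g : ℝ) (n : ℕ) (s : ℝ) (K L i : ℕ) : Set (Ω × Ω') :=
  {q | bG g n s < XJ H J n i q ∧ ∀ k, k < K + 1 → XJ H J n (i + (k + 1) * L) q ≤ bG g n s}

lemma measurableSet_LocE (hm : ∀ n x, Measurable (H n x)) (hJmeas : ∀ n i, Measurable (J n i))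
    (g : ℝ) (n : ℕ) (s : ℝ) (K L i : ℕ) : MeasurableSet (LocE H J g n s K L i) := by
  refine (measurableSet_lt measurable_const (measurable_XJ hm hJmeas n i)).inter ?_
  have : {q : Ω × Ω' | ∀ k, k < K + 1 → XJ H J n (i + (k + 1) * L) q ≤ bG g n s} =
    ⋂ k, ⋂ (_ : k < K + 1), {q : Ω × Ω' | XJ H J n (i + (k + 1) * L) q ≤ bG g n s} := by ext q; simp
  show MeasurableSet {q : Ω × Ω' | ∀ k, k < K + 1 → XJ H J n (i + (k + 1) * L) q ≤ bG g n s}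
  rw [this]
  exact MeasurableSet.iInter fun k => MeasurableSet.iInter fun _ => measurableSet_le (measurable_XJ hm hJmeas n _) measurable_const

end joint

set_option linter.unusedSectionVars false
set_option linter.unusedVariables false

section joint2
variable {Ω : Type*} [MeasurableSpace Ω] {Pe : Measure Ω} [IsProbabilityMeasure Pe]
variable {Ω' : Type*} [MeasurableSpace Ω'] {Pw : Measure Ω'} [IsProbabilityMeasure Pw]
    {J : (n : ℕ) → ℕ → Ω' → V n} {e : ℕ → ℕ → Ω' → ℝ} {H : ∀ n, V n → Ω → ℝ} {p : ℕ}

/-- grid spacing -/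
noncomputable def Lg (c δ : ℝ) (n : ℕ) : ℕ := ⌊δ * (γseq c n ^ 2)⁻¹⌋₊

lemma Lg_le {c δ : ℝ} (hδ : 0 < δ) {n : ℕ} (hn : n ≠ 0) : γseq c n ^ 2 * Lg c δ n ≤ δ := by
  have hg := gam_pos (c := c) hn
  have : (Lg c δ n : ℝ) ≤ δ * (γseq c n ^ 2)⁻¹ := Nat.floor_le (by positivity)
  calc γseq c n ^ 2 * Lg c δ n ≤ γseq c n ^ 2 * (δ * (γseq c n ^ 2)⁻¹) := by gcongr
    _ = δ := by field_simp

lemma Lg_ge {c δ : ℝ} (hδ : 0 < δ) {n : ℕ} (hn : n ≠ 0) : δ - γseq c n ^ 2 ≤ γseq c n ^ 2 * Lg c δ n := by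
  have hg := gam_pos (c := c) hn
  have : δ * (γseq c n ^ 2)⁻¹ < (Lg c δ n : ℝ) + 1 := Nat.lt_floor_add_one _
  have h2 : γseq c n ^ 2 * (δ * (γseq c n ^ 2)⁻¹) ≤ γseq c n ^ 2 * ((Lg c δ n : ℝ) + 1) := by gcongr
  have h3 : γseq c n ^ 2 * (δ * (γseq c n ^ 2)⁻¹) = δ := by field_simp
  linarith

lemma dev_aux (hJmeas : ∀ n i, Measurable (J n i))
    (hemeas : ∀ n i, Measurable (e n i)) (hlaw : WalkExpLaw Pw J e) {c δ : ℝ} (hδ : 0 < δ)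
    {n : ℕ} (hn : n ≠ 0) (K i a d : ℕ) (hd : d ≤ K + 1) :
    ∫ ω', |γseq c n ^ 2 * (hammingDist (J n (i + a * Lg c δ n) ω') (J n (i + (a + d) * Lg c δ n) ω') : ℝ) - δ * d| ∂Pw ≤
      γseq c n ^ 2 * (K + 1) + (K + 1) ^ 2 * δ ^ 2 * (γseq c n ^ 2 * n)⁻¹ := by
  have hg := gam_pos (c := c) hn
  have hn0 : (0 : ℝ) < n := by positivity
  set g := γseq c n with hgdef
  set L := Lg c δ n with hLdef
  have hL1 : g ^ 2 * L ≤ δ := Lg_le hδ hn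
  have hL2 : δ - g ^ 2 ≤ g ^ 2 * L := Lg_ge hδ hn
  have hidx : i + (a + d) * L = (i + a * L) + d * L := by ring
  rw [hidx]
  have hIntg : Integrable (fun ω' => (hammingDist (J n (i + a * L) ω') (J n (i + a * L + d * L) ω') : ℝ)) Pw :=
    integrable_phi_dist hJmeas n _ _ (fun d => (d : ℝ))
  have hd' : (d : ℝ) ≤ K + 1 := by exact_mod_cast hd
  have hd0 : (0 : ℝ) ≤ d := by positivity
  have h1 : ∫ ω', |g ^ 2 * (hammingDist (J n (i + a * L) ω') (J n (i + a * L + d * L) ω') : ℝ) - δ * d| ∂Pw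
      = ∫ ω', (δ * d - g ^ 2 * (hammingDist (J n (i + a * L) ω') (J n (i + a * L + d * L) ω') : ℝ)) ∂Pw := by
    refine integral_congr_ae ?_
    filter_upwards [dist_le hJmeas hemeas hlaw hn] with ω' hω'
    have h2 := hω' (i + a * L) (d * L)
    have h3 : (hammingDist (J n (i + a * L) ω') (J n (i + a * L + d * L) ω') : ℝ) ≤ d * L := by exact_mod_cast h2
    rw [abs_of_nonpos, neg_sub]
    have h4 : g ^ 2 * (hammingDist (J n (i + a * L) ω') (J n (i + a * L + d * L) ω') : ℝ) ≤ g ^ 2 * (d * L) := by gcongr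
    have h5 : d * (g ^ 2 * L) ≤ d * δ := by gcongr
    nlinarith
  rw [h1, integral_sub (integrable_const _) (hIntg.const_mul _), integral_const_mul (g ^ 2)]
  have h6 := mean_dist hJmeas hemeas hlaw hn (i + a * L) (d * L)
  simp only [integral_const, probReal_univ, smul_eq_mul, one_mul]
  push_cast at h6
  have h7 : g ^ 2 * ((d : ℝ) * L - (d * L) ^ 2 / n) ≤ g ^ 2 * ∫ ω', (hammingDist (J n (i + a * L) ω') (J n (i + a * L + d * L) ω') : ℝ) ∂Pw := by gcongr
  have h8 : δ * d - g ^ 2 * (d * L) ≤ g ^ 2 * (K + 1) := by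
    have : d * (δ - g ^ 2 * L) ≤ (K + 1) * g ^ 2 := by
      refine mul_le_mul hd' (by linarith) (by linarith) (by positivity)
    linarith
  have h9 : g ^ 2 * ((d * L) ^ 2 / n) ≤ (K + 1) ^ 2 * δ ^ 2 * (g ^ 2 * n)⁻¹ := by
    have e1 : g ^ 2 * (((d : ℝ) * L) ^ 2 / n) = (d * (g ^ 2 * L)) ^ 2 * (g ^ 2 * n)⁻¹ := by field_simp
    rw [e1, ← mul_pow]
    gcongr
  rw [mul_sub] at h7
  linarith

lemma dev_bound (hJmeas : ∀ n i, Measurable (J n i))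
    (hemeas : ∀ n i, Measurable (e n i)) (hlaw : WalkExpLaw Pw J e) {c δ : ℝ} (hδ : 0 < δ)
    {n : ℕ} (hn : n ≠ 0) (K i a b : ℕ) (ha : a ≤ K + 1) (hb : b ≤ K + 1) :
    ∫ ω', abs (γseq c n ^ 2 * (hammingDist (J n (i + a * Lg c δ n) ω') (J n (i + b * Lg c δ n) ω') : ℝ) - δ * |(a : ℝ) - b|) ∂Pw ≤
      γseq c n ^ 2 * (K + 1) + (K + 1) ^ 2 * δ ^ 2 * (γseq c n ^ 2 * n)⁻¹ := by
  rcases le_total a b with hab | hab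
  · obtain ⟨d, rfl⟩ := Nat.exists_eq_add_of_le hab
    have := dev_aux hJmeas hemeas hlaw hδ hn (c := c) K i a d (by omega)
    have h2 : |(a : ℝ) - ((a + d : ℕ) : ℝ)| = d := by push_cast; rw [sub_add_cancel_left, abs_neg, abs_of_nonneg (by positivity)]
    rw [h2]; exact this
  · obtain ⟨d, rfl⟩ := Nat.exists_eq_add_of_le hab
    have := dev_aux hJmeas hemeas hlaw hδ hn (c := c) K i b d (by omega)
    have h2 : |((b + d : ℕ) : ℝ) - (b : ℝ)| = d := by push_cast; rw [add_sub_cancel_left, abs_of_nonneg (by positivity)]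
    rw [h2]
    simp_rw [hammingDist_comm (J n (i + (b + d) * Lg c δ n) _)]
    exact this

lemma XJ_loc (hp : 2 ≤ p) {c : ℝ} (hc : 0 < c) (hc2 : c < 1 / 2)
    (hm : ∀ n x, Measurable (H n x)) (hJmeas : ∀ n i, Measurable (J n i))
    (hemeas : ∀ n i, Measurable (e n i)) (hlaw : WalkExpLaw Pw J e)
    (hH : ∀ n, IsCenteredGaussianVector Pe (H n) (fun x y => (n : ℝ) * overlap n x y ^ p))
    (K : ℕ) {δ : ℝ} (hδ : 0 < δ) (s : ℝ) {η : ℝ} (hη : 0 < η) :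
    ∀ᶠ n : ℕ in atTop, ∀ i, |AG (γseq c n) n * (Pe.prod Pw).real (LocE H J (γseq c n) n s K (Lg c δ n) i)
      - exp (-s) * hN (2 * p * δ) K| ≤ η := by
  obtain ⟨ρ, hρ, N0, hun⟩ := unif_limit (P := Pe) hp hc hc2 hm hH K hδ s (half_pos hη)
  set T := exp (-s) * hN (2 * p * δ) K with hT
  set C := exp (-s) + |T| with hC
  have hCpos : 0 < C := by positivity
  have hr : Tendsto (fun n : ℕ => C / ρ * (((K + 2 : ℕ) : ℝ) * (((K + 2 : ℕ) : ℝ) *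
      (γseq c n ^ 2 * (K + 1) + (K + 1) ^ 2 * δ ^ 2 * (γseq c n ^ 2 * n)⁻¹)))) atTop (nhds 0) := by
    have h1 := ((gam_tendsto hc).pow 2).mul_const ((K : ℝ) + 1)
    have h2 := (gam_sq_tendsto hc2).inv_tendsto_atTop.const_mul (((K : ℝ) + 1) ^ 2 * δ ^ 2)
    have h3 := (((h1.add h2).const_mul (((K + 2 : ℕ) : ℝ))).const_mul (((K + 2 : ℕ) : ℝ))).const_mul (C / ρ)
    simpa using h3
  filter_upwards [eventually_ge_atTop N0, eventually_ne_atTop 0, hr.eventually (ge_mem_nhds (half_pos hη))]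
    with n hnN hn hrn i
  have hg := gam_pos (c := c) hn
  have hA := AG_pos hg hn
  have hS := measurableSet_LocE hm hJmeas (γseq c n) n s K (Lg c δ n) i
  set f : ℕ → ℕ → Ω' → ℝ := fun a b ω' => abs (γseq c n ^ 2 * (hammingDist (J n (i + a * Lg c δ n) ω') (J n (i + b * Lg c δ n) ω') : ℝ) - δ * |(a : ℝ) - b|) with hf
  have hfi : ∀ a b, Integrable (f a b) Pw := fun a b =>
    integrable_phi_dist hJmeas n _ _ (fun d => abs (γseq c n ^ 2 * (d : ℝ) - δ * |(a : ℝ) - b|))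
  have hDi : Integrable (fun ω' => ∑ a ∈ Finset.range (K + 2), ∑ b ∈ Finset.range (K + 2), f a b ω') Pw :=
    integrable_finsetSum _ fun a _ => integrable_finsetSum _ fun b _ => hfi a b
  have hDle : ∫ ω', ∑ a ∈ Finset.range (K + 2), ∑ b ∈ Finset.range (K + 2), f a b ω' ∂Pw ≤
      (((K + 2 : ℕ) : ℝ) * (((K + 2 : ℕ) : ℝ) *
      (γseq c n ^ 2 * (K + 1) + (K + 1) ^ 2 * δ ^ 2 * (γseq c n ^ 2 * n)⁻¹))) := by
    rw [integral_finsetSum _ (fun a _ => integrable_finsetSum _ fun b _ => hfi a b)]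
    refine (Finset.sum_le_card_nsmul _ _ (((K + 2 : ℕ) : ℝ) *
      (γseq c n ^ 2 * (K + 1) + (K + 1) ^ 2 * δ ^ 2 * (γseq c n ^ 2 * n)⁻¹)) ?_).trans (le_of_eq ?_)
    · intro a ha
      rw [integral_finsetSum _ (fun b _ => hfi a b)]
      refine (Finset.sum_le_card_nsmul _ _ 
        (γseq c n ^ 2 * (K + 1) + (K + 1) ^ 2 * δ ^ 2 * (γseq c n ^ 2 * n)⁻¹) ?_).trans (le_of_eq ?_)
      · intro b hb
        exact dev_bound hJmeas hemeas hlaw hδ hn K i a b (by have := Finset.mem_range.1 ha; omega) (by have := Finset.mem_range.1 hb; omega)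
      · rw [nsmul_eq_mul, Finset.card_range]
    · rw [nsmul_eq_mul, Finset.card_range]
  rw [prod_real_eq hS]
  set F : Ω' → ℝ := fun ω' => Pe.real {ω | (ω, ω') ∈ LocE H J (γseq c n) n s K (Lg c δ n) i} with hF
  have hFi : Integrable F Pw := integrable_fib hS
  have heq : AG (γseq c n) n * ∫ ω', F ω' ∂Pw - T = ∫ ω', (AG (γseq c n) n * F ω' - T) ∂Pw := by
    rw [integral_sub (hFi.const_mul _) (integrable_const _), integral_const_mul]; simp
  rw [heq]
  refine abs_integral_le_integral_abs.trans ?_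
  have hpt : ∀ ω', |AG (γseq c n) n * F ω' - T| ≤ η / 2 + C / ρ * ∑ a ∈ Finset.range (K + 2), ∑ b ∈ Finset.range (K + 2), f a b ω' := by
    intro ω'
    have hD0 : 0 ≤ ∑ a ∈ Finset.range (K + 2), ∑ b ∈ Finset.range (K + 2), f a b ω' :=
      Finset.sum_nonneg fun a _ => Finset.sum_nonneg fun b _ => abs_nonneg _
    by_cases hgood : ∀ a b, a ≤ K + 1 → b ≤ K + 1 → f a b ω' ≤ ρ
    · have h1 := hun n hnN (fun j => J n (i + j * Lg c δ n) ω') hgood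
      have h2 : F ω' = Pe.real {ω | bG (γseq c n) n s < H n (J n (i + 0 * Lg c δ n) ω') ω ∧
        ∀ k, k < K + 1 → H n (J n (i + (k + 1) * Lg c δ n) ω') ω ≤ bG (γseq c n) n s} := by
        simp only [zero_mul, add_zero]; rfl
      rw [h2]
      refine h1.trans ?_
      have : 0 ≤ C / ρ * ∑ a ∈ Finset.range (K + 2), ∑ b ∈ Finset.range (K + 2), f a b ω' := by positivity
      linarith
    · push Not at hgood
      obtain ⟨a, b, ha, hb, hab⟩ := hgood
      have h1 : f a b ω' ≤ ∑ a ∈ Finset.range (K + 2), ∑ b ∈ Finset.range (K + 2), f a b ω' := by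
        refine le_trans ?_ (Finset.single_le_sum (f := fun a => ∑ b ∈ Finset.range (K + 2), f a b ω')
          (fun a _ => Finset.sum_nonneg fun b _ => abs_nonneg _) (Finset.mem_range.2 (by omega : a < K + 2)))
        exact Finset.single_le_sum (f := fun b => f a b ω')
          (fun b _ => abs_nonneg _) (Finset.mem_range.2 (by omega : b < K + 2))
      have h2 : F ω' ≤ (AG (γseq c n) n)⁻¹ * exp (-s) := by
        refine le_trans (measureReal_mono ?_ (measure_ne_top _ _)) (fld_tail hn (hm n) (hH n) hg (J n i ω') s)
        intro ω hω
        exact hω.1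
      have h3 : AG (γseq c n) n * F ω' ≤ exp (-s) := by
        calc AG (γseq c n) n * F ω' ≤ AG (γseq c n) n * ((AG (γseq c n) n)⁻¹ * exp (-s)) := by gcongr
          _ = exp (-s) := by field_simp
      have h4 : 0 ≤ AG (γseq c n) n * F ω' := mul_nonneg hA.le measureReal_nonneg
      have h5 : |AG (γseq c n) n * F ω' - T| ≤ C := by
        refine (abs_sub _ _).trans ?_
        rw [abs_of_nonneg h4]; linarith
      have h6 : C ≤ C / ρ * ∑ a ∈ Finset.range (K + 2), ∑ b ∈ Finset.range (K + 2), f a b ω' := by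
        calc C = C / ρ * ρ := by field_simp
          _ ≤ _ := by gcongr; exact hab.le.trans h1
      linarith
  have hi2 : Integrable (fun ω' => C / ρ * ∑ a ∈ Finset.range (K + 2), ∑ b ∈ Finset.range (K + 2), f a b ω') Pw := hDi.const_mul _
  refine (integral_mono ((hFi.const_mul _).sub (integrable_const _)).abs ((integrable_const (η / 2)).add hi2) hpt).trans ?_
  simp only [Pi.add_apply]
  rw [integral_add (integrable_const (η / 2)) hi2, integral_const_mul]
  simp only [integral_const, probReal_univ, smul_eq_mul, one_mul]
  have : C / ρ * ∫ ω', ∑ a ∈ Finset.range (K + 2), ∑ b ∈ Finset.range (K + 2), f a b ω' ∂Pw ≤ η / 2 := by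
    refine le_trans ?_ hrn
    gcongr
  linarith

end joint2

set_option linter.unusedSectionVars false
set_option linter.unusedVariables false

section absd
variable {α : Type*} [MeasurableSpace α] {μ : Measure α} [IsFiniteMeasure μ]

lemma upper_abs (X : ℕ → α → ℝ) (b b' : ℝ) (θ L K : ℕ) (hL : 1 ≤ L) {a t ch : ℝ}
    (h1 : ∀ i, μ.real {q | b' < X i q ∧ ∀ k, k < K + 1 → X (i + (k + 1) * L) q ≤ b'} ≤ a)
    (h2 : ∀ i, μ.real {q | b' < X i q} ≤ t)
    (h3 : ∀ i, μ.real {q | X i q ≤ b' ∧ ∃ l < L, b < X (i + l) q} ≤ ch) :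
    μ.real {q | ∃ j ∈ Icc 1 θ, b < X j q} ≤ ((θ / L : ℕ) + 1 : ℝ) * (a + ch) + (K + 1) * t := by
  set κ := θ / L with hκ
  have hsub : {q | ∃ j ∈ Icc 1 θ, b < X j q} ⊆
      ((⋃ k ∈ Finset.range (κ + 1), {q | b' < X (k * L) q ∧ ∀ k', k' < K + 1 → X (k * L + (k' + 1) * L) q ≤ b'}) ∪
      (⋃ k ∈ Finset.range (κ + 1), {q | X (k * L) q ≤ b' ∧ ∃ l < L, b < X (k * L + l) q})) ∪
      (⋃ k ∈ Finset.range (K + 1), {q | b' < X ((κ + 1 + k) * L) q}) := by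
    rintro q ⟨j, hj, hjb⟩
    rw [Finset.mem_Icc] at hj
    have hjk : j / L ≤ κ := Nat.div_le_div_right hj.2
    have hjm : j % L < L := Nat.mod_lt _ hL
    have hjd : j / L * L + j % L = j := Nat.div_add_mod' j L
    by_cases hex : b' < X (j / L * L) q
    · by_cases htail : ∃ k ∈ Finset.range (K + 1), b' < X ((κ + 1 + k) * L) q
      · right
        obtain ⟨k, hk, h⟩ := htail
        exact Set.mem_biUnion hk h
      · push Not at htail
        left; left
        classical
        obtain ⟨k, hk, hmax⟩ := Finset.exists_max_image
          ((Finset.range (κ + 1)).filter fun k => b' < X (k * L) q) id ⟨j / L, by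
            rw [Finset.mem_filter]; exact ⟨Finset.mem_range.2 (by omega), hex⟩⟩
        rw [Finset.mem_filter] at hk
        refine Set.mem_biUnion hk.1 ⟨hk.2, fun k' hk' => ?_⟩
        have hk1 := Finset.mem_range.1 hk.1
        rw [← add_mul]
        by_contra hcon
        push Not at hcon
        by_cases hle : k + (k' + 1) ≤ κ
        · have := hmax (k + (k' + 1)) (by rw [Finset.mem_filter]; exact ⟨Finset.mem_range.2 (by omega), hcon⟩)
          simp at this
        · have := htail (k + (k' + 1) - (κ + 1)) (Finset.mem_range.2 (by omega))
          rw [show κ + 1 + (k + (k' + 1) - (κ + 1)) = k + (k' + 1) by omega] at this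
          linarith
    · left; right
      refine Set.mem_biUnion (Finset.mem_coe.2 (Finset.mem_range.2 (by omega : j / L < κ + 1))) ⟨not_lt.1 hex, j % L, hjm, ?_⟩
      rw [hjd]; exact hjb
  refine (measureReal_mono hsub (measure_ne_top _ _)).trans ?_
  refine (measureReal_union_le _ _).trans ?_
  have e1 := (measureReal_union_le (μ := μ) (⋃ k ∈ Finset.range (κ + 1), {q | b' < X (k * L) q ∧ ∀ k', k' < K + 1 → X (k * L + (k' + 1) * L) q ≤ b'})
      (⋃ k ∈ Finset.range (κ + 1), {q | X (k * L) q ≤ b' ∧ ∃ l < L, b < X (k * L + l) q}))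
  have e2 : μ.real (⋃ k ∈ Finset.range (κ + 1), {q | b' < X (k * L) q ∧ ∀ k', k' < K + 1 → X (k * L + (k' + 1) * L) q ≤ b'}) ≤ ((κ : ℝ) + 1) * a := by
    refine (measureReal_biUnion_finset_le _ _).trans ((Finset.sum_le_card_nsmul _ _ a fun k _ => h1 (k * L)).trans (le_of_eq ?_))
    rw [nsmul_eq_mul, Finset.card_range]; push_cast; ring
  have e3 : μ.real (⋃ k ∈ Finset.range (κ + 1), {q | X (k * L) q ≤ b' ∧ ∃ l < L, b < X (k * L + l) q}) ≤ ((κ : ℝ) + 1) * ch := by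
    refine (measureReal_biUnion_finset_le _ _).trans ((Finset.sum_le_card_nsmul _ _ ch fun k _ => h3 (k * L)).trans (le_of_eq ?_))
    rw [nsmul_eq_mul, Finset.card_range]; push_cast; ring
  have e4 : μ.real (⋃ k ∈ Finset.range (K + 1), {q | b' < X ((κ + 1 + k) * L) q}) ≤ ((K : ℝ) + 1) * t := by
    refine (measureReal_biUnion_finset_le _ _).trans ((Finset.sum_le_card_nsmul _ _ t fun k _ => h2 _).trans (le_of_eq ?_))
    rw [nsmul_eq_mul, Finset.card_range]; push_cast; ring
  linarith

lemma lower_abs (X : ℕ → α → ℝ) (hX : ∀ i, Measurable (X i)) (b : ℝ) (θ L K : ℕ) (hL : 1 ≤ L) {a : ℝ} (pr : ℕ → ℝ)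
    (h1 : ∀ i, a ≤ μ.real {q | b < X i q ∧ ∀ k, k < K + 1 → X (i + (k + 1) * L) q ≤ b})
    (h2 : ∀ i j, μ.real {q | b < X i q ∧ b < X (i + j) q} ≤ pr j) :
    ((θ / L : ℕ) : ℝ) * (a - ∑ k ∈ Finset.range (θ / L), pr ((K + 2 + k) * L)) ≤ μ.real {q | ∃ j ∈ Icc 1 θ, b < X j q} := by
  set κ := θ / L with hκ
  set D : ℕ → Set α := fun k => {q | b < X (k * L) q ∧ ∀ k', k < k' → k' ≤ κ → X (k' * L) q ≤ b} with hD
  have hDm : ∀ k, MeasurableSet (D k) := by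
    intro k
    refine (measurableSet_lt measurable_const (hX _)).inter ?_
    have : {q | ∀ k', k < k' → k' ≤ κ → X (k' * L) q ≤ b} = ⋂ k', ⋂ (_ : k < k'), ⋂ (_ : k' ≤ κ), {q | X (k' * L) q ≤ b} := by
      ext q; simp
    show MeasurableSet {q | ∀ k', k < k' → k' ≤ κ → X (k' * L) q ≤ b}
    rw [this]
    exact MeasurableSet.iInter fun _ => MeasurableSet.iInter fun _ => MeasurableSet.iInter fun _ => measurableSet_le (hX _) measurable_const
  have hdis : (↑(Finset.Icc 1 κ) : Set ℕ).PairwiseDisjoint D := by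
    intro i hi j hj hij
    have hi' := Finset.mem_Icc.1 (Finset.mem_coe.1 hi)
    have hj' := Finset.mem_Icc.1 (Finset.mem_coe.1 hj)
    refine Set.disjoint_left.2 fun q hq1 hq2 => ?_
    rcases lt_or_gt_of_ne hij with h | h
    · exact absurd (hq1.2 j h hj'.2) (not_le.2 hq2.1)
    · exact absurd (hq2.2 i h hi'.2) (not_le.2 hq1.1)
  have hsub : (⋃ k ∈ Finset.Icc 1 κ, D k) ⊆ {q | ∃ j ∈ Icc 1 θ, b < X j q} := by
    intro q hq
    simp only [Set.mem_iUnion] at hq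
    obtain ⟨k, hk, hq⟩ := hq
    have hk' := Finset.mem_Icc.1 hk
    refine ⟨k * L, Finset.mem_Icc.2 ⟨Nat.mul_pos hk'.1 hL, ?_⟩, hq.1⟩
    exact (Nat.mul_le_mul_right L hk'.2).trans (Nat.div_mul_le_self θ L)
  refine le_trans ?_ (measureReal_mono hsub (measure_ne_top _ _))
  rw [measureReal_biUnion_finset hdis (fun k _ => hDm k) (fun k _ => measure_ne_top _ _)]
  have hk : ∀ k ∈ Finset.Icc 1 κ, a - ∑ k ∈ Finset.range κ, pr ((K + 2 + k) * L) ≤ μ.real (D k) := by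
    intro k _
    have hs : {q | b < X (k * L) q ∧ ∀ k', k' < K + 1 → X (k * L + (k' + 1) * L) q ≤ b} ⊆
        D k ∪ ⋃ i ∈ Finset.range κ, {q | b < X (k * L) q ∧ b < X (k * L + (K + 2 + i) * L) q} := by
      rintro q ⟨hq1, hq2⟩
      by_cases hc : ∃ i ∈ Finset.range κ, b < X (k * L + (K + 2 + i) * L) q
      · right
        obtain ⟨i, hi, h⟩ := hc
        exact Set.mem_biUnion hi ⟨hq1, h⟩
      · left
        push Not at hc
        refine ⟨hq1, fun k' hk1 hk2 => ?_⟩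
        by_cases hle : k' ≤ k + K + 1
        · have := hq2 (k' - k - 1) (by omega)
          rwa [← add_mul, show k + (k' - k - 1 + 1) = k' by omega] at this
        · have := hc (k' - k - K - 2) (Finset.mem_range.2 (by omega))
          rwa [← add_mul, show k + (K + 2 + (k' - k - K - 2)) = k' by omega] at this
    have e1 := (h1 (k * L)).trans ((measureReal_mono hs (measure_ne_top _ _)).trans (measureReal_union_le _ _))
    have e2 : μ.real (⋃ i ∈ Finset.range κ, {q | b < X (k * L) q ∧ b < X (k * L + (K + 2 + i) * L) q}) ≤
        ∑ k ∈ Finset.range κ, pr ((K + 2 + k) * L) :=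
      (measureReal_biUnion_finset_le _ _).trans (Finset.sum_le_sum fun i _ => h2 _ _)
    linarith
  refine le_trans (le_of_eq ?_) (Finset.card_nsmul_le_sum _ _ _ hk)
  rw [nsmul_eq_mul, Nat.card_Icc, Nat.add_sub_cancel]

end absd

set_option linter.unusedSectionVars false
set_option linter.unusedVariables false

section asym

lemma polyexp {c : ℝ} (hc2 : c < 1 / 2) (M : ℕ) {a : ℝ} (ha : 0 < a) :
    Tendsto (fun n : ℕ => (n : ℝ) ^ M * exp (-a * (γseq c n ^ 2 * n))) atTop (nhds 0) := by
  have hb : 0 < 1 - 2 * c := by linarith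
  have h := (tendsto_rpow_mul_exp_neg_mul_atTop_nhds_zero ((M : ℝ) / (1 - 2 * c)) a ha).comp (gam_sq_tendsto hc2)
  refine h.congr' ?_
  filter_upwards [eventually_ne_atTop 0] with n hn
  simp only [Function.comp]
  congr 1
  rw [gam_sq_n hn, ← Real.rpow_mul (by positivity), ← Real.rpow_natCast]
  congr 1
  field_simp

lemma Lg_tendsto {c δ : ℝ} (hc : 0 < c) (hδ : 0 < δ) :
    Tendsto (fun n : ℕ => γseq c n ^ 2 * Lg c δ n) atTop (nhds δ) := by
  have h1 := ((gam_tendsto hc).pow 2).const_sub δ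
  rw [zero_pow two_ne_zero, sub_zero] at h1
  refine tendsto_of_tendsto_of_tendsto_of_le_of_le' h1 tendsto_const_nhds ?_ ?_
  · filter_upwards [eventually_ne_atTop 0] with n hn using Lg_ge hδ hn
  · filter_upwards [eventually_ne_atTop 0] with n hn using Lg_le hδ hn

lemma Lg_pos {c δ : ℝ} (hc : 0 < c) (hδ : 0 < δ) : ∀ᶠ n : ℕ in atTop, 1 ≤ Lg c δ n := by
  filter_upwards [(Lg_tendsto hc hδ).eventually (lt_mem_nhds hδ)] with n hn
  by_contra h
  have : Lg c δ n = 0 := by omega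
  rw [this] at hn; simp at hn

lemma ginv_tendsto {c : ℝ} (hc2 : c < 1 / 2) :
    Tendsto (fun n : ℕ => (γseq c n ^ 2)⁻¹ / θseq n) atTop (nhds 0) := by
  have h1 : Tendsto (fun n : ℕ => (γseq c n ^ 2 * n)⁻¹ * (((n : ℝ))⁻¹ / 3)) atTop (nhds 0) := by
    have := (gam_sq_tendsto hc2).inv_tendsto_atTop.mul ((tendsto_inv_atTop_nhds_zero_nat (𝕜 := ℝ)).div_const 3)
    simpa using this
  refine h1.congr fun n => ?_
  unfold θseq
  push_cast
  rw [mul_inv, div_eq_mul_inv, div_eq_mul_inv, mul_inv, sq (n : ℝ), mul_inv]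
  ring

lemma kap_tendsto {c δ : ℝ} (hc : 0 < c) (hc2 : c < 1 / 2) (hδ : 0 < δ) :
    Tendsto (fun n : ℕ => (γseq c n ^ 2)⁻¹ / θseq n * ((θseq n / Lg c δ n : ℕ) : ℝ)) atTop (nhds (1 / δ)) := by
  have h1 : Tendsto (fun n : ℕ => 1 / (γseq c n ^ 2 * Lg c δ n)) atTop (nhds (1 / δ)) :=
    tendsto_const_nhds.div (Lg_tendsto hc hδ) hδ.ne'
  have h2 := h1.sub (ginv_tendsto hc2)
  rw [sub_zero] at h2
  have key : ∀ᶠ n : ℕ in atTop, (γseq c n ^ 2)⁻¹ / θseq n * ((θseq n : ℝ) / Lg c δ n) = 1 / (γseq c n ^ 2 * Lg c δ n) := by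
    filter_upwards [eventually_ne_atTop 0, Lg_pos hc hδ] with n hn hL
    have hg := gam_pos (c := c) hn
    have h3 : (0 : ℝ) < θseq n := by unfold θseq; positivity
    have h4 : (0 : ℝ) < Lg c δ n := by exact_mod_cast hL
    field_simp
  refine tendsto_of_tendsto_of_tendsto_of_le_of_le' h2 h1 ?_ ?_
  · filter_upwards [key, Lg_pos hc hδ] with n hk hL
    rw [← hk, ← mul_sub_one]
    refine mul_le_mul_of_nonneg_left ?_ (by positivity)
    have h4 : (0 : ℝ) < Lg c δ n := by exact_mod_cast hL
    rw [sub_le_iff_le_add, div_le_iff₀ h4]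
    have := (Nat.lt_div_mul_add (a := θseq n) hL).le
    have h5 : (θseq n : ℝ) ≤ ((θseq n / Lg c δ n : ℕ) : ℝ) * Lg c δ n + Lg c δ n := by exact_mod_cast this
    linarith
  · filter_upwards [key] with n hk
    rw [← hk]
    exact mul_le_mul_of_nonneg_left Nat.cast_div_le (by positivity)

lemma aseq_eq {c : ℝ} {n : ℕ} (hn : n ≠ 0) : aseq c n = AG (γseq c n) n * (γseq c n ^ 2)⁻¹ := by
  have hg := gam_pos (c := c) hn
  unfold aseq AG
  field_simp

end asym

section limits
variable {Ω : Type*} [MeasurableSpace Ω] {Pe : Measure Ω} [IsProbabilityMeasure Pe]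
variable {Ω' : Type*} [MeasurableSpace Ω'] {Pw : Measure Ω'} [IsProbabilityMeasure Pw]
    {J : (n : ℕ) → ℕ → Ω' → V n} {e : ℕ → ℕ → Ω' → ℝ} {H : ∀ n, V n → Ω → ℝ} {p : ℕ}

/-- probability that the walk sees a deep trap -/
noncomputable def QJ (Pe : Measure Ω) (Pw : Measure Ω') (H : ∀ n, V n → Ω → ℝ) (J : (n : ℕ) → ℕ → Ω' → V n)
    (c : ℝ) (n : ℕ) (s : ℝ) : ℝ :=
  (Pe.prod Pw).real {q | ∃ j ∈ Icc 1 (θseq n), bG (γseq c n) n s < XJ H J n j q}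

lemma QJ_upper (hp : 2 ≤ p) {c : ℝ} (hc : 0 < c) (hc2 : c < 1 / 2)
    (hm : ∀ n x, Measurable (H n x)) (hJmeas : ∀ n i, Measurable (J n i))
    (hemeas : ∀ n i, Measurable (e n i)) (hlaw : WalkExpLaw Pw J e)
    (hH : ∀ n, IsCenteredGaussianVector Pe (H n) (fun x y => (n : ℝ) * overlap n x y ^ p))
    (s : ℝ) {ε : ℝ} (hε : 0 < ε) {ζ : ℝ} (hζ : 0 < ζ) :
    ∀ᶠ n : ℕ in atTop, aseq c n / θseq n * QJ Pe Pw H J c n s ≤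
      2 * p * exp (-(s - ε)) * (1 + ζ) + 3 * ζ := by
  obtain ⟨m0, hm0, hlim⟩ := hN_limit hζ
  have hp0 : (0 : ℝ) < p := by
    have : 0 < p := by omega
    exact_mod_cast this
  set C := exp (-s) * (exp (ε + 1024 * p) * (120 / ε ^ 5)) with hC
  have hC0 : 0 < C := by positivity
  -- choose r
  obtain ⟨r, hr0, hr1, hrm, hrC⟩ : ∃ r : ℝ, 0 < r ∧ r ≤ 1 ∧ 2 * p * r ^ 2 < m0 ∧ C * r ^ 3 ≤ ζ := by
    have t1 : Tendsto (fun r : ℝ => 2 * p * r ^ 2) (nhdsWithin 0 (Set.Ioi 0)) (nhds 0) := by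
      have : Tendsto (fun r : ℝ => 2 * p * r ^ 2) (nhds 0) (nhds (2 * (p : ℝ) * 0 ^ 2)) := (by fun_prop : Continuous fun r : ℝ => 2 * p * r ^ 2).tendsto 0
      rw [show (2 * (p : ℝ) * 0 ^ 2) = 0 by ring] at this
      exact this.mono_left nhdsWithin_le_nhds
    have t2 : Tendsto (fun r : ℝ => C * r ^ 3) (nhdsWithin 0 (Set.Ioi 0)) (nhds 0) := by
      have : Tendsto (fun r : ℝ => C * r ^ 3) (nhds 0) (nhds (C * 0 ^ 3)) := (by fun_prop : Continuous fun r : ℝ => C * r ^ 3).tendsto 0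
      rw [show (C * 0 ^ 3) = 0 by ring] at this
      exact this.mono_left nhdsWithin_le_nhds
    have t3 : ∀ᶠ r : ℝ in nhdsWithin 0 (Set.Ioi 0), r < 1 := nhdsWithin_le_nhds (gt_mem_nhds one_pos)
    obtain ⟨r, h1, h2, h3, h4⟩ := ((t1.eventually (gt_mem_nhds hm0)).and ((t2.eventually (gt_mem_nhds hζ)).and (t3.and self_mem_nhdsWithin))).exists
    exact ⟨r, h4, h3.le, h1, h2.le⟩
  have hδ : 0 < r ^ 2 := by positivity
  obtain ⟨K, hK⟩ := hlim (2 * p * r ^ 2) (by positivity) hrm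
  have hK := hK K le_rfl
  have hh : hN (2 * p * r ^ 2) K ≤ 2 * p * r ^ 2 * (1 + ζ) := by
    have := (abs_le.1 hK).2; linarith
  set aa := exp (-(s - ε)) * hN (2 * p * r ^ 2) K + ζ * r ^ 2 with haa
  set ch := exp (-s) * (exp (ε + 1024 * p) * (120 / (ε * (1 / r)) ^ 5)) with hch
  set R := fun n : ℕ => (γseq c n ^ 2)⁻¹ / θseq n with hR
  have hlimit : Tendsto (fun n : ℕ => (R n * ((θseq n / Lg c (r ^ 2) n : ℕ) : ℝ) + R n) * (aa + ch) + R n * ((K + 1) * exp (-(s - ε))))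
      atTop (nhds (1 / r ^ 2 * (aa + ch))) := by
    have := (((kap_tendsto hc hc2 hδ).add (ginv_tendsto hc2)).mul_const (aa + ch)).add ((ginv_tendsto hc2).mul_const ((K + 1) * exp (-(s - ε))))
    simpa using this
  have hfin : 1 / r ^ 2 * (aa + ch) < 2 * p * exp (-(s - ε)) * (1 + ζ) + 3 * ζ := by
    have e1 : ch = C * r ^ 5 := by rw [hch, hC]; field_simp
    have e2 : 1 / r ^ 2 * (aa + ch) = 1 / r ^ 2 * (exp (-(s - ε)) * hN (2 * p * r ^ 2) K) + ζ + C * r ^ 3 := by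
      rw [e1, haa]; field_simp
    have e3 : 1 / r ^ 2 * (exp (-(s - ε)) * hN (2 * p * r ^ 2) K) ≤ 1 / r ^ 2 * (exp (-(s - ε)) * (2 * p * r ^ 2 * (1 + ζ))) := by gcongr
    have e4 : 1 / r ^ 2 * (exp (-(s - ε)) * (2 * p * r ^ 2 * (1 + ζ))) = 2 * p * exp (-(s - ε)) * (1 + ζ) := by field_simp
    linarith
  filter_upwards [eventually_ne_atTop 0, Lg_pos hc hδ, hlimit.eventually (gt_mem_nhds hfin),
    XJ_loc hp hc hc2 hm hJmeas hemeas hlaw hH K hδ (s - ε) (by positivity : 0 < ζ * r ^ 2)] with n hn hL hlt hloc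
  have hg := gam_pos (c := c) hn
  have hA := AG_pos hg hn
  have hup := upper_abs (μ := Pe.prod Pw) (XJ H J n) (bG (γseq c n) n s) (bG (γseq c n) n (s - ε)) (θseq n) (Lg c (r ^ 2) n) K hL
    (a := (AG (γseq c n) n)⁻¹ * aa) (t := (AG (γseq c n) n)⁻¹ * exp (-(s - ε))) (ch := (AG (γseq c n) n)⁻¹ * ch)
    (by
      intro i
      have h1 := (abs_le.1 (hloc i)).2
      rw [inv_mul_eq_div, le_div_iff₀ hA, mul_comm]
      have : AG (γseq c n) n * (Pe.prod Pw).real (LocE H J (γseq c n) n (s - ε) K (Lg c (r ^ 2) n) i) ≤ aa := by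
        rw [haa]; linarith
      exact this)
    (fun i => XJ_tail hm hJmeas hH hn hg (s - ε) i)
    (by
      intro i
      have h2 := XJ_chain hm hJmeas hemeas hlaw hH hn hg s i hL (Lam := 1 / r) (by rw [le_div_iff₀ hr0]; linarith)
        (by
          have := Lg_le (c := c) hδ hn
          rw [div_pow, one_pow, mul_one_div, div_le_one hδ]; exact this) hε
      rw [mul_assoc] at h2
      exact h2)
  refine le_trans ?_ hlt.le
  have hRn : 0 ≤ R n := by rw [hR]; positivity
  have hQ : AG (γseq c n) n * QJ Pe Pw H J c n s ≤ (((θseq n / Lg c (r ^ 2) n : ℕ) : ℝ) + 1) * (aa + ch) + (K + 1) * exp (-(s - ε)) := by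
    have := mul_le_mul_of_nonneg_left hup hA.le
    refine this.trans (le_of_eq ?_)
    field_simp
  calc aseq c n / θseq n * QJ Pe Pw H J c n s = R n * (AG (γseq c n) n * QJ Pe Pw H J c n s) := by
        rw [aseq_eq hn, hR]; ring
    _ ≤ R n * ((((θseq n / Lg c (r ^ 2) n : ℕ) : ℝ) + 1) * (aa + ch) + (K + 1) * exp (-(s - ε))) := by gcongr
    _ = _ := by ring

end limits

set_option linter.unusedSectionVars false
set_option linter.unusedVariables false

section limits2
variable {Ω : Type*} [MeasurableSpace Ω] {Pe : Measure Ω} [IsProbabilityMeasure Pe]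
variable {Ω' : Type*} [MeasurableSpace Ω'] {Pw : Measure Ω'} [IsProbabilityMeasure Pw]
    {J : (n : ℕ) → ℕ → Ω' → V n} {e : ℕ → ℕ → Ω' → ℝ} {H : ∀ n, V n → Ω → ℝ} {p : ℕ}

lemma far_tail {c : ℝ} (hc : 0 < c) (hc2 : c < 1 / 2) :
    Tendsto (fun n : ℕ => (θseq n : ℝ) * (8 / (γseq c n ^ 2 / 4) * exp (-(γseq c n ^ 2 / 4) * (n / 4 - 1)))) atTop (nhds 0) := by
  have h := (polyexp hc2 3 (a := 1 / 16) (by norm_num)).const_mul (96 * exp 1)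
  rw [mul_zero] at h
  refine squeeze_zero' ?_ ?_ h
  · exact Eventually.of_forall fun n => by positivity
  · filter_upwards [eventually_ne_atTop 0, (gam_sq_tendsto hc2).eventually_ge_atTop 1] with n hn h1
    have hg := gam_pos (c := c) hn
    have hg1 := gam_le_one hc hn
    have hg2 : 0 < γseq c n ^ 2 := by positivity
    have e1 : 8 / (γseq c n ^ 2 / 4) ≤ 32 * n := by
      rw [div_le_iff₀ (by positivity)]; nlinarith
    have e2 : exp (-(γseq c n ^ 2 / 4) * (n / 4 - 1)) ≤ exp 1 * exp (-(1 / 16) * (γseq c n ^ 2 * n)) := by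
      rw [← Real.exp_add, Real.exp_le_exp]
      nlinarith
    have e3 : (θseq n : ℝ) = 3 * n ^ 2 := by unfold θseq; push_cast; ring
    rw [e3]
    calc 3 * (n : ℝ) ^ 2 * (8 / (γseq c n ^ 2 / 4) * exp (-(γseq c n ^ 2 / 4) * (n / 4 - 1)))
        ≤ 3 * (n : ℝ) ^ 2 * (32 * n * (exp 1 * exp (-(1 / 16) * (γseq c n ^ 2 * n)))) := by gcongr
      _ = _ := by ring

lemma geo_tail {r : ℝ} (hr0 : 0 < r) (hr1 : r < 1) (M κ : ℕ) :
    ∑ k ∈ Finset.range κ, r ^ (M + k) ≤ r ^ M * (1 - r)⁻¹ := by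
  simp_rw [pow_add]
  rw [← Finset.mul_sum]
  refine mul_le_mul_of_nonneg_left ?_ (by positivity)
  rw [← tsum_geometric_of_lt_one hr0.le hr1]
  exact (summable_geometric_of_lt_one hr0.le hr1).sum_le_tsum _ (fun _ _ => by positivity)

lemma QJ_lower (hp : 2 ≤ p) {c : ℝ} (hc : 0 < c) (hc2 : c < 1 / 2)
    (hm : ∀ n x, Measurable (H n x)) (hJmeas : ∀ n i, Measurable (J n i))
    (hemeas : ∀ n i, Measurable (e n i)) (hlaw : WalkExpLaw Pw J e)
    (hH : ∀ n, IsCenteredGaussianVector Pe (H n) (fun x y => (n : ℝ) * overlap n x y ^ p))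
    (s : ℝ) {ζ : ℝ} (hζ : 0 < ζ) :
    ∀ᶠ n : ℕ in atTop, 2 * p * exp (-s) * (1 - ζ) - 4 * ζ ≤ aseq c n / θseq n * QJ Pe Pw H J c n s := by
  obtain ⟨m0, hm0, hlim⟩ := hN_limit hζ
  have hp0 : (0 : ℝ) < p := by
    have : 0 < p := by omega
    exact_mod_cast this
  set δ := m0 / (4 * p) with hδdef
  have hδ : 0 < δ := by positivity
  have hδm : 2 * p * δ < m0 := by
    have : 2 * p * δ = m0 / 2 := by rw [hδdef]; field_simp; ring
    linarith
  obtain ⟨K0, hK0⟩ := hlim (2 * p * δ) (by positivity) hδm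
  set r := exp (-(δ / 32)) with hr
  have hr0 : 0 < r := exp_pos _
  have hr1 : r < 1 := by rw [hr, Real.exp_lt_one_iff]; linarith
  have hgeo : Tendsto (fun K : ℕ => exp (-s) * (2 * (r ^ (K + 2) * (1 - r)⁻¹))) atTop (nhds 0) := by
    have h1 := (tendsto_pow_atTop_nhds_zero_of_lt_one hr0.le hr1).comp (tendsto_add_atTop_nat 2)
    have := ((h1.mul_const (1 - r)⁻¹).const_mul 2).const_mul (exp (-s))
    simpa using this
  obtain ⟨K, hKg, hKK⟩ := ((hgeo.eventually (ge_mem_nhds (by positivity : 0 < ζ * δ))).and (eventually_ge_atTop K0)).exists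
  have hh : 2 * p * δ * (1 - ζ) ≤ hN (2 * p * δ) K := by
    have := (abs_le.1 (hK0 K hKK)).1; linarith
  set aa := exp (-s) * hN (2 * p * δ) K - ζ * δ with haa
  set R := fun n : ℕ => (γseq c n ^ 2)⁻¹ / θseq n with hR
  set W := aa - 2 * (ζ * δ) with hW
  have hlimit : Tendsto (fun n : ℕ => R n * ((θseq n / Lg c δ n : ℕ) : ℝ) * W) atTop (nhds (1 / δ * W)) :=
    (kap_tendsto hc hc2 hδ).mul_const W
  have hfin : 2 * p * exp (-s) * (1 - ζ) - 4 * ζ < 1 / δ * W := by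
    have e2 : 1 / δ * W = 1 / δ * (exp (-s) * hN (2 * p * δ) K) - 3 * ζ := by
      rw [hW, haa]; field_simp; ring
    have e3 : 1 / δ * (exp (-s) * (2 * p * δ * (1 - ζ))) ≤ 1 / δ * (exp (-s) * hN (2 * p * δ) K) := by gcongr
    have e4 : 1 / δ * (exp (-s) * (2 * p * δ * (1 - ζ))) = 2 * p * exp (-s) * (1 - ζ) := by field_simp
    linarith
  have hfar := (far_tail hc hc2).const_mul (exp (-s))
  rw [mul_zero] at hfar
  filter_upwards [eventually_ne_atTop 0, Lg_pos hc hδ, hlimit.eventually (lt_mem_nhds hfin),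
    XJ_loc hp hc hc2 hm hJmeas hemeas hlaw hH K hδ s (by positivity : 0 < ζ * δ),
    hfar.eventually (ge_mem_nhds (by positivity : 0 < ζ * δ)),
    (Lg_tendsto hc hδ).eventually (lt_mem_nhds (half_lt_self hδ)),
    (gam_sq_tendsto hc2).eventually_ge_atTop (-2 * s)] with n hn hL hlt hloc hfarn hLn hsn
  have hg := gam_pos (c := c) hn
  have hg1 := gam_le_one hc hn
  have hA := AG_pos hg hn
  set T := 8 / (γseq c n ^ 2 / 4) * exp (-(γseq c n ^ 2 / 4) * (n / 4 - 1)) with hT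
  have hT0 : 0 ≤ T := by positivity
  set pr : ℕ → ℝ := fun j => (AG (γseq c n) n)⁻¹ * exp (-s) * (2 * exp (-(γseq c n ^ 2 / 4 * j / 4)) + T) with hpr
  have hlow := lower_abs (μ := Pe.prod Pw) (XJ H J n) (fun i => measurable_XJ hm hJmeas n i) (bG (γseq c n) n s) (θseq n) (Lg c δ n) K hL
    (a := (AG (γseq c n) n)⁻¹ * aa) pr
    (by
      intro i
      have h1 := (abs_le.1 (hloc i)).1
      rw [inv_mul_eq_div, div_le_iff₀ hA, mul_comm]
      have : aa ≤ AG (γseq c n) n * (Pe.prod Pw).real (LocE H J (γseq c n) n s K (Lg c δ n) i) := by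
        rw [haa]; linarith
      exact this)
    (fun i j => XJ_pair hp hm hJmeas hemeas hlaw hH hn hg hg1 s (by linarith) i j)
  refine hlt.le.trans ?_
  have hRn : 0 ≤ R n := by rw [hR]; positivity
  set κ := θseq n / Lg c δ n with hκ
  have hsum : AG (γseq c n) n * ∑ k ∈ Finset.range κ, pr ((K + 2 + k) * Lg c δ n) ≤ 2 * (ζ * δ) := by
    have h1 : ∀ k ∈ Finset.range κ, AG (γseq c n) n * pr ((K + 2 + k) * Lg c δ n) ≤ exp (-s) * (2 * r ^ (K + 2 + k)) + exp (-s) * T := by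
      intro k _
      rw [hpr]
      simp only
      rw [← mul_assoc, ← mul_assoc, mul_inv_cancel₀ hA.ne', one_mul, ← mul_add]
      gcongr
      rw [hr, ← Real.exp_nat_mul, Real.exp_le_exp]
      push_cast
      have : (0 : ℝ) ≤ (K : ℝ) + 2 + k := by positivity
      nlinarith
    rw [Finset.mul_sum]
    refine (Finset.sum_le_sum h1).trans ?_
    rw [Finset.sum_add_distrib, ← Finset.mul_sum, ← Finset.mul_sum, Finset.sum_const, nsmul_eq_mul, Finset.card_range]
    have h2 : exp (-s) * (2 * ∑ k ∈ Finset.range κ, r ^ (K + 2 + k)) ≤ ζ * δ := by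
      refine le_trans ?_ hKg
      gcongr
      exact geo_tail hr0 hr1 _ _
    have h3 : (κ : ℝ) * (exp (-s) * T) ≤ ζ * δ := by
      refine le_trans ?_ hfarn
      have : (κ : ℝ) ≤ θseq n := by exact_mod_cast Nat.div_le_self _ _
      calc (κ : ℝ) * (exp (-s) * T) ≤ θseq n * (exp (-s) * T) := by gcongr
        _ = _ := by ring
    linarith
  have hQ : (κ : ℝ) * W ≤ AG (γseq c n) n * QJ Pe Pw H J c n s := by
    have h1 := mul_le_mul_of_nonneg_left hlow hA.le
    refine le_trans ?_ h1
    have h2 : AG (γseq c n) n * ((κ : ℝ) * ((AG (γseq c n) n)⁻¹ * aa - ∑ k ∈ Finset.range κ, pr ((K + 2 + k) * Lg c δ n)))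
      = κ * (aa - AG (γseq c n) n * ∑ k ∈ Finset.range κ, pr ((K + 2 + k) * Lg c δ n)) := by
      have : AG (γseq c n) n * (AG (γseq c n) n)⁻¹ = 1 := mul_inv_cancel₀ hA.ne'
      linear_combination (κ * aa) * this
    rw [h2]
    refine mul_le_mul_of_nonneg_left ?_ (by positivity)
    linarith
  calc R n * (κ : ℝ) * W = R n * (κ * W) := by ring
    _ ≤ R n * (AG (γseq c n) n * QJ Pe Pw H J c n s) := by gcongr
    _ = _ := by rw [aseq_eq hn, hR]; ring

lemma QJ_tendsto (hp : 2 ≤ p) {c : ℝ} (hc : 0 < c) (hc2 : c < 1 / 2)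
    (hm : ∀ n x, Measurable (H n x)) (hJmeas : ∀ n i, Measurable (J n i))
    (hemeas : ∀ n i, Measurable (e n i)) (hlaw : WalkExpLaw Pw J e)
    (hH : ∀ n, IsCenteredGaussianVector Pe (H n) (fun x y => (n : ℝ) * overlap n x y ^ p)) (s : ℝ) :
    Tendsto (fun n : ℕ => aseq c n / θseq n * QJ Pe Pw H J c n s) atTop (nhds (2 * p * exp (-s))) := by
  refine tendsto_order.2 ⟨fun a ha => ?_, fun a ha => ?_⟩
  · have t : Tendsto (fun ζ : ℝ => 2 * p * exp (-s) * (1 - ζ) - 4 * ζ) (nhdsWithin 0 (Set.Ioi 0)) (nhds (2 * p * exp (-s))) := by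
      have := (by fun_prop : Continuous fun ζ : ℝ => 2 * p * exp (-s) * (1 - ζ) - 4 * ζ).tendsto 0
      simp only [sub_zero, mul_one, mul_zero] at this
      exact this.mono_left nhdsWithin_le_nhds
    obtain ⟨ζ, h1, h2⟩ := ((t.eventually (lt_mem_nhds ha)).and self_mem_nhdsWithin).exists
    filter_upwards [QJ_lower hp hc hc2 hm hJmeas hemeas hlaw hH s h2] with n hn using h1.trans_le hn
  · have t : Tendsto (fun ζ : ℝ => 2 * p * exp (-(s - ζ)) * (1 + ζ) + 3 * ζ) (nhdsWithin 0 (Set.Ioi 0)) (nhds (2 * p * exp (-s))) := by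
      have := (by fun_prop : Continuous fun ζ : ℝ => 2 * p * exp (-(s - ζ)) * (1 + ζ) + 3 * ζ).tendsto 0
      simp only [sub_zero, add_zero, mul_one, mul_zero] at this
      exact this.mono_left nhdsWithin_le_nhds
    obtain ⟨ζ, h1, h2⟩ := ((t.eventually (gt_mem_nhds ha)).and self_mem_nhdsWithin).exists
    filter_upwards [QJ_upper hp hc hc2 hm hJmeas hemeas hlaw hH s h2 h2] with n hn using hn.trans_lt h1

end limits2

set_option linter.unusedSectionVars false
set_option linter.unusedVariables false

section fin

lemma polyexp2 {c : ℝ} (hc : 0 < c) (M : ℕ) {a : ℝ} (ha : 0 < a) :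
    Tendsto (fun n : ℕ => (n : ℝ) ^ M * exp (-a * (γseq c n)⁻¹)) atTop (nhds 0) := by
  have h0 : Tendsto (fun n : ℕ => (n : ℝ) ^ c) atTop atTop :=
    (tendsto_rpow_atTop hc).comp (tendsto_natCast_atTop_atTop (R := ℝ))
  have h := (tendsto_rpow_mul_exp_neg_mul_atTop_nhds_zero ((M : ℝ) / c) a ha).comp h0
  refine h.congr' ?_
  filter_upwards [eventually_ne_atTop 0] with n hn
  simp only [Function.comp]
  congr 1
  · rw [← Real.rpow_mul (by positivity), ← Real.rpow_natCast]
    congr 1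
    field_simp
  · unfold γseq
    rw [Real.rpow_neg (by positivity), inv_inv]

lemma theta_cast (n : ℕ) : (θseq n : ℝ) = 3 * n ^ 2 := by unfold θseq; push_cast; ring

lemma aseq_pos {c : ℝ} {n : ℕ} (hn : n ≠ 0) : 0 < aseq c n := by
  have hg := gam_pos (c := c) hn
  have : (0 : ℝ) < n := by positivity
  unfold aseq; positivity

lemma theta_div_a {c : ℝ} (hc : 0 < c) (hc2 : c < 1 / 2) :
    Tendsto (fun n : ℕ => (θseq n : ℝ) / aseq c n) atTop (nhds 0) := by
  have h := (polyexp hc2 2 (a := 1 / 2) (by norm_num)).const_mul 3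
  rw [mul_zero] at h
  refine squeeze_zero' ?_ ?_ h
  · filter_upwards [eventually_ne_atTop 0] with n hn
    have := aseq_pos (c := c) hn
    positivity
  · filter_upwards [eventually_ne_atTop 0] with n hn
    have hg := gam_pos (c := c) hn
    have hg1 := gam_le_one hc hn
    have hn1 : (1 : ℝ) ≤ n := by exact_mod_cast Nat.one_le_iff_ne_zero.2 hn
    have hs : 1 ≤ Real.sqrt (2 * π * n) := by
      rw [Real.one_le_sqrt]
      nlinarith [Real.pi_gt_three]
    have hgi : 1 ≤ (γseq c n)⁻¹ := (one_le_inv₀ hg).2 hg1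
    have ha : exp (γseq c n ^ 2 * n / 2) ≤ aseq c n := by
      unfold aseq
      have : 1 ≤ Real.sqrt (2 * π * n) * (γseq c n)⁻¹ := one_le_mul_of_one_le_of_one_le hs hgi
      exact le_mul_of_one_le_left (exp_pos _).le this
    rw [div_le_iff₀ (aseq_pos hn), theta_cast]
    have e1 : exp (-(1 / 2) * (γseq c n ^ 2 * n)) * exp (γseq c n ^ 2 * n / 2) = 1 := by
      rw [← Real.exp_add, Real.exp_eq_one_iff]; ring
    calc 3 * (n : ℝ) ^ 2 = 3 * (n : ℝ) ^ 2 * (exp (-(1 / 2) * (γseq c n ^ 2 * n)) * exp (γseq c n ^ 2 * n / 2)) := by rw [e1, mul_one]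
      _ ≤ 3 * (n : ℝ) ^ 2 * (exp (-(1 / 2) * (γseq c n ^ 2 * n)) * aseq c n) := by gcongr
      _ = _ := by ring

lemma kseq_le {c t : ℝ} (ht : 0 < t) {n : ℕ} (hn : n ≠ 0) : (kseq c n t : ℝ) ≤ aseq c n * t / θseq n := by
  have ha := aseq_pos (c := c) hn
  have hθ : (0 : ℝ) < θseq n := by rw [theta_cast]; positivity
  unfold kseq
  refine Nat.cast_div_le.trans ?_
  gcongr
  exact Nat.floor_le (by positivity)

lemma kseq_ge {c t : ℝ} (ht : 0 < t) {n : ℕ} (hn : n ≠ 0) : aseq c n * t / θseq n - 2 ≤ (kseq c n t : ℝ) := by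
  have ha := aseq_pos (c := c) hn
  have hθ' : 0 < θseq n := by unfold θseq; positivity
  have hθ : (1 : ℝ) ≤ θseq n := by exact_mod_cast hθ'
  have h1 := (Nat.lt_div_mul_add (a := ⌊aseq c n * t⌋₊) hθ').le
  have h2 : (⌊aseq c n * t⌋₊ : ℝ) ≤ (kseq c n t : ℝ) * θseq n + θseq n := by unfold kseq; exact_mod_cast h1
  have h3 := Nat.lt_floor_add_one (aseq c n * t)
  rw [sub_le_iff_le_add, div_le_iff₀ (by linarith)]
  linarith

lemma kseq_tendsto {c t : ℝ} (hc : 0 < c) (hc2 : c < 1 / 2) (ht : 0 < t) :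
    Tendsto (fun n : ℕ => (kseq c n t : ℝ) * (θseq n / aseq c n)) atTop (nhds t) := by
  have h1 := ((theta_div_a hc hc2).const_mul 2).const_sub t
  rw [mul_zero, sub_zero] at h1
  refine tendsto_of_tendsto_of_tendsto_of_le_of_le' h1 tendsto_const_nhds ?_ ?_
  · filter_upwards [eventually_ne_atTop 0] with n hn
    have ha := aseq_pos (c := c) hn
    have hθ : (0 : ℝ) < θseq n := by rw [theta_cast]; positivity
    calc t - 2 * (θseq n / aseq c n) = (aseq c n * t / θseq n - 2) * (θseq n / aseq c n) := by field_simp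
      _ ≤ _ := by gcongr; exact kseq_ge ht hn
  · filter_upwards [eventually_ne_atTop 0] with n hn
    have ha := aseq_pos (c := c) hn
    have hθ : (0 : ℝ) < θseq n := by rw [theta_cast]; positivity
    calc (kseq c n t : ℝ) * (θseq n / aseq c n) ≤ (aseq c n * t / θseq n) * (θseq n / aseq c n) := by
          gcongr; exact kseq_le ht hn
      _ = t := by field_simp

lemma kexp_tendsto {c t : ℝ} (hc : 0 < c) (hc2 : c < 1 / 2) (ht : 0 < t) :
    Tendsto (fun n : ℕ => (kseq c n t : ℝ) * (θseq n * exp (-n))) atTop (nhds 0) := by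
  have h : Tendsto (fun n : ℕ => t * (2 * π) * ((n : ℝ) ^ (2:ℝ) * exp (-(1 / 2) * n))) atTop (nhds 0) := by
    have := (((tendsto_rpow_mul_exp_neg_mul_atTop_nhds_zero 2 (1 / 2) (by norm_num)).comp (tendsto_natCast_atTop_atTop (R := ℝ)))).const_mul (t * (2 * π))
    simpa using this
  refine squeeze_zero' (Eventually.of_forall fun n => by positivity) ?_ h
  filter_upwards [eventually_ne_atTop 0, (gam_sq_tendsto hc2).eventually_ge_atTop 1] with n hn h1
  have hg := gam_pos (c := c) hn
  have hg1 := gam_le_one hc hn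
  have hn1 : (1 : ℝ) ≤ n := by exact_mod_cast Nat.one_le_iff_ne_zero.2 hn
  have ha := aseq_pos (c := c) hn
  have hθ : (0 : ℝ) < θseq n := by rw [theta_cast]; positivity
  have hs : Real.sqrt (2 * π * n) ≤ 2 * π * n := by
    rw [Real.sqrt_le_left (by positivity)]
    have : 1 ≤ 2 * π * n := by nlinarith [Real.pi_gt_three]
    nlinarith
  have hgi : (γseq c n)⁻¹ ≤ n := by
    rw [inv_le_iff_one_le_mul₀ hg]
    nlinarith
  have he : exp (γseq c n ^ 2 * n / 2) * exp (-n) ≤ exp (-(1 / 2) * n) := by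
    rw [← Real.exp_add, Real.exp_le_exp]
    have : γseq c n ^ 2 ≤ 1 := by nlinarith
    nlinarith
  calc (kseq c n t : ℝ) * (θseq n * exp (-n)) ≤ aseq c n * t / θseq n * (θseq n * exp (-n)) := by
        gcongr; exact kseq_le ht hn
    _ = t * (Real.sqrt (2 * π * n) * (γseq c n)⁻¹ * (exp (γseq c n ^ 2 * n / 2) * exp (-n))) := by
        unfold aseq; field_simp
    _ ≤ t * (2 * π * n * n * exp (-(1 / 2) * n)) := by gcongr
    _ = _ := by
        have : (n : ℝ) ^ (2 : ℝ) = n ^ 2 := by exact_mod_cast Real.rpow_natCast (n : ℝ) 2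
        rw [this]; ring

lemma thr_eq {c u : ℝ} (hu : 0 < u) (β : ℕ → ℝ) {n : ℕ} (hn : n ≠ 0) :
    cseq c β n * u ^ (β n / γseq c n) = exp (β n * bG (γseq c n) n (Real.log u)) := by
  unfold cseq bG
  rw [Real.rpow_def_of_pos hu, ← Real.exp_add]
  congr 1
  ring

end fin

section fin2
variable {Ω : Type*} [MeasurableSpace Ω] {Pe : Measure Ω} [IsProbabilityMeasure Pe]
variable {Ω' : Type*} [MeasurableSpace Ω'] {Pw : Measure Ω'} [IsProbabilityMeasure Pw]
    {J : (n : ℕ) → ℕ → Ω' → V n} {e : ℕ → ℕ → Ω' → ℝ} {H : ∀ n, V n → Ω → ℝ} {p : ℕ}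

lemma prod_real_eq' {S : Set (Ω × Ω')} (hS : MeasurableSet S) :
    (Pe.prod Pw).real S = ∫ ω, Pw.real {ω' | (ω, ω') ∈ S} ∂Pe := by
  rw [measureReal_def, Measure.prod_apply hS, integral_eq_lintegral_of_nonneg_ae]
  · congr 1
    refine lintegral_congr fun ω' => ?_
    rw [measureReal_def, ENNReal.ofReal_toReal (measure_ne_top _ _)]; rfl
  · exact Eventually.of_forall fun _ => measureReal_nonneg
  · exact (measurable_measure_prodMk_left hS).ennreal_toReal.aestronglyMeasurable

/-- the clock event -/
def SE (H : ∀ n, V n → Ω → ℝ) (J : (n : ℕ) → ℕ → Ω' → V n) (e : ℕ → ℕ → Ω' → ℝ) (β : ℕ → ℝ) (n : ℕ) (b : ℝ) :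
    Set (Ω × Ω') :=
  {q | exp (β n * b) < ∑ j ∈ Icc 1 (θseq n), exp (β n * XJ H J n j q) * e n j q.2}

lemma measurableSet_SE (hm : ∀ n x, Measurable (H n x)) (hJmeas : ∀ n i, Measurable (J n i))
    (hemeas : ∀ n i, Measurable (e n i)) (β : ℕ → ℝ) (n : ℕ) (b : ℝ) : MeasurableSet (SE H J e β n b) := by
  refine measurableSet_lt measurable_const ?_
  refine Finset.measurable_fun_sum _ fun j _ => ?_
  exact (Real.measurable_exp.comp ((measurable_XJ hm hJmeas n j).const_mul _)).mul ((hemeas n j).comp measurable_snd)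

lemma measurableSet_QE (hm : ∀ n x, Measurable (H n x)) (hJmeas : ∀ n i, Measurable (J n i)) (n : ℕ) (b : ℝ) :
    MeasurableSet {q : Ω × Ω' | ∃ j ∈ Icc 1 (θseq n), b < XJ H J n j q} := by
  have : {q : Ω × Ω' | ∃ j ∈ Icc 1 (θseq n), b < XJ H J n j q} = ⋃ j ∈ Icc 1 (θseq n), {q : Ω × Ω' | b < XJ H J n j q} := by
    ext q; simp
  rw [this]
  exact Finset.measurableSet_biUnion _ fun j _ => measurableSet_lt measurable_const (measurable_XJ hm hJmeas n j)

lemma nu_eq (hm : ∀ n x, Measurable (H n x)) (hJmeas : ∀ n i, Measurable (J n i))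
    (hemeas : ∀ n i, Measurable (e n i)) {c u t : ℝ} (hu : 0 < u) (β : ℕ → ℝ) {n : ℕ} (hn : n ≠ 0) :
    ∫ ω, nuSum Pw J e c β n t u (fun x => H n x ω) ∂Pe =
      kseq c n t * (Pe.prod Pw).real (SE H J e β n (bG (γseq c n) n (Real.log u))) := by
  rw [prod_real_eq' (measurableSet_SE hm hJmeas hemeas _ _ _), ← integral_const_mul]
  unfold nuSum
  rw [thr_eq hu β hn]
  rfl

lemma SE_upper (hm : ∀ n x, Measurable (H n x)) (hJmeas : ∀ n i, Measurable (J n i))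
    (hemeas : ∀ n i, Measurable (e n i)) (hlaw : WalkExpLaw Pw J e)
    {c : ℝ} {β : ℕ → ℝ} {β₀ : ℝ} (hβ₀ : 0 < β₀) {n : ℕ} (hn : n ≠ 0) (hβ : β₀ ≤ β n) (s : ℝ) {η : ℝ} (hη : 0 < η)
    (hbig : 3 * ((n : ℝ) ^ 3 * exp (-(β₀ * η) * (γseq c n)⁻¹)) ≤ 1) :
    (Pe.prod Pw).real (SE H J e β n (bG (γseq c n) n s)) ≤ QJ Pe Pw H J c n (s - η) + θseq n * exp (-n) := by
  have hg := gam_pos (c := c) hn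
  have hsub : SE H J e β n (bG (γseq c n) n s) ⊆
      {q | ∃ j ∈ Icc 1 (θseq n), bG (γseq c n) n (s - η) < XJ H J n j q} ∪
      ⋃ j ∈ Icc 1 (θseq n), Prod.snd ⁻¹' {ω' | (n : ℝ) < e n j ω'} := by
    intro q hq
    by_contra hcon
    rw [Set.mem_union, not_or] at hcon
    obtain ⟨h1, h2⟩ := hcon
    have h1 : ∀ j ∈ Icc 1 (θseq n), XJ H J n j q ≤ bG (γseq c n) n (s - η) := by
      intro j hj
      by_contra h
      exact h1 ⟨j, hj, not_le.1 h⟩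
    have h2 : ∀ j ∈ Icc 1 (θseq n), e n j q.2 ≤ n := by
      intro j hj
      by_contra h
      exact h2 (Set.mem_biUnion hj (not_le.1 h))
    have hq : exp (β n * bG (γseq c n) n s) < ∑ j ∈ Icc 1 (θseq n), exp (β n * XJ H J n j q) * e n j q.2 := hq
    have h3 : ∑ j ∈ Icc 1 (θseq n), exp (β n * XJ H J n j q) * e n j q.2 ≤
        (θseq n : ℝ) * (exp (β n * bG (γseq c n) n (s - η)) * n) := by
      refine (Finset.sum_le_card_nsmul _ _ (exp (β n * bG (γseq c n) n (s - η)) * n) ?_).trans (le_of_eq ?_)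
      · intro j hj
        have hβn : 0 ≤ β n := by linarith
        calc exp (β n * XJ H J n j q) * e n j q.2 ≤ exp (β n * XJ H J n j q) * n := by gcongr; exact h2 j hj
          _ ≤ _ := by gcongr; exact h1 j hj
      · rw [nsmul_eq_mul, Nat.card_Icc, Nat.add_sub_cancel]
    have h4 : exp (β n * bG (γseq c n) n (s - η)) ≤ exp (β n * bG (γseq c n) n s) * exp (-(β₀ * η) * (γseq c n)⁻¹) := by
      rw [← Real.exp_add, Real.exp_le_exp]
      unfold bG
      have : 0 ≤ (β n - β₀) * (η * (γseq c n)⁻¹) := mul_nonneg (by linarith) (by positivity)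
      rw [sub_div, div_eq_mul_inv, div_eq_mul_inv]
      nlinarith
    have h5 : (θseq n : ℝ) * (exp (β n * bG (γseq c n) n (s - η)) * n) ≤ exp (β n * bG (γseq c n) n s) := by
      calc (θseq n : ℝ) * (exp (β n * bG (γseq c n) n (s - η)) * n)
          ≤ (θseq n : ℝ) * (exp (β n * bG (γseq c n) n s) * exp (-(β₀ * η) * (γseq c n)⁻¹) * n) := by gcongr
        _ = exp (β n * bG (γseq c n) n s) * (3 * ((n : ℝ) ^ 3 * exp (-(β₀ * η) * (γseq c n)⁻¹))) := by
          rw [theta_cast]; ring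
        _ ≤ exp (β n * bG (γseq c n) n s) * 1 := by gcongr
        _ = _ := mul_one _
    linarith
  refine (measureReal_mono hsub (measure_ne_top _ _)).trans ((measureReal_union_le _ _).trans ?_)
  refine add_le_add le_rfl ?_
  refine (measureReal_biUnion_finset_le _ _).trans ((Finset.sum_le_card_nsmul _ _ (exp (-n)) ?_).trans (le_of_eq ?_))
  · intro j _
    rw [measurePreserving_snd.measureReal_preimage (measurableSet_lt measurable_const (hemeas n j)).nullMeasurableSet]
    exact (exp_marg hJmeas hemeas hlaw hn j n (by positivity)).le
  · rw [nsmul_eq_mul, Nat.card_Icc, Nat.add_sub_cancel]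

lemma SE_lower (hm : ∀ n x, Measurable (H n x)) (hJmeas : ∀ n i, Measurable (J n i))
    (hemeas : ∀ n i, Measurable (e n i)) (hlaw : WalkExpLaw Pw J e)
    {c : ℝ} {β : ℕ → ℝ} {β₀ : ℝ} (hβ₀ : 0 < β₀) {n : ℕ} (hn : n ≠ 0) (hβ : β₀ ≤ β n) (s : ℝ) {η : ℝ} (hη : 0 < η)
    (hbig : (n : ℝ) ^ 3 * exp (-(β₀ * η) * (γseq c n)⁻¹) ≤ 1) :
    exp (-((θseq n + 1) * ((n : ℝ) ^ 3)⁻¹)) * QJ Pe Pw H J c n (s + η) ≤ (Pe.prod Pw).real (SE H J e β n (bG (γseq c n) n s)) := by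
  have hg := gam_pos (c := c) hn
  have hn0 : (0 : ℝ) < n := by positivity
  have hSm := measurableSet_SE hm hJmeas hemeas β n (bG (γseq c n) n s)
  have hQm := measurableSet_QE hm hJmeas n (bG (γseq c n) n (s + η))
  unfold QJ
  rw [prod_real_eq' hSm, prod_real_eq' hQm, ← integral_const_mul]
  have hIntg : ∀ {S : Set (Ω × Ω')}, MeasurableSet S → Integrable (fun ω => Pw.real {ω' | (ω, ω') ∈ S}) Pe := by
    intro S hS
    refine Integrable.of_bound (C := 1) (measurable_measure_prodMk_left hS).ennreal_toReal.aestronglyMeasurable ?_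
    refine Eventually.of_forall fun ω' => ?_
    rw [Real.norm_eq_abs, abs_of_nonneg measureReal_nonneg]; exact measureReal_le_one
  refine integral_mono ((hIntg hQm).const_mul _) (hIntg hSm) fun ω => ?_
  set S : Set (Fin (θseq n + 1) → V n) := {xs | ∃ j : Fin (θseq n + 1), 1 ≤ (j : ℕ) ∧ bG (γseq c n) n (s + η) < H n (xs j) ω} with hS
  have e1 : {ω' | (ω, ω') ∈ {q : Ω × Ω' | ∃ j ∈ Icc 1 (θseq n), bG (γseq c n) n (s + η) < XJ H J n j q}} =
      {ω' | pathJ J n (θseq n) ω' ∈ S} := by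
    ext ω'
    constructor
    · rintro ⟨j, hj, h⟩
      rw [Finset.mem_Icc] at hj
      exact ⟨⟨j, by omega⟩, hj.1, h⟩
    · rintro ⟨j, hj, h⟩
      exact ⟨j, Finset.mem_Icc.2 ⟨hj, by have := j.2; omega⟩, h⟩
  have h2 := law_path_exp hJmeas hemeas hlaw hn (θseq n) S ((n : ℝ) ^ 3)⁻¹ (by positivity)
  show exp (-((θseq n + 1) * ((n : ℝ) ^ 3)⁻¹)) * Pw.real {ω' | (ω, ω') ∈ {q : Ω × Ω' | ∃ j ∈ Icc 1 (θseq n), bG (γseq c n) n (s + η) < XJ H J n j q}} ≤ _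
  rw [e1, mul_comm, ← h2]
  refine measureReal_mono ?_ (measure_ne_top _ _)
  rintro ω' ⟨⟨j, hj, h⟩, he⟩
  show exp (β n * bG (γseq c n) n s) < ∑ j ∈ Icc 1 (θseq n), exp (β n * XJ H J n j (ω, ω')) * e n j ω'
  have hy : (0 : ℝ) < ((n : ℝ) ^ 3)⁻¹ := by positivity
  have hβn : 0 < β n := by linarith
  have h3 : exp (β n * XJ H J n j (ω, ω')) * e n j ω' ≤ ∑ j ∈ Icc 1 (θseq n), exp (β n * XJ H J n j (ω, ω')) * e n j ω' := by
    refine Finset.single_le_sum (f := fun j : ℕ => exp (β n * XJ H J n j (ω, ω')) * e n j ω') (fun i hi => ?_)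
      (Finset.mem_Icc.2 ⟨hj, by have := j.2; omega⟩)
    rw [Finset.mem_Icc] at hi
    have := he ⟨i, by omega⟩
    exact mul_nonneg (exp_pos _).le (hy.trans this).le
  refine lt_of_lt_of_le ?_ h3
  have hX : bG (γseq c n) n (s + η) < XJ H J n j (ω, ω') := h
  have h4 : exp (β n * bG (γseq c n) n s) ≤ exp (β n * bG (γseq c n) n (s + η)) * exp (-(β₀ * η) * (γseq c n)⁻¹) := by
    rw [← Real.exp_add, Real.exp_le_exp]
    unfold bG
    have : 0 ≤ (β n - β₀) * (η * (γseq c n)⁻¹) := mul_nonneg (by linarith) (by positivity)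
    rw [add_div, div_eq_mul_inv, div_eq_mul_inv]
    nlinarith
  have h5 : exp (-(β₀ * η) * (γseq c n)⁻¹) ≤ ((n : ℝ) ^ 3)⁻¹ := by
    have hn3 : (0:ℝ) < (n:ℝ)^3 := by positivity
    rw [← one_div ((n:ℝ)^3), le_div_iff₀ hn3, mul_comm]; exact hbig
  calc exp (β n * bG (γseq c n) n s) ≤ exp (β n * bG (γseq c n) n (s + η)) * exp (-(β₀ * η) * (γseq c n)⁻¹) := h4
    _ ≤ exp (β n * bG (γseq c n) n (s + η)) * ((n : ℝ) ^ 3)⁻¹ := by gcongr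
    _ ≤ exp (β n * XJ H J n j (ω, ω')) * ((n : ℝ) ^ 3)⁻¹ := by gcongr
    _ < exp (β n * XJ H J n j (ω, ω')) * e n j ω' := by
      have := he j
      gcongr

lemma f_tendsto : Tendsto (fun n : ℕ => exp (-((θseq n + 1) * ((n : ℝ) ^ 3)⁻¹))) atTop (nhds 1) := by
  have h0 := tendsto_inv_atTop_nhds_zero_nat (𝕜 := ℝ)
  have h1 : Tendsto (fun n : ℕ => -(3 * ((n : ℝ))⁻¹ + ((n : ℝ)⁻¹) ^ 3)) atTop (nhds 0) := by
    have := ((h0.const_mul 3).add (h0.pow 3)).neg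
    simpa using this
  have h2 := (Real.continuous_exp.tendsto 0).comp h1
  rw [Real.exp_zero] at h2
  refine h2.congr' ?_
  filter_upwards [eventually_ne_atTop 0] with n hn
  have hn0 : (0 : ℝ) < n := by positivity
  simp only [Function.comp]
  congr 1
  rw [theta_cast]; field_simp

lemma kQ_tendsto (hp : 2 ≤ p) {c : ℝ} (hc : 0 < c) (hc2 : c < 1 / 2)
    (hm : ∀ n x, Measurable (H n x)) (hJmeas : ∀ n i, Measurable (J n i))
    (hemeas : ∀ n i, Measurable (e n i)) (hlaw : WalkExpLaw Pw J e)
    (hH : ∀ n, IsCenteredGaussianVector Pe (H n) (fun x y => (n : ℝ) * overlap n x y ^ p)) (s : ℝ) {t : ℝ} (ht : 0 < t) :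
    Tendsto (fun n : ℕ => (kseq c n t : ℝ) * QJ Pe Pw H J c n s) atTop (nhds (t * (2 * p * exp (-s)))) := by
  refine ((kseq_tendsto hc hc2 ht).mul (QJ_tendsto hp hc hc2 hm hJmeas hemeas hlaw hH s)).congr' ?_
  filter_upwards [eventually_ne_atTop 0] with n hn
  have ha := aseq_pos (c := c) hn
  have hθ : (0 : ℝ) < θseq n := by rw [theta_cast]; positivity
  field_simp

lemma main_aux (hp : 2 ≤ p) {c : ℝ} (hc : 0 < c) (hc2 : c < 1 / 2)
    (hm : ∀ n x, Measurable (H n x)) (hJmeas : ∀ n i, Measurable (J n i))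
    (hemeas : ∀ n i, Measurable (e n i)) (hlaw : WalkExpLaw Pw J e)
    (hH : ∀ n, IsCenteredGaussianVector Pe (H n) (fun x y => (n : ℝ) * overlap n x y ^ p))
    {β : ℕ → ℝ} {β₀ : ℝ} (hβ₀ : 0 < β₀) (hβ : ∀ n, β₀ ≤ β n) {u t : ℝ} (hu : 0 < u) (ht : 0 < t) :
    Tendsto (fun n => ∫ ω, nuSum Pw J e c β n t u (fun x => H n x ω) ∂Pe) atTop (nhds (2 * p * t / u)) := by
  set s := Real.log u with hs
  have hlim : 2 * p * t / u = t * (2 * p * exp (-s)) := by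
    rw [hs, Real.exp_neg, Real.exp_log hu]; field_simp
  rw [hlim]
  have hbig : ∀ {η : ℝ}, 0 < η → ∀ᶠ n : ℕ in atTop, 3 * ((n : ℝ) ^ 3 * exp (-(β₀ * η) * (γseq c n)⁻¹)) ≤ 1 := by
    intro η hη
    have := (polyexp2 hc 3 (mul_pos hβ₀ hη)).const_mul 3
    rw [mul_zero] at this
    exact this.eventually (ge_mem_nhds one_pos)
  refine tendsto_order.2 ⟨fun a ha => ?_, fun a ha => ?_⟩
  · have tt : Tendsto (fun η : ℝ => t * (2 * p * exp (-(s + η)))) (nhdsWithin 0 (Set.Ioi 0)) (nhds (t * (2 * p * exp (-s)))) := by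
      have := (by fun_prop : Continuous fun η : ℝ => t * (2 * p * exp (-(s + η)))).tendsto 0
      simp only [add_zero] at this
      exact this.mono_left nhdsWithin_le_nhds
    obtain ⟨η, h1, h2⟩ := ((tt.eventually (lt_mem_nhds ha)).and self_mem_nhdsWithin).exists
    have h3 := f_tendsto.mul (kQ_tendsto hp hc hc2 hm hJmeas hemeas hlaw hH (s + η) ht)
    rw [one_mul] at h3
    filter_upwards [eventually_ne_atTop 0, h3.eventually (lt_mem_nhds h1), hbig h2] with n hn h4 h5
    rw [nu_eq hm hJmeas hemeas hu β hn]
    refine h4.trans_le ?_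
    have hpos : 0 ≤ (n : ℝ) ^ 3 * exp (-(β₀ * η) * (γseq c n)⁻¹) := by positivity
    have h6 := SE_lower (Pe := Pe) hm hJmeas hemeas hlaw hβ₀ hn (hβ n) s h2 (c := c) (by linarith)
    calc exp (-((θseq n + 1) * ((n : ℝ) ^ 3)⁻¹)) * (kseq c n t * QJ Pe Pw H J c n (s + η))
        = kseq c n t * (exp (-((θseq n + 1) * ((n : ℝ) ^ 3)⁻¹)) * QJ Pe Pw H J c n (s + η)) := by ring
      _ ≤ _ := by gcongr
  · have tt : Tendsto (fun η : ℝ => t * (2 * p * exp (-(s - η)))) (nhdsWithin 0 (Set.Ioi 0)) (nhds (t * (2 * p * exp (-s)))) := by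
      have := (by fun_prop : Continuous fun η : ℝ => t * (2 * p * exp (-(s - η)))).tendsto 0
      simp only [sub_zero] at this
      exact this.mono_left nhdsWithin_le_nhds
    obtain ⟨η, h1, h2⟩ := ((tt.eventually (gt_mem_nhds ha)).and self_mem_nhdsWithin).exists
    have h3 := (kQ_tendsto hp hc hc2 hm hJmeas hemeas hlaw hH (s - η) ht).add (kexp_tendsto hc hc2 ht)
    rw [add_zero] at h3
    filter_upwards [eventually_ne_atTop 0, h3.eventually (gt_mem_nhds h1), hbig h2] with n hn h4 h5
    rw [nu_eq hm hJmeas hemeas hu β hn]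
    refine lt_of_le_of_lt ?_ h4
    have h6 := SE_upper (Pe := Pe) hm hJmeas hemeas hlaw hβ₀ hn (hβ n) s h2 (c := c) h5
    rw [← mul_add]
    gcongr

end fin2

/-- Convergence of the annealed intensity (Proposition 3.2):
`𝔼[ν_n^t(u,∞)] → 2p·t·u⁻¹` for the `p`-spin SK model. -/
theorem expectation_nu_tendsto
    (p : ℕ) (hp : 2 ≤ p) (c : ℝ) (hc0 : 0 < c) (hc1 : c < 1 / 2)
    (β : ℕ → ℝ) (β₀ : ℝ) (hβ₀ : 0 < β₀) (hβ : ∀ n : ℕ, β₀ ≤ β n)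
    (B : ℝ) (hB : ∀ n : ℕ, γseq c n * β n ≤ B)
    {Ω : Type*} [MeasurableSpace Ω] (Pe : Measure Ω) [IsProbabilityMeasure Pe]
    (H : (n : ℕ) → V n → Ω → ℝ) (hHmeas : ∀ n x, Measurable (H n x))
    (hH : ∀ n : ℕ, IsCenteredGaussianVector Pe (H n)
      (fun x y => (n : ℝ) * overlap n x y ^ p))
    {Ω' : Type*} [MeasurableSpace Ω'] (Pw : Measure Ω') [IsProbabilityMeasure Pw]
    (J : (n : ℕ) → ℕ → Ω' → V n) (e : ℕ → ℕ → Ω' → ℝ)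
    (hJmeas : ∀ n i, Measurable (J n i)) (hemeas : ∀ n i, Measurable (e n i))
    (hlaw : WalkExpLaw Pw J e) :
    ∀ u : ℝ, 0 < u → ∀ t : ℝ, 0 < t →
      Tendsto (fun n => ∫ ω, nuSum Pw J e c β n t u (fun x => H n x ω) ∂Pe)
        atTop (nhds (2 * p * t / u)) := by
  intro u hu t ht
  exact main_aux hp hc0 hc1 hHmeas hJmeas hemeas hlaw hH hβ₀ hβ hu ht
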